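/- There is a constant D₀ such that the following holds for every 0 < c ≤ 1/12. Let D > D₀ be a prime with D ≡ 3 (mod 4) and suppose Hypothesis H(c) holds for L(s, χ_D). Let χ be a nontrivial character of the ideal class group of K = ℚ(√−D), and let F : ℂ → ℂ be any entire function satisfying F(s) = Σ_{n≥1} λ_χ(n) n^{−s} for all s with Re s > 1. Then every zero ρ = β + iγ of F with |γ| ≤ 1 satisfies β ≤ 1 − c/log D. -/

import Mathlib

open NumberField
open scoped Classical

/-- The ideal class of a nonzero integral ideal (junk value `1` for the zero ideal). -/
noncomputable def idealClass (K : Type) [Field K] [NumberField K] (I : Ideal (𝓞 K)) :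
    ClassGroup (𝓞 K) :=
  if h : I ∈ nonZeroDivisors (Ideal (𝓞 K)) then ClassGroup.mk0 ⟨I, h⟩ else 1

/-- `lambdaChi K χ n = Σ_{N𝔞 = n} χ(𝔞)`, the sum over integral ideals of norm `n`. -/
noncomputable def lambdaChi (K : Type) [Field K] [NumberField K]
    (χ : ClassGroup (𝓞 K) →* ℂ) (n : ℕ) : ℂ :=
  ∑ᶠ I ∈ {I : Ideal (𝓞 K) | Ideal.absNorm I = n ∧ I ≠ 0}, χ (idealClass K I)

/-- The Kronecker symbol χ_D(n) = (−D/n), as the quadratic Dirichlet character mod `D`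
(for prime `D ≡ 3 (mod 4)` this is the Legendre symbol character mod `D`). -/
noncomputable def chiD (D : ℕ) [Fact (Nat.Prime D)] : DirichletCharacter ℂ D :=
  (quadraticChar (ZMod D)).ringHomComp (Int.castRingHom ℂ)

/-- Hypothesis H(c): every zero ρ of L(s, χ_D) with |Im ρ| ≤ 1 has Re ρ ≤ 1 - c/log D. -/
def HypH (c : ℝ) (D : ℕ) [Fact (Nat.Prime D)] : Prop :=
  ∀ ρ : ℂ, (chiD D).LFunction ρ = 0 → |ρ.im| ≤ 1 → ρ.re ≤ 1 - c / Real.log D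

section JensenType

open Metric Complex Real MeasureTheory

/-- First Fourier coefficient of `log ‖G‖` on a circle, for a nonvanishing analytic function. -/
theorem re_logDeriv_eq_circleAverage {G : ℂ → ℂ} {c : ℂ} {r : ℝ} (hr : 0 < r)
    (hG : AnalyticOnNhd ℂ G (closedBall c r)) (h0 : ∀ z ∈ closedBall c r, G z ≠ 0) :
    r * (logDeriv G c).re =
      circleAverage (fun z => 2 * ((z - c).re / r) * Real.log ‖G z‖) c r := by
  obtain ⟨δ, hδ, hsub⟩ : ∃ δ, 0 < δ ∧ ∀ z ∈ ball c (r + δ), AnalyticAt ℂ G z ∧ G z ≠ 0 := by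
    have hopen : IsOpen {z | AnalyticAt ℂ G z ∧ G z ≠ 0} := by
      rw [isOpen_iff_mem_nhds]
      rintro z ⟨hz, hz'⟩
      filter_upwards [hz.eventually_analyticAt, hz.continuousAt.eventually_ne hz'] with w h1 h2
      exact ⟨h1, h2⟩
    obtain ⟨δ, hδ, h⟩ := (isCompact_closedBall c r).exists_thickening_subset_open hopen
      (fun z hz => ⟨hG z hz, h0 z hz⟩)
    rw [thickening_closedBall hδ hr.le] at h
    exact ⟨δ, hδ, fun z hz => h (by rwa [add_comm])⟩
  set B := ball c (r + δ) with hB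
  have hcB : c ∈ B := mem_ball_self (by positivity)
  have hclB : closedBall c r ⊆ B := closedBall_subset_ball (by linarith)
  have hBo : IsOpen B := isOpen_ball
  have hld : DifferentiableOn ℂ (logDeriv G) B := fun z hz =>
    ((hsub z hz).1.deriv.differentiableAt.div (hsub z hz).1.differentiableAt
      (hsub z hz).2).differentiableWithinAt
  obtain ⟨h, hhc, hh⟩ := (hld.isExactOn_ball).with_val_at c 0
  have hhd : DifferentiableOn ℂ h B := fun z hz => (hh z hz).differentiableAt.differentiableWithinAt
  have hexp : ∀ z ∈ B, G z = G c * cexp (h z) := by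
    have hconst : ∀ z ∈ B, G z * cexp (-h z) = G c * cexp (-h c) := by
      intro z hz
      refine (convex_ball c (r + δ)).is_const_of_fderivWithin_eq_zero (𝕜 := ℂ)
        (f := fun w => G w * cexp (-h w)) ?_ ?_ hz hcB
      · intro w hw
        exact ((hsub w hw).1.differentiableAt.mul
          (hh w hw).differentiableAt.neg.cexp).differentiableWithinAt
      · intro w hw
        rw [fderivWithin_of_isOpen hBo hw]
        have : HasDerivAt (fun w => G w * cexp (-h w)) 0 w := by
          have h1 := (hsub w hw).1.differentiableAt.hasDerivAt.mul (hh w hw).neg.cexp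
          have h2 : deriv G w * cexp ((-h) w) + G w * (cexp ((-h) w) * -logDeriv G w) = 0 := by
            have := (hsub w hw).2
            rw [logDeriv_apply]
            field_simp
            ring
          rw [h2] at h1
          exact h1
        rw [this.hasFDerivAt.fderiv]
        ext; simp
    intro z hz
    have := hconst z hz
    rw [hhc, neg_zero, Complex.exp_zero, mul_one, Complex.exp_neg] at this
    field_simp at this
    rw [this, mul_comm]
  have hlog : ∀ z ∈ B, Real.log ‖G z‖ = Real.log ‖G c‖ + (h z).re := by
    intro z hz
    rw [hexp z hz, norm_mul, Complex.norm_exp, Real.log_mul (norm_ne_zero_iff.2 (hsub c hcB).2)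
      (Real.exp_pos _).ne', Real.log_exp]
  set q : ℂ → ℂ := fun z => r * dslope h c z + h z * ((z - c) / r)
    + 2 * Real.log ‖G c‖ * ((z - c) / r) with hq
  have hqd : DifferentiableOn ℂ q B := by
    have := (Complex.differentiableOn_dslope (hBo.mem_nhds hcB)).2 hhd
    refine ((this.const_mul _).add (hhd.mul ?_)).add ?_ <;> fun_prop
  have hav : circleAverage q c r = r * logDeriv G c := by
    have h1 : DiffContOnCl ℂ q (ball c |r|) := by
      rw [abs_of_pos hr]
      refine (hqd.mono ?_).diffContOnCl
      rw [closure_ball _ hr.ne']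
      exact hclB
    rw [h1.circleAverage, hq]
    simp [dslope_same, (hh c hcB).deriv]
  have hci : CircleIntegrable q c r := by
    refine ContinuousOn.circleIntegrable hr.le (hqd.continuousOn.mono ?_)
    exact sphere_subset_closedBall.trans hclB
  have : r * (logDeriv G c).re = reCLM (circleAverage q c r) := by
    rw [hav]; simp
  rw [this, ← ContinuousLinearMap.circleAverage_comp_comm _ hci]
  refine circleAverage_congr_sphere fun z hz => ?_
  rw [abs_of_pos hr] at hz
  have hzB : z ∈ B := hclB (sphere_subset_closedBall hz)
  have hzc : ‖z - c‖ = r := by simpa [dist_eq_norm] using hz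
  have hne : z - c ≠ 0 := by
    intro h; rw [h, norm_zero] at hzc; exact hr.ne hzc
  have hzne : z ≠ c := sub_ne_zero.1 hne
  simp only [Function.comp_apply, reCLM_apply, hq, hlog z hzB]
  rw [dslope_of_ne _ hzne, slope_def_field, hhc, sub_zero]
  have hn : (z - c).re ^ 2 + (z - c).im ^ 2 = r ^ 2 := by
    rw [← hzc, Complex.sq_norm, Complex.normSq_apply]; ring
  have e1 : (r : ℂ) * (h z / (z - c)) = h z * ((starRingEnd ℂ) (z - c) / r) := by
    have : (z - c) * (starRingEnd ℂ) (z - c) = (r : ℂ) ^ 2 := by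
      rw [Complex.mul_conj, Complex.normSq_eq_norm_sq, hzc]; push_cast; ring
    have hr' : (r : ℂ) ≠ 0 := by exact_mod_cast hr.ne'
    field_simp
    rw [← this]; ring
  rw [e1]
  have e2 : h z * ((starRingEnd ℂ) (z - c) / r) + h z * ((z - c) / r)
      = ((2 * ((z - c).re / r) : ℝ) : ℂ) * h z := by
    have : (z - c) + (starRingEnd ℂ) (z - c) = ((2 * (z - c).re : ℝ) : ℂ) := by
      rw [Complex.add_conj]
    have h2 : (((2 * ((z - c).re / r) : ℝ)) : ℂ) = ((2 * (z - c).re : ℝ) : ℂ) / r := by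
      push_cast; ring
    rw [h2, ← this]; ring
  rw [e2]
  have e3 : (2 : ℂ) * Real.log ‖G c‖ * ((z - c) / r)
      = ((2 * Real.log ‖G c‖ / r : ℝ) : ℂ) * (z - c) := by push_cast; ring
  rw [e3, Complex.add_re, Complex.re_ofReal_mul, Complex.re_ofReal_mul]
  ring

end JensenType

section Factorization

open Metric Complex Real Set Filter Topology

/-- An analytic function on a closed disc, nonzero at the centre, is a polynomial times a
nonvanishing analytic function. -/
theorem exists_prod_mul_eq_of_analyticOnNhd {F : ℂ → ℂ} {c : ℂ} {r : ℝ} (hr : 0 < r)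
    (hF : AnalyticOnNhd ℂ F (closedBall c r)) (hc : F c ≠ 0) :
    ∃ (S : Finset ℂ) (m : ℂ → ℕ) (g : ℂ → ℂ), AnalyticOnNhd ℂ g (closedBall c r) ∧
      (∀ z ∈ closedBall c r, g z ≠ 0) ∧ (∀ u ∈ S, 0 < m u) ∧ (∀ u ∈ S, u ∈ closedBall c r) ∧
      ∀ z ∈ closedBall c r, F z = (∏ u ∈ S, (z - u) ^ m u) * g z := by
  set U := closedBall c r with hU
  have hcU : c ∈ U := mem_closedBall_self hr.le
  have hpre : IsPreconnected U := (convex_closedBall c r).isPreconnected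
  have hperf : Preperfect U := by
    refine IsPreconnected.preperfect_of_nontrivial ?_ hpre
    refine ⟨c, hcU, c + r, ?_, ?_⟩
    · simp [hU, abs_of_pos hr]
    · simp [hr.ne']
  have hord : ∀ u : U, meromorphicOrderAt F u ≠ ⊤ := by
    intro u
    refine hF.meromorphicOn.meromorphicOrderAt_ne_top_of_isPreconnected (x := c) hpre hcU u.2 ?_
    rw [(hF c hcU).meromorphicOrderAt_eq, (hF c hcU).analyticOrderAt_eq_zero.2 hc]
    simp
  have hfin : (MeromorphicOn.divisor F U).support.Finite :=
    (MeromorphicOn.divisor F U).finiteSupport (isCompact_closedBall c r)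
  obtain ⟨g, hg, hg0, heq⟩ := hF.meromorphicOn.extract_zeros_poles hord hfin
  have hnn : 0 ≤ MeromorphicOn.divisor F U := MeromorphicOn.AnalyticOnNhd.divisor_nonneg hF
  set d := MeromorphicOn.divisor F U with hd
  refine ⟨hfin.toFinset, fun u => (d u).toNat, g, hg, fun z hz => hg0 ⟨z, hz⟩, ?_, ?_, ?_⟩
  · intro u hu
    have h1 : d u ≠ 0 := by simpa using hu
    have h2 : 0 ≤ d u := hnn u
    exact Int.pos_iff_toNat_pos.1 (lt_of_le_of_ne h2 (Ne.symm h1))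
  · intro u hu
    exact d.supportWithinDomain (by simpa using hu)
  · have hprod : (∏ᶠ u, (fun z => z - u) ^ d u : ℂ → ℂ) =
        fun z => ∏ u ∈ hfin.toFinset, (z - u) ^ (d u).toNat := by
      rw [Function.FactorizedRational.finprod_eq_fun hfin]
      funext z
      rw [finprod_eq_prod_of_mulSupport_subset (s := hfin.toFinset)]
      · refine Finset.prod_congr rfl fun u _ => ?_
        rw [← zpow_natCast, Int.toNat_of_nonneg (hnn u)]
      · intro u hu
        simp only [Function.mem_mulSupport] at hu
        simp only [Finite.coe_toFinset, Function.mem_support]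
        intro h
        simp [h] at hu
    rw [hprod] at heq
    intro z hz
    have han : AnalyticAt ℂ (fun z => (∏ u ∈ hfin.toFinset, (z - u) ^ (d u).toNat) * g z) z := by
      refine AnalyticAt.mul ?_ (hg z hz)
      fun_prop
    have h1 := MeromorphicAt.eventuallyEq_nhdsNE_of_eventuallyEq_codiscreteWithin_preperfect
      (hF z hz).meromorphicAt (g := fun z => (∏ u ∈ hfin.toFinset, (z - u) ^ (d u).toNat) * g z)
      han.meromorphicAt hz hperf heq
    have h2 := ((hF z hz).continuousAt.eventuallyEq_nhds_iff_eventuallyEq_nhdsNE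
      han.continuousAt).1 h1
    exact h2.eq_of_nhds

end Factorization

section Blaschke

open Metric Complex Real Set Filter Topology ComplexConjugate

private theorem logDeriv_prod_pow_mul {S : Finset ℂ} {m : ℂ → ℕ} {B : ℂ → ℂ → ℂ} {g : ℂ → ℂ}
    {c : ℂ} (hB : ∀ u ∈ S, DifferentiableAt ℂ (B u) c) (hB0 : ∀ u ∈ S, B u c ≠ 0)
    (hg : DifferentiableAt ℂ g c) (hg0 : g c ≠ 0) :
    logDeriv (fun z => (∏ u ∈ S, B u z ^ m u) * g z) c =
      ∑ u ∈ S, m u * logDeriv (B u) c + logDeriv g c := by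
  rw [logDeriv_mul (f := fun z => ∏ u ∈ S, B u z ^ m u) c
    (Finset.prod_ne_zero_iff.2 fun u hu => pow_ne_zero _ (hB0 u hu)) hg0
    (DifferentiableAt.fun_finsetProd fun u hu => (hB u hu).pow _) hg]
  congr 1
  rw [logDeriv_prod (f := fun u z => B u z ^ m u) (s := S)
    (fun u hu => pow_ne_zero _ (hB0 u hu)) (fun u hu => (hB u hu).pow _)]
  exact Finset.sum_congr rfl fun u hu => logDeriv_fun_pow (hB u hu) _

/-- First-coefficient Jensen formula. -/
theorem exists_re_logDeriv_eq {F : ℂ → ℂ} {c : ℂ} {r : ℝ} (hr : 0 < r)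
    (hF : AnalyticOnNhd ℂ F (closedBall c r)) (h0 : ∀ z ∈ sphere c r, F z ≠ 0) (hc : F c ≠ 0) :
    ∃ (S : Finset ℂ) (m : ℂ → ℕ), (∀ u ∈ S, 0 < m u ∧ F u = 0 ∧ u ∈ closedBall c r) ∧
      (∀ z ∈ closedBall c r, F z = 0 → z ∈ S) ∧
      (logDeriv F c).re =
        r⁻¹ * circleAverage (fun z => 2 * ((z - c).re / r) * Real.log ‖F z‖) c r +
        ∑ u ∈ S, m u * ((c - u).re * (1 / ‖c - u‖ ^ 2 - 1 / r ^ 2)) := by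
  obtain ⟨S, m, g, hg, hg0, hm, hS, hfac⟩ := exists_prod_mul_eq_of_analyticOnNhd hr hF hc
  have hcc : c ∈ closedBall c r := mem_closedBall_self hr.le
  have hz0 : ∀ u ∈ S, F u = 0 := by
    intro u hu
    rw [hfac u (hS u hu), Finset.prod_eq_zero hu (by simp [(hm u hu).ne']), zero_mul]
  have hlt : ∀ u ∈ S, ‖u - c‖ < r := by
    intro u hu
    have h1 : ‖u - c‖ ≤ r := by simpa [dist_eq_norm] using hS u hu
    refine lt_of_le_of_ne h1 fun h => h0 u (by simp [h]) (hz0 u hu)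
  have hne : ∀ u ∈ S, c - u ≠ 0 := by
    intro u hu h
    exact hc (by rw [sub_eq_zero.1 h]; exact hz0 u hu)
  refine ⟨S, m, fun u hu => ⟨hm u hu, hz0 u hu, hS u hu⟩, ?_, ?_⟩
  · intro z hz hFz
    rw [hfac z hz] at hFz
    rcases mul_eq_zero.1 hFz with h | h
    · obtain ⟨u, hu, h⟩ := Finset.prod_eq_zero_iff.1 h
      rwa [sub_eq_zero.1 (pow_eq_zero_iff (hm u hu).ne' |>.1 h)]
    · exact absurd h (hg0 z hz)
  set B : ℂ → ℂ → ℂ := fun u z => ((r : ℂ) ^ 2 - (z - c) * conj (u - c)) / r with hB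
  have hrC : (r : ℂ) ≠ 0 := by exact_mod_cast hr.ne'
  have hB0 : ∀ u ∈ S, ∀ z ∈ closedBall c r, B u z ≠ 0 := by
    intro u hu z hz h
    have h1 : (r : ℂ) ^ 2 - (z - c) * conj (u - c) = 0 := by
      simpa [hB, hrC] using h
    have h2 : ‖(z - c) * conj (u - c)‖ = r ^ 2 := by
      rw [← sub_eq_zero.1 h1]; simp
    rw [norm_mul, RCLike.norm_conj] at h2
    have h3 : ‖z - c‖ ≤ r := by simpa [dist_eq_norm] using hz
    have := hlt u hu
    nlinarith [norm_nonneg (z - c), norm_nonneg (u - c)]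
  have hBd : ∀ u, Differentiable ℂ (B u) := by
    intro u; simp only [hB]; fun_prop
  set G : ℂ → ℂ := fun z => (∏ u ∈ S, B u z ^ m u) * g z with hG
  have hGan : AnalyticOnNhd ℂ G (closedBall c r) := by
    intro z hz
    refine AnalyticAt.mul (Finset.analyticAt_fun_prod _ fun u hu => ?_) (hg z hz)
    exact ((hBd u).analyticAt z).pow _
  have hG0 : ∀ z ∈ closedBall c r, G z ≠ 0 := fun z hz =>
    mul_ne_zero (Finset.prod_ne_zero_iff.2 fun u hu => pow_ne_zero _ (hB0 u hu z hz)) (hg0 z hz)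
  have hnorm : ∀ z ∈ sphere c r, ‖G z‖ = ‖F z‖ := by
    intro z hz
    rw [hfac z (sphere_subset_closedBall hz)]
    simp only [hG, norm_mul, norm_prod, norm_pow]
    congr 1
    refine Finset.prod_congr rfl fun u hu => ?_
    congr 1
    have hzr : ‖z - c‖ = r := by simpa [dist_eq_norm] using hz
    have h1 : (r : ℂ) ^ 2 = (z - c) * conj (z - c) := by
      rw [Complex.mul_conj, Complex.normSq_eq_norm_sq, hzr]; norm_cast
    have h2 : B u z = (z - c) * conj (z - u) / r := by
      simp only [hB, h1, map_sub]; ring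
    rw [h2, norm_div, norm_mul, RCLike.norm_conj, hzr]
    simp [abs_of_pos hr]
    field_simp
  have havg := re_logDeriv_eq_circleAverage hr hGan hG0
  rw [circleAverage_congr_sphere (f₂ := fun z => 2 * ((z - c).re / r) * Real.log ‖F z‖)
    (by rw [abs_of_pos hr]; intro z hz; simp only [hnorm z hz])] at havg
  have hdF : logDeriv F c = ∑ u ∈ S, m u * (1 / (c - u)) + logDeriv g c := by
    have h1 : F =ᶠ[𝓝 c] fun z => (∏ u ∈ S, (z - u) ^ m u) * g z := by
      filter_upwards [closedBall_mem_nhds c hr] with z hz using hfac z hz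
    rw [(logDeriv_congr_nhds h1).eq_of_nhds, logDeriv_prod_pow_mul (B := fun u z => z - u)
      (fun u _ => by fun_prop) hne (hg c hcc).differentiableAt (hg0 c hcc)]
    congr 1
    refine Finset.sum_congr rfl fun u _ => ?_
    rw [logDeriv_apply]
    simp
  have hdG : logDeriv G c = ∑ u ∈ S, m u * (conj (c - u) / r ^ 2) + logDeriv g c := by
    rw [logDeriv_prod_pow_mul (fun u _ => (hBd u) c) (fun u hu => hB0 u hu c hcc)
      (hg c hcc).differentiableAt (hg0 c hcc)]
    congr 1
    refine Finset.sum_congr rfl fun u _ => ?_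
    congr 1
    have h1 : HasDerivAt (B u) (-(1 * conj (u - c)) / r) c := by
      have := ((((hasDerivAt_id c).sub_const c).mul_const (conj (u - c))).const_sub
        ((r : ℂ) ^ 2)).div_const (r : ℂ)
      exact this
    rw [logDeriv_apply, h1.deriv]
    simp only [hB, sub_self, zero_mul, sub_zero, map_sub]
    field_simp
    ring
  have hre : (logDeriv F c).re = (logDeriv G c).re +
      ∑ u ∈ S, m u * ((c - u).re * (1 / ‖c - u‖ ^ 2 - 1 / r ^ 2)) := by
    rw [hdF, hdG]
    simp only [add_re, re_sum]
    have : ∀ u ∈ S, ((m u : ℂ) * (1 / (c - u))).re = ((m u : ℂ) * (conj (c - u) / r ^ 2)).re +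
        m u * ((c - u).re * (1 / ‖c - u‖ ^ 2 - 1 / r ^ 2)) := by
      intro u _
      rw [← ofReal_natCast, re_ofReal_mul, re_ofReal_mul, ← ofReal_pow, div_ofReal_re, conj_re,
        one_div, Complex.inv_re, Complex.normSq_eq_norm_sq]
      ring
    rw [Finset.sum_congr rfl this, Finset.sum_add_distrib]
    ring
  rw [hre, ← havg]
  field_simp

end Blaschke

section LogDerivBound

open Metric Complex Real Set Filter Topology MeasureTheory

private theorem integral_negPart_cos_sq :
    ∫ θ in (0 : ℝ)..2 * π, (max 0 (-Real.cos θ)) ^ 2 = π / 2 := by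
  have hper : Function.Periodic (fun θ : ℝ => (max 0 (-Real.cos θ)) ^ 2) (2 * π) := by
    intro θ; simp
  have h1 : ∫ θ in (0 : ℝ)..2 * π, (max 0 (-Real.cos θ)) ^ 2 =
      ∫ θ in (0 : ℝ)..2 * π, (max 0 (Real.cos θ)) ^ 2 := by
    have h2 := hper.intervalIntegral_add_eq 0 π
    rw [zero_add] at h2
    have h3 := intervalIntegral.integral_comp_add_right (a := 0) (b := 2 * π)
      (fun θ : ℝ => (max 0 (-Real.cos θ)) ^ 2) π
    rw [zero_add, add_comm (2 * π)] at h3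
    rw [h2, ← h3]
    simp
  have hc1 : Continuous (fun θ : ℝ => (max 0 (-Real.cos θ)) ^ 2) := by fun_prop
  have hc2 : Continuous (fun θ : ℝ => (max 0 (Real.cos θ)) ^ 2) := by fun_prop
  have h4 : (∫ θ in (0 : ℝ)..2 * π, (max 0 (-Real.cos θ)) ^ 2) +
      ∫ θ in (0 : ℝ)..2 * π, (max 0 (Real.cos θ)) ^ 2 = π := by
    rw [← intervalIntegral.integral_add (hc1.intervalIntegrable _ _) (hc2.intervalIntegrable _ _)]
    have : ∀ θ : ℝ, (max 0 (-Real.cos θ)) ^ 2 + (max 0 (Real.cos θ)) ^ 2 = Real.cos θ ^ 2 := by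
      intro θ
      rcases le_total 0 (Real.cos θ) with h | h
      · rw [max_eq_left (by linarith), max_eq_right h]; ring
      · rw [max_eq_right (by linarith), max_eq_left h]; ring
    simp only [this, integral_cos_sq]
    simp
  linarith

private theorem circleAverage_negPart_sq (c : ℂ) {r : ℝ} (hr : 0 < r) :
    circleAverage (fun z => (max 0 (-((z - c).re / r))) ^ 2) c r = 1 / 4 := by
  rw [circleAverage_def]
  have : ∀ θ : ℝ, (circleMap c r θ - c).re / r = Real.cos θ := by
    intro θ
    simp [circleMap, Complex.exp_re]
    field_simp
  simp only [this, integral_negPart_cos_sq, smul_eq_mul]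
  field_simp
  norm_num

/-- Upper bound for the real part of `-logDeriv F` at the centre of a disc in which the zeros of
`F` lie to the left, with an extra term for an arbitrary zero. -/
theorem exists_neg_re_logDeriv_le {F : ℂ → ℂ} {c : ℂ} {r₀ r₁ A B B' : ℝ} (hr₀ : 0 < r₀)
    (hr₁ : r₀ < r₁) (hF : AnalyticOnNhd ℂ F (closedBall c r₁)) (hc : F c ≠ 0)
    (hzero : ∀ z ∈ closedBall c r₁, F z = 0 → z.re ≤ c.re)
    (hB : 0 ≤ B) (hB' : 0 ≤ B')
    (hleft : ∀ z ∈ closedBall c r₁, F z ≠ 0 → z.re ≤ c.re →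
      Real.log ‖F z‖ ≤ A * (c.re - z.re) + B)
    (hright : ∀ z ∈ closedBall c r₁, F z ≠ 0 → c.re ≤ z.re →
      (z.re - c.re) * (-Real.log ‖F z‖) ≤ B') :
    ∃ r ∈ Icc r₀ r₁, -(logDeriv F c).re ≤ A / 2 + 2 * B / r₀ + 2 * B' / r₀ ^ 2 ∧
      ∀ ρ, F ρ = 0 → ρ.re ≤ c.re → -(logDeriv F c).re ≤ A / 2 + 2 * B / r₀ + 2 * B' / r₀ ^ 2 -
        (c - ρ).re * (1 / ‖c - ρ‖ ^ 2 - 1 / r ^ 2) := by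
  obtain ⟨S, m, g, -, hg0, -, -, hfac⟩ :=
    exists_prod_mul_eq_of_analyticOnNhd (hr₀.trans hr₁) hF hc
  obtain ⟨r, hrI, hrS⟩ : ∃ r ∈ Icc r₀ r₁, r ∉ S.image (fun u => dist u c) :=
    (Icc_infinite hr₁).exists_notMem_finset _
  have hr : 0 < r := hr₀.trans_le hrI.1
  have hsub : closedBall c r ⊆ closedBall c r₁ := closedBall_subset_closedBall hrI.2
  have hsph : ∀ z ∈ sphere c r, F z ≠ 0 := by
    intro z hz h
    have hz' := hsub (sphere_subset_closedBall hz)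
    rw [hfac z hz'] at h
    rcases mul_eq_zero.1 h with h | h
    · obtain ⟨u, hu, h⟩ := Finset.prod_eq_zero_iff.1 h
      have : z = u := sub_eq_zero.1 (eq_zero_of_pow_eq_zero h)
      exact hrS (Finset.mem_image.2 ⟨u, hu, this ▸ hz⟩)
    · exact hg0 z hz' h
  obtain ⟨S', m', hS', hmem, hform⟩ := exists_re_logDeriv_eq hr (hF.mono hsub) hsph hc
  set avg := circleAverage (fun z => 2 * ((z - c).re / r) * Real.log ‖F z‖) c r with havg
  have hbound : -(r⁻¹ * avg) ≤ A / 2 + 2 * B / r₀ + 2 * B' / r₀ ^ 2 := by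
    have hci : CircleIntegrable (fun z => 2 * ((z - c).re / r) * Real.log ‖F z‖) c r := by
      refine ContinuousOn.circleIntegrable hr.le ?_
      refine ContinuousOn.mul (by fun_prop) (ContinuousOn.log ?_ fun z hz => ?_)
      · exact ((hF.mono hsub).continuousOn.mono sphere_subset_closedBall).norm
      · simpa using hsph z hz
    have hci2 : CircleIntegrable (fun z => 2 * A * r * (max 0 (-((z - c).re / r))) ^ 2) c r := by
      refine ContinuousOn.circleIntegrable hr.le (Continuous.continuousOn ?_)
      fun_prop
    have hci3 : CircleIntegrable (fun _ : ℂ => 2 * B + 2 * B' / r) c r :=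
      ContinuousOn.circleIntegrable hr.le continuousOn_const
    have hle : -avg ≤ 2 * A * r * (1 / 4) + (2 * B + 2 * B' / r) := by
      have e1 : circleAverage (fun z => 2 * A * r * (max 0 (-((z - c).re / r))) ^ 2) c r =
          2 * A * r * (1 / 4) := by
        rw [← circleAverage_negPart_sq c hr, ← smul_eq_mul (2 * A * r)]
        exact circleAverage_fun_smul (𝕜 := ℝ) (E := ℝ)
      have e2 := circleAverage_fun_smul (𝕜 := ℝ) (E := ℝ) (a := (-1 : ℝ)) (c := c) (R := r)
        (f := fun z : ℂ => 2 * ((z - c).re / r) * Real.log ‖F z‖)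
      rw [neg_one_smul, ← havg] at e2
      have e3 := circleAverage_fun_add hci2 hci3
      rw [e1, circleAverage_const] at e3
      rw [← e2, ← e3]
      refine circleAverage_mono (hci.const_smul (a := (-1 : ℝ))) (hci2.add hci3) ?_
      intro z hz
      rw [abs_of_pos hr] at hz
      have hz' := hsub (sphere_subset_closedBall hz)
      simp only [smul_eq_mul]
      have hdr : 0 ≤ 2 * B' / r := by positivity
      rcases le_total z.re c.re with h | h
      · have h1 := hleft z hz' (hsph z hz) h
        have h2 : 0 ≤ -((z - c).re / r) := by
          rw [sub_re, ← neg_div]; exact div_nonneg (by linarith) hr.le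
        rw [max_eq_right h2]
        have h3 : c.re - z.re = r * -((z - c).re / r) := by
          rw [sub_re]; field_simp; ring
        rw [h3] at h1
        have h4 : -((z - c).re / r) ≤ 1 := by
          rw [← neg_div, div_le_one hr]
          have := Complex.abs_re_le_norm (z - c)
          rw [← dist_eq_norm, mem_sphere.1 hz] at this
          linarith [neg_abs_le (z - c).re]
        set t := -((z - c).re / r) with ht
        have h5 : (z - c).re / r = -t := by rw [ht]; ring
        rw [h5]
        nlinarith [mul_le_mul_of_nonneg_left h1 h2, mul_le_mul_of_nonneg_right h4 hB]
      · have h1 := hright z hz' (hsph z hz) h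
        have h2 : -((z - c).re / r) ≤ 0 := by
          rw [sub_re]; have := div_nonneg (sub_nonneg.2 h) hr.le; linarith
        rw [max_eq_left h2]
        have h3 : -1 * (2 * ((z - c).re / r) * Real.log ‖F z‖) =
          2 * ((z.re - c.re) * (-Real.log ‖F z‖)) / r := by rw [sub_re]; ring
        rw [h3]
        have h4 : 2 * ((z.re - c.re) * (-Real.log ‖F z‖)) / r ≤ 2 * B' / r := by gcongr
        simp only [ne_eq, OfNat.ofNat_ne_zero, not_false_eq_true, zero_pow, mul_zero]
        linarith
    have h1 : -(r⁻¹ * avg) ≤ A / 2 + 2 * B / r + 2 * B' / r ^ 2 := by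
      have := mul_le_mul_of_nonneg_left hle (inv_nonneg.2 hr.le)
      calc -(r⁻¹ * avg) = r⁻¹ * -avg := by ring
        _ ≤ _ := this
        _ = _ := by field_simp; ring
    have h2 : 2 * B / r ≤ 2 * B / r₀ := by gcongr; exact hrI.1
    have h3 : 2 * B' / r ^ 2 ≤ 2 * B' / r₀ ^ 2 := by gcongr; exact hrI.1
    linarith
  have hterm : ∀ u ∈ S', 0 ≤ (m' u : ℝ) * ((c - u).re * (1 / ‖c - u‖ ^ 2 - 1 / r ^ 2)) := by
    intro u hu
    obtain ⟨-, h1, h2⟩ := hS' u hu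
    have h3 : 0 < ‖c - u‖ := norm_pos_iff.2 fun h => hc (by rw [sub_eq_zero.1 h]; exact h1)
    have h4 : ‖c - u‖ ≤ r := by rw [← dist_eq_norm, dist_comm]; exact h2
    have h5 := hzero u (hsub h2) h1
    refine mul_nonneg (Nat.cast_nonneg _) (mul_nonneg (by rw [sub_re]; linarith) ?_)
    rw [sub_nonneg]
    gcongr
  have hfirst : -(logDeriv F c).re ≤ A / 2 + 2 * B / r₀ + 2 * B' / r₀ ^ 2 := by
    have := Finset.sum_nonneg hterm
    linarith
  refine ⟨r, hrI, hfirst, fun ρ hρ hρc => ?_⟩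
  by_cases hin : ρ ∈ closedBall c r
  · have h1 := Finset.single_le_sum hterm (hmem ρ hin hρ)
    have h2 := hterm ρ (hmem ρ hin hρ)
    have h3 : (1 : ℝ) ≤ m' ρ := by exact_mod_cast (hS' ρ (hmem ρ hin hρ)).1
    have h4 : (c - ρ).re * (1 / ‖c - ρ‖ ^ 2 - 1 / r ^ 2) ≤
        (m' ρ : ℝ) * ((c - ρ).re * (1 / ‖c - ρ‖ ^ 2 - 1 / r ^ 2)) := by
      refine le_mul_of_one_le_left ?_ h3
      exact nonneg_of_mul_nonneg_right h2 (by linarith)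
    linarith
  · have h1 : r < ‖c - ρ‖ := by
      rw [← dist_eq_norm, dist_comm]; simpa using hin
    have h2 : (c - ρ).re * (1 / ‖c - ρ‖ ^ 2 - 1 / r ^ 2) ≤ 0 := by
      refine mul_nonpos_of_nonneg_of_nonpos (by rw [sub_re]; linarith) ?_
      rw [sub_nonpos]
      gcongr
    linarith

end LogDerivBound

section QuadraticIntegers

/-- A ring with an integral basis `1, ω` such that `ω² = ω - k`, together with its conjugation. -/
structure QuadraticBasis (R : Type*) [CommRing R] (k : ℕ) where
  /-- the second basis vector -/
  ω : R
  /-- the conjugation -/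
  σ : R →+* R
  /-- the integral basis -/
  b : Module.Basis (Fin 2) ℤ R
  b_zero : b 0 = 1
  b_one : b 1 = ω
  ω_sq : ω * ω = ω - k
  σ_ω : σ ω = 1 - ω

private theorem exists_int_of_isIntegral {K : Type*} [Field K] [CharZero K] {r : ℚ}
    (h : IsIntegral ℤ ((r : ℚ) : K)) : ∃ n : ℤ, r = n := by
  have h1 : IsIntegral ℤ r := by
    rwa [← eq_ratCast (algebraMap ℚ K) r,
      isIntegral_algebraMap_iff (algebraMap ℚ K).injective] at h
  obtain ⟨n, hn⟩ := IsIntegrallyClosed.isIntegral_iff.1 h1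
  exact ⟨n, by simpa using hn.symm⟩

private theorem exists_int_of_prime_mul_sq {D : ℕ} (hD : D.Prime) {r : ℚ} {M : ℤ}
    (h : D * r ^ 2 = M) : ∃ n : ℤ, r = n := by
  have hD0 : (D : ℚ) ≠ 0 := by exact_mod_cast hD.ne_zero
  have h1 : IsIntegral ℤ ((D : ℚ) * r) := by
    refine IsIntegral.of_pow (n := 2) two_pos ?_
    have : ((D : ℚ) * r) ^ 2 = algebraMap ℤ ℚ (D * M) := by
      simp only [eq_intCast]; push_cast; rw [← h]; ring
    rw [this]
    exact isIntegral_algebraMap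
  obtain ⟨s, hs⟩ := IsIntegrallyClosed.isIntegral_iff.1 h1
  simp only [eq_intCast] at hs
  have h2 : s ^ 2 = D * M := by
    have : (s : ℚ) ^ 2 = D * M := by rw [hs, ← h]; ring
    exact_mod_cast this
  have h3 : (D : ℤ) ∣ s := (Nat.prime_iff_prime_int.1 hD).dvd_of_dvd_pow ⟨M, h2⟩
  obtain ⟨n, rfl⟩ := h3
  refine ⟨n, ?_⟩
  push_cast at hs
  exact (mul_left_cancel₀ hD0 hs).symm

/-- The integral basis of `ℚ(√-D)` for a prime `D ≡ 3 (mod 4)`. -/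
theorem nonempty_quadraticBasis {D : ℕ} (hD : D.Prime) (hD4 : D % 4 = 3) (K : Type) [Field K]
    [NumberField K] (hK : Module.finrank ℚ K = 2) (hα : ∃ α : K, α ^ 2 = -(D : K)) :
    Nonempty (QuadraticBasis (𝓞 K) ((D + 1) / 4)) := by
  obtain ⟨α, hα⟩ := hα
  set k := (D + 1) / 4 with hk
  have hDk : D + 1 = 4 * k := by omega
  have hDK : (D : K) + 1 = 4 * k := by exact_mod_cast hDk
  have hsq : ∀ q : ℚ, (q : K) ≠ α := by
    intro q hq
    have h1 : q ^ 2 = -(D : ℚ) := by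
      have : ((q ^ 2 : ℚ) : K) = ((-(D : ℚ) : ℚ) : K) := by
        push_cast; rw [hq, hα]
      exact_mod_cast this
    have : (0 : ℚ) < D := by exact_mod_cast hD.pos
    nlinarith [sq_nonneg q]
  have hli : LinearIndependent ℚ ![(1 : K), α] := by
    rw [LinearIndependent.pair_iff]
    intro s t hst
    have hst' : (s : K) + t * α = 0 := by
      simpa [Algebra.smul_def] using hst
    have ht : t = 0 := by
      by_contra ht
      have htK : (t : K) ≠ 0 := by exact_mod_cast ht
      refine hsq (-s / t) ?_
      push_cast
      field_simp
      linear_combination -hst'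
    refine ⟨?_, ht⟩
    rw [ht] at hst'
    simpa using hst'
  have hspan : ∀ x : K, ∃ p q : ℚ, x = p + q * α := by
    intro x
    let B := basisOfLinearIndependentOfCardEqFinrank hli (by simp [hK])
    refine ⟨B.repr x 0, B.repr x 1, ?_⟩
    have h := B.sum_repr x
    rw [Fin.sum_univ_two, show B 0 = 1 by simp [B], show B 1 = α by simp [B]] at h
    simp only [Algebra.smul_def, mul_one, eq_ratCast] at h
    exact h.symm
  have : Algebra.IsQuadraticExtension ℚ K := ⟨hK⟩
  obtain ⟨τ, hτ⟩ : ∃ τ : K ≃ₐ[ℚ] K, τ ≠ 1 := by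
    have h1 : Nat.card (K ≃ₐ[ℚ] K) = 2 := by rw [IsGalois.card_aut_eq_finrank, hK]
    have : Finite (K ≃ₐ[ℚ] K) := Nat.finite_of_card_ne_zero (by omega)
    have : Nontrivial (K ≃ₐ[ℚ] K) := Finite.one_lt_card_iff_nontrivial.1 (by omega)
    exact exists_ne 1
  have hτα : τ α = -α := by
    have h1 : τ α ^ 2 = α ^ 2 := by rw [← map_pow, hα]; simp
    rcases sq_eq_sq_iff_eq_or_eq_neg.1 h1 with h | h
    · refine absurd (AlgEquiv.ext fun x => ?_) hτ
      obtain ⟨p, q, rfl⟩ := hspan x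
      simp [h]
    · exact h
  have h_integral : ∀ x : K, IsIntegral ℤ x → ∃ a b : ℤ, x = a + b * ((1 + α) / 2) := by
    intro x hx
    obtain ⟨p, q, rfl⟩ := hspan x
    have hx' : IsIntegral ℤ ((p : K) - q * α) := by
      have := hx.map τ
      simpa [hτα, sub_eq_add_neg] using this
    obtain ⟨A, hA⟩ : ∃ n : ℤ, 2 * p = n := by
      refine exists_int_of_isIntegral (K := K) ?_
      have e : ((2 * p : ℚ) : K) = (p + q * α) + (p - q * α) := by push_cast; ring
      rw [e]
      exact hx.add hx'
    obtain ⟨N, hN⟩ : ∃ n : ℤ, p ^ 2 + D * q ^ 2 = n := by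
      refine exists_int_of_isIntegral (K := K) ?_
      have e : ((p ^ 2 + D * q ^ 2 : ℚ) : K) = (p + q * α) * (p - q * α) := by
        push_cast; linear_combination (-q : K) ^ 2 * hα
      rw [e]
      exact hx.mul hx'
    obtain ⟨B, hB⟩ : ∃ n : ℤ, 2 * q = n := by
      refine exists_int_of_prime_mul_sq hD (M := 4 * N - A ^ 2) ?_
      push_cast
      rw [← hN, ← hA]
      ring
    have hrel : A ^ 2 + D * B ^ 2 = 4 * N := by
      have : (A : ℚ) ^ 2 + D * B ^ 2 = 4 * N := by rw [← hN, ← hA, ← hB]; ring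
      exact_mod_cast this
    have hpar : (2 : ℤ) ∣ A - B := by
      have h1 : (D : ℤ) = 4 * k - 1 := by have : (D : ℤ) + 1 = 4 * k := by exact_mod_cast hDk
                                          linarith
      rw [h1] at hrel
      have h2 : (2 : ℤ) ∣ (A - B) * (A + B) := ⟨2 * N - 2 * k * B ^ 2, by linarith⟩
      rcases Int.prime_two.dvd_or_dvd h2 with h | h
      · exact h
      · omega
    obtain ⟨a, ha⟩ := hpar
    refine ⟨a, B, ?_⟩
    have hp : (p : K) = A / 2 := by
      rw [eq_div_iff two_ne_zero]; have : ((2 * p : ℚ) : K) = ((A : ℚ) : K) := by rw [hA]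
      push_cast at this; linear_combination this
    have hq : (q : K) = B / 2 := by
      rw [eq_div_iff two_ne_zero]; have : ((2 * q : ℚ) : K) = ((B : ℚ) : K) := by rw [hB]
      push_cast at this; linear_combination this
    have hAB : (A : K) = B + 2 * a := by
      have : A = B + 2 * a := by linarith
      rw [this]; push_cast; ring
    rw [hp, hq, hAB]
    ring
  have hωint : IsIntegral ℤ ((1 + α) / 2) := by
    refine ⟨Polynomial.X ^ 2 - Polynomial.X + Polynomial.C (k : ℤ), ?_, ?_⟩
    · monicity!
    · simp
      linear_combination hα / 4 - hDK / 4
  set ω : 𝓞 K := ⟨(1 + α) / 2, hωint⟩ with hω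
  have hωK : (ω : K) = (1 + α) / 2 := rfl
  have hli2 : LinearIndependent ℤ ![(1 : 𝓞 K), ω] := by
    rw [LinearIndependent.pair_iff]
    intro s t hst
    have hst' : (s : K) + t * ((1 + α) / 2) = 0 := by
      have := congrArg (fun x : 𝓞 K => (x : K)) hst
      simpa [hωK] using this
    have h1 := LinearIndependent.pair_iff.1 hli (s + t / 2) (t / 2) (by
      simp only [Algebra.smul_def]
      simp
      linear_combination hst')
    have ht : (t : ℚ) = 0 := by linarith [h1.2]
    have hs : (s : ℚ) = 0 := by linarith [h1.1, h1.2]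
    exact ⟨by exact_mod_cast hs, by exact_mod_cast ht⟩
  have hsp2 : ⊤ ≤ Submodule.span ℤ (Set.range ![(1 : 𝓞 K), ω]) := by
    intro x _
    obtain ⟨a, b, hab⟩ := h_integral x x.2
    have : x = a • 1 + b • ω := by
      ext
      simp [hωK, hab]
    rw [this]
    refine Submodule.add_mem _ (Submodule.smul_mem _ _ (Submodule.subset_span ⟨0, rfl⟩))
      (Submodule.smul_mem _ _ (Submodule.subset_span ⟨1, rfl⟩))
  refine ⟨⟨ω, (RingOfIntegers.mapRingEquiv τ.toRingEquiv).toRingHom,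
    Module.Basis.mk hli2 hsp2, by simp, by simp, ?_, ?_⟩⟩
  · ext
    simp [hωK]
    linear_combination hα / 4 - hDK / 4
  · ext
    change τ ((1 + α) / 2) = 1 - (1 + α) / 2
    have h2 : τ 2 = 2 := map_ofNat τ 2
    simp [hτα, h2]
    ring

end QuadraticIntegers

section QuadraticIdeals

namespace QuadraticBasis

variable {R : Type*} [CommRing R] {k : ℕ} (q : QuadraticBasis R k)

theorem exists_coord (x : R) : ∃ a b : ℤ, x = a + b * q.ω := by
  refine ⟨q.b.repr x 0, q.b.repr x 1, ?_⟩
  have h := q.b.sum_repr x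
  rw [Fin.sum_univ_two, q.b_zero, q.b_one] at h
  simpa using h.symm

theorem repr_coord (a b : ℤ) : q.b.repr (a + b * q.ω) = Finsupp.single 0 a + Finsupp.single 1 b := by
  have h : (a + b * q.ω : R) = a • q.b 0 + b • q.b 1 := by
    rw [q.b_zero, q.b_one]; simp
  rw [h, map_add, map_smul, map_smul, Module.Basis.repr_self, Module.Basis.repr_self]
  simp

theorem coord_inj {a b a' b' : ℤ} (h : (a + b * q.ω : R) = a' + b' * q.ω) : a = a' ∧ b = b' := by
  have h1 := congrArg q.b.repr h
  rw [q.repr_coord, q.repr_coord] at h1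
  exact ⟨by simpa using DFunLike.congr_fun h1 0, by simpa using DFunLike.congr_fun h1 1⟩

theorem coord_eq_zero {a b : ℤ} (h : (a + b * q.ω : R) = 0) : a = 0 ∧ b = 0 :=
  q.coord_inj (a' := 0) (b' := 0) (by simpa using h)

theorem intCast_inj {R : Type*} [CommRing R] {k : ℕ} (q : QuadraticBasis R k) {a b : ℤ} (h : (a : R) = b) : a = b :=
  (q.coord_inj (a := a) (b := 0) (a' := b) (b' := 0) (by simpa using h)).1

theorem mul_σ (a b : ℤ) :
    (a + b * q.ω : R) * q.σ (a + b * q.ω) = ((a ^ 2 + a * b + k * b ^ 2 : ℤ) : R) := by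
  simp only [map_add, map_mul, map_intCast, q.σ_ω]
  push_cast
  linear_combination (-(b : R) ^ 2) * q.ω_sq

theorem σ_σ (x : R) : q.σ (q.σ x) = x := by
  obtain ⟨a, b, rfl⟩ := q.exists_coord x
  simp [q.σ_ω]

theorem four_mul_norm (a b : ℤ) :
    4 * (a ^ 2 + a * b + k * b ^ 2) = (2 * a + b) ^ 2 + (4 * k - 1) * b ^ 2 := by ring

theorem norm_pos (hk : 0 < k) {a b : ℤ} (h : a ≠ 0 ∨ b ≠ 0) : 0 < a ^ 2 + a * b + k * b ^ 2 := by
  have h1 := four_mul_norm (k := k) a b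
  have hk' : (1 : ℤ) ≤ k := by exact_mod_cast hk
  by_cases hb : b = 0
  · subst hb
    have : 0 < a ^ 2 := by have := h.resolve_right (by simp); positivity
    nlinarith
  · have h2 : 0 < b ^ 2 := by positivity
    nlinarith [sq_nonneg (2 * a + b)]

theorem norm_nonneg (hk : 0 < k) (a b : ℤ) : 0 ≤ a ^ 2 + a * b + k * b ^ 2 := by
  have h1 := four_mul_norm (k := k) a b
  have hk' : (1 : ℤ) ≤ k := by exact_mod_cast hk
  nlinarith [sq_nonneg (2 * a + b), sq_nonneg b]

/-- The ideal `J` equals `ℤ m + ℤ (e + ω)`. -/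
def IsPrim (J : Ideal R) (m : ℕ) (e : ℤ) : Prop :=
  0 < m ∧ ∀ a b : ℤ, (a + b * q.ω : R) ∈ J ↔ (m : ℤ) ∣ a - b * e

variable {q} {J : Ideal R} {m : ℕ} {e : ℤ}

theorem IsPrim.natCast_mem (h : q.IsPrim J m e) : (m : R) ∈ J := by
  have := (h.2 m 0).2 (by simp)
  simpa using this

theorem IsPrim.add_mem (h : q.IsPrim J m e) : (e + q.ω : R) ∈ J := by
  have := (h.2 e 1).2 (by simp)
  simpa using this

theorem IsPrim.ne_zero (h : q.IsPrim J m e) : J ≠ 0 := by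
  rintro rfl
  have := h.natCast_mem
  rw [Submodule.zero_eq_bot, Ideal.mem_bot] at this
  have h1 := q.intCast_inj (a := m) (b := 0) (by simpa using this)
  have := h.1
  omega

theorem IsPrim.shift (h : q.IsPrim J m e) (t : ℤ) : q.IsPrim J m (e + m * t) := by
  refine ⟨h.1, fun a b => ?_⟩
  rw [h.2]
  have : a - b * (e + m * t) = a - b * e - m * (b * t) := by ring
  rw [this]
  exact (dvd_sub_left (Dvd.intro _ rfl)).symm

theorem IsPrim.dvd_norm (h : q.IsPrim J m e) : (m : ℤ) ∣ e ^ 2 + e + k := by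
  have h1 := J.mul_mem_right (q.σ (e + q.ω)) h.add_mem
  have h2 := q.mul_σ e 1
  simp only [Int.cast_one, one_mul] at h2
  rw [h2] at h1
  have := (h.2 (e ^ 2 + e * 1 + k * 1 ^ 2) 0).1 (by simpa using h1)
  simpa using this

theorem IsPrim.exists_shift (h : q.IsPrim J m e) :
    ∃ e', q.IsPrim J m e' ∧ (2 * e' + 1) ^ 2 ≤ (m : ℤ) ^ 2 := by
  have hm : (0 : ℤ) < m := by exact_mod_cast h.1
  refine ⟨e + m * -((2 * e + 1 + m) / (2 * m)), h.shift _, ?_⟩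
  have h1 := Int.mul_ediv_add_emod (2 * e + 1 + m) (2 * m)
  have h2 := Int.emod_nonneg (2 * e + 1 + m) (b := 2 * m) (by omega)
  have h3 := Int.emod_lt_of_pos (2 * e + 1 + m) (b := 2 * m) (by omega)
  set r := (2 * e + 1 + m) % (2 * m)
  set s := (2 * e + 1 + m) / (2 * m)
  have h4 : 2 * (e + m * -s) + 1 = r - m := by linarith
  rw [h4]
  nlinarith

variable [IsDedekindDomain R]

theorem IsPrim.absNorm [Module.Free ℤ R] (h : q.IsPrim J m e) : Ideal.absNorm J = m := by
  have : NeZero m := ⟨h.1.ne'⟩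
  let φ : R →+ ZMod m :=
    { toFun := fun x => ((q.b.repr x 0 - q.b.repr x 1 * e : ℤ) : ZMod m)
      map_zero' := by simp
      map_add' := fun x y => by simp; ring }
  have hφ : ∀ a b : ℤ, φ (a + b * q.ω) = ((a - b * e : ℤ) : ZMod m) := by
    intro a b
    change ((q.b.repr (a + b * q.ω) 0 - q.b.repr (a + b * q.ω) 1 * e : ℤ) : ZMod m) = _
    rw [q.repr_coord]
    simp
  have hker : φ.ker = J.toAddSubgroup := by
    ext x
    obtain ⟨a, b, rfl⟩ := q.exists_coord x
    rw [AddMonoidHom.mem_ker, hφ, ZMod.intCast_zmod_eq_zero_iff_dvd, ← h.2]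
    rfl
  have hsurj : Function.Surjective φ := by
    intro y
    refine ⟨((y.val : ℤ) : R) + ((0 : ℤ) : R) * q.ω, ?_⟩
    rw [hφ]
    simp
  have h1 := AddSubgroup.index_ker φ
  rw [AddMonoidHom.range_eq_top.2 hsurj, hker] at h1
  rw [Ideal.absNorm_apply, Submodule.cardQuot_apply]
  change J.toAddSubgroup.index = m
  rw [h1]
  simp

variable (q)

/-- Every nonzero ideal is an integer multiple of a primitive one. -/
theorem exists_isPrim (hk : 0 < k) {I : Ideal R} (hI : I ≠ 0) :
    ∃ (d : ℤ) (J : Ideal R) (m : ℕ) (e : ℤ), d ≠ 0 ∧ I = Ideal.span {(d : R)} * J ∧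
      q.IsPrim J m e := by
  let M : Submodule ℤ ℤ := (I.restrictScalars ℤ).map (q.b.coord 1)
  obtain ⟨d, hd⟩ := (IsPrincipalIdealRing.principal M).principal
  have hmem : ∀ a b : ℤ, (a + b * q.ω : R) ∈ I → d ∣ b := by
    intro a b hab
    have : b ∈ M := ⟨a + b * q.ω, hab, by simp [q.repr_coord]⟩
    rw [hd, Submodule.mem_span_singleton] at this
    obtain ⟨c, hc⟩ := this
    exact ⟨c, by rw [← hc, smul_eq_mul, mul_comm]⟩
  have hmem2 : ∀ a b : ℤ, (a + b * q.ω : R) ∈ I → d ∣ a := by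
    intro a b hab
    have h1 := I.mul_mem_left q.ω hab
    have h2 : q.ω * (a + b * q.ω : R) = ((-(k * b) : ℤ) : R) + ((a + b : ℤ) : R) * q.ω := by
      push_cast; linear_combination (b : R) * q.ω_sq
    rw [h2] at h1
    have h3 := hmem _ _ h1
    exact (dvd_add_left (hmem _ _ hab)).1 h3
  obtain ⟨x, hxI, hx0⟩ := Submodule.exists_mem_ne_zero_of_ne_bot hI
  have hd0 : d ≠ 0 := by
    rintro rfl
    obtain ⟨a, b, rfl⟩ := q.exists_coord x
    have h1 := zero_dvd_iff.1 (hmem _ _ hxI)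
    have h2 := zero_dvd_iff.1 (hmem2 _ _ hxI)
    exact hx0 (by simp [h1, h2])
  have hdR : (d : R) ≠ 0 := by
    intro h
    exact hd0 (q.intCast_inj (by simpa using h))
  have hle : I ≤ Ideal.span {(d : R)} := by
    intro x hx
    obtain ⟨a, b, rfl⟩ := q.exists_coord x
    rw [Ideal.mem_span_singleton]
    exact dvd_add (Int.cast_dvd_cast (α := R) _ _ (hmem2 _ _ hx))
      (Dvd.dvd.mul_right (Int.cast_dvd_cast (α := R) _ _ (hmem _ _ hx)) _)
  obtain ⟨J, hJ⟩ := Ideal.dvd_iff_le.2 hle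
  have hdJ : ∀ y : R, (d : R) * y ∈ I ↔ y ∈ J := by
    intro y
    rw [hJ, Ideal.mem_span_singleton_mul]
    constructor
    · rintro ⟨z, hz, h⟩
      rwa [← mul_left_cancel₀ hdR h]
    · exact fun h => ⟨y, h, rfl⟩
  obtain ⟨e, he⟩ : ∃ e : ℤ, (e + q.ω : R) ∈ J := by
    have : d ∈ M := by rw [hd]; exact Submodule.mem_span_singleton_self d
    obtain ⟨y, hy, hyd⟩ := this
    obtain ⟨a, b, rfl⟩ := q.exists_coord y
    have hb : b = d := by simpa [q.repr_coord] using hyd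
    subst hb
    obtain ⟨e, rfl⟩ := hmem2 _ _ hy
    refine ⟨e, (hdJ _).1 ?_⟩
    have : (b : R) * (e + q.ω) = ((b * e : ℤ) : R) + b * q.ω := by push_cast; ring
    rwa [this]
  have hJ0 : J ≠ ⊥ := by
    rintro rfl
    exact hI (by rw [hJ, Ideal.mul_bot]; rfl)
  obtain ⟨m, hm⟩ := (IsPrincipalIdealRing.principal (J.comap (Int.castRingHom R))).principal
  have hmJ : ∀ a : ℤ, (a : R) ∈ J ↔ m ∣ a := by
    intro a
    have : (a : R) ∈ J ↔ a ∈ J.comap (Int.castRingHom R) := by simp [Ideal.mem_comap]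
    rw [this, hm, Submodule.mem_span_singleton]
    constructor
    · rintro ⟨c, rfl⟩; exact Dvd.intro_left _ rfl
    · rintro ⟨c, rfl⟩; exact ⟨c, by rw [smul_eq_mul, mul_comm]⟩
  have hm0 : m ≠ 0 := by
    rintro rfl
    obtain ⟨y, hy, hy0⟩ := Submodule.exists_mem_ne_zero_of_ne_bot hJ0
    obtain ⟨a, b, rfl⟩ := q.exists_coord y
    have h1 := J.mul_mem_right (q.σ (a + b * q.ω)) hy
    rw [q.mul_σ, hmJ, zero_dvd_iff] at h1
    refine (norm_pos hk (a := a) (b := b) ?_).ne' h1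
    by_contra! h
    exact hy0 (by simp [h.1, h.2])
  refine ⟨d, J, m.natAbs, e, hd0, hJ, Int.natAbs_pos.2 hm0, fun a b => ?_⟩
  rw [Int.natAbs_dvd, ← hmJ]
  have h1 := J.mul_mem_left (b : R) he
  have h2 : (a + b * q.ω : R) = ((a - b * e : ℤ) : R) + b * (e + q.ω) := by push_cast; ring
  rw [h2]
  exact J.add_mem_iff_left h1

variable [Module.Free ℤ R]

theorem absNorm_span (a b : ℤ) :
    Ideal.absNorm (Ideal.span {(a + b * q.ω : R)}) = (a ^ 2 + a * b + k * b ^ 2).natAbs := by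
  have := Module.Finite.of_basis q.b
  rw [Ideal.absNorm_span_singleton, Algebra.norm_eq_matrix_det q.b, Matrix.det_fin_two]
  simp only [Algebra.leftMulMatrix_eq_repr_mul, q.b_zero, q.b_one, mul_one]
  have h : (a + b * q.ω : R) * q.ω = ((-(k * b) : ℤ) : R) + ((a + b : ℤ) : R) * q.ω := by
    push_cast; linear_combination (b : R) * q.ω_sq
  rw [h, q.repr_coord, q.repr_coord]
  simp
  ring_nf

theorem absNorm_span_int {R : Type*} [CommRing R] {k : ℕ} (q : QuadraticBasis R k)
    [IsDedekindDomain R] [Module.Free ℤ R] (d : ℤ) : Ideal.absNorm (Ideal.span {(d : R)}) = d.natAbs ^ 2 := by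
  have := q.absNorm_span d 0
  simpa [Int.natAbs_pow] using this

end QuadraticBasis

end QuadraticIdeals

section ReducedIdeals

open nonZeroDivisors

namespace QuadraticBasis

variable {R : Type*} [CommRing R] [IsDedekindDomain R] {k : ℕ}

theorem mem_nonZeroDivisors_of_isPrim {q : QuadraticBasis R k} {J : Ideal R} {m : ℕ} {e : ℤ}
    (h : q.IsPrim J m e) : J ∈ (Ideal R)⁰ :=
  mem_nonZeroDivisors_iff_ne_zero.2 h.ne_zero

theorem intCast_ne_zero {R : Type*} [CommRing R] {k : ℕ} (q : QuadraticBasis R k) {d : ℤ} (hd : d ≠ 0) : (d : R) ≠ 0 :=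
  fun h => hd (q.intCast_inj (by simpa using h))

theorem exists_isPrim_mk0_eq (q : QuadraticBasis R k) (hk : 0 < k) (I : (Ideal R)⁰) :
    ∃ (d : ℤ) (J : Ideal R) (hJ : J ∈ (Ideal R)⁰) (m : ℕ) (e : ℤ), d ≠ 0 ∧
      (I : Ideal R) = Ideal.span {(d : R)} * J ∧ q.IsPrim J m e ∧
      ClassGroup.mk0 ⟨J, hJ⟩ = ClassGroup.mk0 I := by
  obtain ⟨d, J, m, e, hd, hI, hJ⟩ := q.exists_isPrim hk (nonZeroDivisors.coe_ne_zero I)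
  refine ⟨d, J, mem_nonZeroDivisors_of_isPrim hJ, m, e, hd, hI, hJ, ?_⟩
  rw [ClassGroup.mk0_eq_mk0_iff]
  exact ⟨d, 1, q.intCast_ne_zero hd, one_ne_zero, by simp [hI]⟩

/-- Each ideal class contains a primitive ideal whose norm is at most `√((4k-1)/3)`. -/
theorem exists_reduced [Module.Free ℤ R] (q : QuadraticBasis R k) (hk : 0 < k) (C : ClassGroup R) :
    ∃ (J : Ideal R) (hJ : J ∈ (Ideal R)⁰) (m : ℕ) (e : ℤ), ClassGroup.mk0 ⟨J, hJ⟩ = C ∧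
      q.IsPrim J m e ∧ 3 * (m : ℤ) ^ 2 ≤ 4 * k - 1 := by
  obtain ⟨I, hIC, hmin⟩ : ∃ I : (Ideal R)⁰, ClassGroup.mk0 I = C ∧
      ∀ I' : (Ideal R)⁰, ClassGroup.mk0 I' = C →
        Ideal.absNorm (I : Ideal R) ≤ Ideal.absNorm (I' : Ideal R) := by
    let S : Set ℕ := {n | ∃ I : (Ideal R)⁰, ClassGroup.mk0 I = C ∧ Ideal.absNorm (I : Ideal R) = n}
    have hS : S.Nonempty := by
      obtain ⟨I, hI⟩ := ClassGroup.mk0_surjective C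
      exact ⟨_, I, hI, rfl⟩
    obtain ⟨I, hI, hn⟩ := Nat.sInf_mem hS
    exact ⟨I, hI, fun I' hI' => hn ▸ Nat.sInf_le ⟨I', hI', rfl⟩⟩
  obtain ⟨d, J, hJ, m, e₀, hd, hI, hprim₀, hJI⟩ := q.exists_isPrim_mk0_eq hk I
  obtain ⟨e, hprim, he⟩ := hprim₀.exists_shift
  refine ⟨J, hJ, m, e, hJI.trans hIC, hprim, ?_⟩
  have hm : (0 : ℤ) < m := by exact_mod_cast hprim.1
  have hmI : ∀ I' : (Ideal R)⁰, ClassGroup.mk0 I' = C → m ≤ Ideal.absNorm (I' : Ideal R) := by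
    intro I' hI'
    refine le_trans ?_ (hmin I' hI')
    rw [hI, map_mul, q.absNorm_span_int, hprim.absNorm]
    exact Nat.le_mul_of_pos_left _ (by have := Int.natAbs_pos.2 hd; positivity)
  obtain ⟨Q, hQ⟩ := hprim.dvd_norm
  have hle : Ideal.span {q.σ (e + q.ω)} * J ≤ Ideal.span {((m : ℤ) : R)} := by
    rw [Ideal.span_singleton_mul_le_iff]
    intro z hz
    obtain ⟨a, b, rfl⟩ := q.exists_coord z
    obtain ⟨c, hc⟩ := (hprim.2 a b).1 hz
    rw [Ideal.mem_span_singleton]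
    refine ⟨c * q.σ (e + q.ω) + b * Q, ?_⟩
    have h1 : (a + b * q.ω : R) = ((m : ℤ) : R) * c + b * (e + q.ω) := by
      have := congrArg (fun z : ℤ => (z : R)) hc
      push_cast at this ⊢
      linear_combination this
    have h2 := q.mul_σ e 1
    simp only [Int.cast_one, one_mul, mul_one, one_pow, hQ] at h2
    rw [h1]
    push_cast at h2 ⊢
    linear_combination (b : R) * h2
  obtain ⟨J', hJ'⟩ := Ideal.dvd_iff_le.2 hle
  have hσ : q.σ (e + q.ω) = ((e + 1 : ℤ) : R) + ((-1 : ℤ) : R) * q.ω := by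
    simp [q.σ_ω]; ring
  have hσ0 : q.σ (e + q.ω) ≠ 0 := by
    rw [hσ]
    intro h
    have := (q.coord_eq_zero h).2
    norm_num at this
  have hJ'0 : J' ∈ (Ideal R)⁰ := by
    rw [mem_nonZeroDivisors_iff_ne_zero]
    rintro rfl
    rw [mul_zero, mul_eq_zero] at hJ'
    exact hJ'.elim (by simpa using hσ0) hprim.ne_zero
  have hcl : ClassGroup.mk0 ⟨J', hJ'0⟩ = C := by
    rw [← hIC, ← hJI, ClassGroup.mk0_eq_mk0_iff]
    exact ⟨_, _, q.intCast_ne_zero hm.ne', hσ0, hJ'.symm⟩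
  have h1 := hmI _ hcl
  have h2 := congrArg Ideal.absNorm hJ'
  rw [map_mul, map_mul, hσ, q.absNorm_span, q.absNorm_span_int, hprim.absNorm] at h2
  have h3 : (e + 1) ^ 2 + (e + 1) * -1 + k * (-1) ^ 2 = m * Q := by rw [← hQ]; ring
  have hQ0 : 0 ≤ (m : ℤ) * Q := by rw [← h3]; exact norm_nonneg hk _ _
  rw [h3, Int.natAbs_natCast] at h2
  have h4 : ((m : ℤ) * Q) * m = m ^ 2 * (Ideal.absNorm J' : ℤ) := by
    rw [← Int.natAbs_of_nonneg hQ0]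
    exact_mod_cast h2
  have h5 : (m : ℤ) ≤ Ideal.absNorm J' := by exact_mod_cast h1
  have h6 : Q = Ideal.absNorm J' := by
    have : (m : ℤ) ^ 2 * Q = m ^ 2 * (Ideal.absNorm J' : ℤ) := by linarith
    exact mul_left_cancel₀ (by positivity) this
  nlinarith

/-- If `4k - 1` is prime, an ideal class of order dividing two is trivial. -/
theorem eq_one_of_sq_eq_one [Module.Free ℤ R] (q : QuadraticBasis R k) (hp : (4 * k - 1 : ℕ).Prime)
    (hk : 1 < k) {C : ClassGroup R} (hC : C ^ 2 = 1) : C = 1 := by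
  obtain ⟨I, hI⟩ := ClassGroup.mk0_surjective C
  obtain ⟨-, B, hB, m, e, -, -, hprim, hBI⟩ := q.exists_isPrim_mk0_eq (by omega) I
  have hm : (0 : ℤ) < m := by exact_mod_cast hprim.1
  have hmR : ((m : ℤ) : R) ≠ 0 := q.intCast_ne_zero hm.ne'
  have h1 : ClassGroup.mk0 (⟨B, hB⟩ * ⟨B, hB⟩ : (Ideal R)⁰) = 1 := by
    rw [map_mul, hBI, hI, ← sq, hC]
  rw [ClassGroup.mk0_eq_one_iff] at h1
  obtain ⟨α₀, hα₀⟩ := h1.principal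
  replace hα₀ : B * B = Ideal.span {α₀} := hα₀
  obtain ⟨α, hα, hγ⟩ : ∃ α, B * B = Ideal.span {α} ∧ ((m : ℤ) : R) + q.σ α ≠ 0 := by
    by_cases h : ((m : ℤ) : R) + q.σ α₀ = 0
    · refine ⟨-α₀, by rw [hα₀, Ideal.span_singleton_neg], ?_⟩
      intro h'
      rw [map_neg] at h'
      have : ((2 * m : ℤ) : R) = 0 := by push_cast at h h' ⊢; linear_combination h + h'
      exact q.intCast_ne_zero (by omega) this
    · exact ⟨α₀, hα₀, h⟩
  have hnorm : α * q.σ α = ((m : ℤ) : R) ^ 2 := by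
    obtain ⟨a, b, rfl⟩ := q.exists_coord α
    have h2 := congrArg Ideal.absNorm hα
    rw [map_mul, q.absNorm_span, hprim.absNorm] at h2
    have h3 : (m : ℤ) * m = a ^ 2 + a * b + k * b ^ 2 := by
      rw [← Int.natAbs_of_nonneg (norm_nonneg (by omega : 0 < k) a b)]
      exact_mod_cast h2
    rw [q.mul_σ, ← h3]
    push_cast; ring
  set γ := ((m : ℤ) : R) + q.σ α with hγdef
  have hσγ : ((m : ℤ) : R) * q.σ γ = α * γ := by
    rw [hγdef, map_add, map_intCast, q.σ_σ]
    linear_combination -hnorm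
  have hαB : α ∈ B * B := by rw [hα]; exact Ideal.mem_span_singleton_self α
  obtain ⟨Q, hQ⟩ := hprim.dvd_norm
  have hconj : ∀ x ∈ B, ∀ y ∈ B, ((m : ℤ) : R) ∣ q.σ x * y := by
    have hform : ∀ x ∈ B, ∃ c b : ℤ, x = ((m : ℤ) : R) * c + b * (e + q.ω) := by
      intro x hx
      obtain ⟨a, b, rfl⟩ := q.exists_coord x
      obtain ⟨c, hc⟩ := (hprim.2 a b).1 hx
      refine ⟨c, b, ?_⟩
      have := congrArg (fun z : ℤ => (z : R)) hc
      push_cast at this ⊢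
      linear_combination this
    intro x hx y hy
    obtain ⟨c, b, rfl⟩ := hform x hx
    obtain ⟨c', b', rfl⟩ := hform y hy
    have h2 := q.mul_σ e 1
    simp only [Int.cast_one, one_mul, mul_one, one_pow, hQ] at h2
    refine ⟨c * (((m : ℤ) : R) * c' + b' * (e + q.ω)) + b * c' * q.σ (e + q.ω) + b * b' * Q, ?_⟩
    simp only [map_add, map_mul, map_intCast] at h2 ⊢
    push_cast at h2 ⊢
    linear_combination (b * b' : R) * h2
  have hconj2 : ∀ x ∈ B, ∃ y ∈ B, q.σ x * α = ((m : ℤ) : R) * y := by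
    intro x hx
    refine Submodule.mul_induction_on hαB ?_ ?_
    · intro u hu v hv
      obtain ⟨w, hw⟩ := hconj x hx u hu
      exact ⟨w * v, B.mul_mem_left w hv, by rw [← mul_assoc, hw]; ring⟩
    · rintro u v ⟨y, hy, hu⟩ ⟨z, hz, hv⟩
      exact ⟨y + z, B.add_mem hy hz, by rw [mul_add, hu, hv]; ring⟩
  have hinv : ∀ x ∈ Ideal.span {γ} * B, q.σ x ∈ Ideal.span {γ} * B := by
    intro x hx
    rw [Ideal.mem_span_singleton_mul] at hx ⊢
    obtain ⟨z, hz, rfl⟩ := hx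
    obtain ⟨y, hy, h⟩ := hconj2 z hz
    refine ⟨y, hy, mul_left_cancel₀ hmR ?_⟩
    rw [map_mul]
    linear_combination (-γ) * h - q.σ z * hσγ
  have hγB : Ideal.span {γ} * B ∈ (Ideal R)⁰ :=
    mul_mem (mem_nonZeroDivisors_iff_ne_zero.2 (by simpa using hγ)) hB
  obtain ⟨d, J, hJ, m', e', hd, hIJ, hprim', hJI⟩ := q.exists_isPrim_mk0_eq (by omega) ⟨_, hγB⟩
  have hdR := q.intCast_ne_zero hd
  have hJB : ClassGroup.mk0 ⟨J, hJ⟩ = C := by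
    rw [hJI, ← hI, ← hBI, ClassGroup.mk0_eq_mk0_iff]
    exact ⟨1, γ, one_ne_zero, hγ, by simp⟩
  have hJinv : ∀ x ∈ J, q.σ x ∈ J := by
    intro x hx
    have h2 : (d : R) * x ∈ Ideal.span {γ} * B := by
      rw [show Ideal.span {γ} * B = _ from hIJ]
      exact Ideal.mem_span_singleton_mul.2 ⟨x, hx, rfl⟩
    have h3 := hinv _ h2
    rw [show Ideal.span {γ} * B = _ from hIJ, map_mul, map_intCast,
      Ideal.mem_span_singleton_mul] at h3
    obtain ⟨z, hz, h⟩ := h3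
    rwa [← mul_left_cancel₀ hdR h]
  have hdvd : (m' : ℤ) ∣ 2 * e' + 1 := by
    have h2 := hJinv _ hprim'.add_mem
    have h3 : q.σ (e' + q.ω) = ((e' + 1 : ℤ) : R) + ((-1 : ℤ) : R) * q.ω := by
      simp [q.σ_ω]; ring
    rw [h3, hprim'.2] at h2
    convert h2 using 1; ring
  have hdvd2 : m' ∣ 4 * k - 1 := by
    have h2 := dvd_sub (hprim'.dvd_norm.mul_left 4) (hdvd.mul_left (2 * e' + 1))
    have h3 : 4 * (e' ^ 2 + e' + k) - (2 * e' + 1) * (2 * e' + 1) = ((4 * k - 1 : ℕ) : ℤ) := by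
      rw [Nat.cast_sub (by omega)]; push_cast; ring
    rw [h3] at h2
    exact_mod_cast h2
  rw [← hJB, ClassGroup.mk0_eq_one_iff]
  rcases (Nat.dvd_prime hp).1 hdvd2 with rfl | rfl
  · have : J = ⊤ := by
      rw [Ideal.eq_top_iff_one]
      simpa using hprim'.natCast_mem
    change (J : Submodule R R).IsPrincipal
    rw [this]
    exact ⟨1, by simp⟩
  · have hδ : J ≤ J := le_rfl
    have h2 : ((-1 : ℤ) : R) + ((2 : ℤ) : R) * q.ω ∈ J := by
      rw [hprim'.2]
      have : (-1 : ℤ) - 2 * e' = -(2 * e' + 1) := by ring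
      rw [this]
      exact hdvd.neg_right
    have h3 : Ideal.span {((-1 : ℤ) : R) + ((2 : ℤ) : R) * q.ω} ≤ J := by
      rwa [Ideal.span_singleton_le_iff_mem]
    obtain ⟨T, hT⟩ := Ideal.dvd_iff_le.2 h3
    have h4 := congrArg Ideal.absNorm hT
    rw [map_mul, q.absNorm_span, hprim'.absNorm] at h4
    have h5 : ((-1) ^ 2 + -1 * 2 + (k : ℤ) * 2 ^ 2).natAbs = 4 * k - 1 := by omega
    rw [h5] at h4
    have h6 : Ideal.absNorm T = 1 := by
      exact (Nat.mul_eq_left hp.ne_zero).1 h4.symm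
    rw [Ideal.absNorm_eq_one_iff] at h6
    rw [h6, Ideal.mul_top] at hT
    exact ⟨_, hT.symm⟩

end QuadraticBasis

end ReducedIdeals

section LatticeCount

open Real Finset

/-- A quarter of the area of the unit disc. -/
noncomputable def quarterArea : ℝ := ∫ y in (0 : ℝ)..1, √(1 - y ^ 2)

theorem antitoneOn_sqrt_one_sub_sq : AntitoneOn (fun y : ℝ => √(1 - y ^ 2)) (Set.Ici 0) := by
  intro x hx y hy hxy
  have hx' : (0 : ℝ) ≤ x := hx
  exact Real.sqrt_le_sqrt (by nlinarith)

theorem integral_sqrt_one_sub_sq_of_one_le {M : ℝ} (hM : 1 ≤ M) :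
    ∫ y in (0 : ℝ)..M, √(1 - y ^ 2) = quarterArea := by
  have hc : Continuous fun y : ℝ => √(1 - y ^ 2) := by fun_prop
  rw [quarterArea, ← intervalIntegral.integral_add_adjacent_intervals
    (hc.intervalIntegrable 0 1) (hc.intervalIntegrable 1 M), add_eq_left,
    intervalIntegral.integral_congr (g := fun _ => 0)]
  · simp
  · intro y hy
    rw [Set.uIcc_of_le hM] at hy
    exact Real.sqrt_eq_zero_of_nonpos (by nlinarith [hy.1])

theorem quarterArea_nonneg : 0 ≤ quarterArea :=
  intervalIntegral.integral_nonneg zero_le_one fun _ _ => Real.sqrt_nonneg _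

theorem abs_sum_range_sqrt_sub_le {r : ℝ} (hr : 0 < r) {N : ℕ} (hN : r ≤ N) :
    |∑ i ∈ range N, √(1 - ((i + 1 : ℕ) / r : ℝ) ^ 2) - r * quarterArea| ≤ 1 := by
  have hanti : AntitoneOn (fun x : ℝ => √(1 - (x / r) ^ 2)) (Set.Icc 0 (0 + N)) := by
    intro x hx y hy hxy
    exact antitoneOn_sqrt_one_sub_sq (Set.mem_Ici.2 (div_nonneg hx.1 hr.le))
      (Set.mem_Ici.2 (div_nonneg hy.1 hr.le)) (by gcongr)
  have h_integral : ∫ x in (0 : ℝ)..0 + N, √(1 - (x / r) ^ 2) = r * quarterArea := by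
    rw [intervalIntegral.integral_comp_div (fun y => √(1 - y ^ 2)) hr.ne', zero_div, zero_add,
      integral_sqrt_one_sub_sq_of_one_le ((one_le_div hr).2 hN), smul_eq_mul]
  have h1 := hanti.sum_le_integral
  have h2 := hanti.integral_le_sum
  rw [h_integral] at h1 h2
  simp only [zero_add] at h1 h2
  have h3 : ∑ i ∈ range N, √(1 - ((i : ℕ) / r : ℝ) ^ 2) ≤
      1 + ∑ i ∈ range N, √(1 - ((i + 1 : ℕ) / r : ℝ) ^ 2) := by
    have := Finset.sum_range_succ' (fun i : ℕ => √(1 - ((i : ℕ) / r : ℝ) ^ 2)) N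
    rw [Finset.sum_range_succ] at this
    have h4 := Real.sqrt_nonneg (1 - ((N : ℕ) / r : ℝ) ^ 2)
    simp only [CharP.cast_eq_zero, zero_div, ne_eq, OfNat.ofNat_ne_zero, not_false_eq_true,
      zero_pow, sub_zero, Real.sqrt_one] at this
    linarith
  rw [abs_le]
  constructor <;> linarith

theorem abs_card_Icc_ceil_floor_sub_le {x y : ℝ} (h : x ≤ y) :
    |((Icc ⌈x⌉ ⌊y⌋).card : ℝ) - (y - x)| ≤ 1 := by
  have h1 := Int.ceil_lt_add_one x
  have h2 := Int.lt_floor_add_one y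
  have h3 := Int.le_ceil x
  have h4 := Int.floor_le y
  have h5 : (0 : ℤ) ≤ ⌊y⌋ + 1 - ⌈x⌉ := by
    have : (⌈x⌉ : ℝ) < ⌊y⌋ + 1 + 1 := by linarith
    have : ⌈x⌉ < ⌊y⌋ + 1 + 1 := by exact_mod_cast this
    omega
  have h6 : ((Icc ⌈x⌉ ⌊y⌋).card : ℝ) = ⌊y⌋ + 1 - ⌈x⌉ := by
    have : ((Icc ⌈x⌉ ⌊y⌋).card : ℤ) = ⌊y⌋ + 1 - ⌈x⌉ := by
      rw [Int.card_Icc, Int.toNat_of_nonneg h5]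
    exact_mod_cast this
  rw [h6, abs_le]
  constructor <;> linarith

/-- Lattice points in an ellipse. -/
theorem ncard_ellipse {m : ℝ} (hm : 0 < m) (g : ℤ) {Δ T : ℝ} (hT : 0 < T) (hΔ : m ^ 2 ≤ Δ) :
    {p : ℤ × ℤ | (2 * m * p.1 + g * p.2) ^ 2 + Δ * p.2 ^ 2 ≤ T}.Finite ∧
    |({p : ℤ × ℤ | (2 * m * p.1 + g * p.2) ^ 2 + Δ * p.2 ^ 2 ≤ T}.ncard : ℝ) -
      2 * quarterArea * T / (m * √Δ)| ≤ 5 * √T / m + 3 := by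
  have hΔ0 : 0 < Δ := lt_of_lt_of_le (by positivity) hΔ
  set r := √T / √Δ with hr
  have hr0 : 0 < r := by positivity
  have hrsq : r ^ 2 * Δ = T := by
    rw [hr, div_pow, Real.sq_sqrt hT.le, Real.sq_sqrt hΔ0.le]; field_simp
  set N := ⌈r⌉₊ with hN
  have hrN : r ≤ N := Nat.le_ceil r
  have hNr : (N : ℝ) < r + 1 := Nat.ceil_lt_add_one hr0.le
  let w : ℤ → ℝ := fun b => √(T - Δ * b ^ 2)
  have hw : ∀ b : ℤ, w b = √T * √(1 - (b / r : ℝ) ^ 2) := by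
    intro b
    rw [← Real.sqrt_mul hT.le]
    rw [div_pow, ← hrsq]
    field_simp
    simp only [w]
    congr 1
    linear_combination -hrsq
  let fib : ℤ → Finset ℤ := fun b =>
    if 0 ≤ T - Δ * b ^ 2 then Icc ⌈(-w b - g * b) / (2 * m)⌉ ⌊(w b - g * b) / (2 * m)⌋ else ∅
  let S : Finset (Σ _ : ℤ, ℤ) := (Icc (-N : ℤ) N).sigma fib
  have hset : {p : ℤ × ℤ | (2 * m * p.1 + g * p.2) ^ 2 + Δ * p.2 ^ 2 ≤ T} =
      ((S.image fun p => (p.2, p.1) : Finset (ℤ × ℤ)) : Set (ℤ × ℤ)) := by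
    ext ⟨i, b⟩
    simp only [Set.mem_ofPred_eq, coe_image, Set.mem_image, Finset.mem_coe, Sigma.exists,
      Prod.mk.injEq]
    have hiff : (2 * m * i + g * b) ^ 2 + Δ * b ^ 2 ≤ T ↔ i ∈ fib b := by
      simp only [fib]
      split_ifs with h
      · rw [mem_Icc, Int.ceil_le, Int.le_floor, div_le_iff₀ (by positivity),
          le_div_iff₀ (by positivity)]
        rw [← le_sub_iff_add_le, Real.sq_le h]
        constructor <;> rintro ⟨h1, h2⟩ <;> constructor <;> simp only [w] at * <;> linarith
      · simp only [notMem_empty, iff_false, not_le]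
        nlinarith [sq_nonneg (2 * m * i + g * b)]
    constructor
    · intro h
      refine ⟨b, i, ?_, rfl, rfl⟩
      simp only [S, mem_sigma]
      refine ⟨?_, hiff.1 h⟩
      rw [mem_Icc, ← abs_le]
      have h1 : (b : ℝ) ^ 2 ≤ r ^ 2 := by
        have : Δ * (b : ℝ) ^ 2 ≤ Δ * r ^ 2 := by nlinarith [sq_nonneg (2 * m * i + g * b)]
        exact le_of_mul_le_mul_left this hΔ0
      have h2 : |(b : ℝ)| ≤ N := (abs_le_of_sq_le_sq h1 hr0.le).trans hrN
      exact_mod_cast h2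
    · rintro ⟨b', i', h, rfl, rfl⟩
      simp only [S, mem_sigma] at h
      exact hiff.2 h.2
  have hinj : Function.Injective fun p : (Σ _ : ℤ, ℤ) => (p.2, p.1) := by
    rintro ⟨a, b⟩ ⟨c, d⟩ h
    simp only [Prod.mk.injEq] at h
    simp [h.1, h.2]
  rw [hset]
  refine ⟨Finset.finite_toSet _, ?_⟩
  rw [Set.ncard_coe_finset, Finset.card_image_of_injective _ hinj, card_sigma]
  have hfib : ∀ b : ℤ, |((fib b).card : ℝ) - w b / m| ≤ 1 := by
    intro b
    simp only [fib]
    split_ifs with h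
    · have h0 : 0 ≤ w b := Real.sqrt_nonneg _
      have := abs_card_Icc_ceil_floor_sub_le (x := (-w b - g * b) / (2 * m))
        (y := (w b - g * b) / (2 * m)) (by gcongr; linarith)
      convert this using 3
      field_simp; ring
    · have : w b = 0 := Real.sqrt_eq_zero_of_nonpos (by linarith)
      simp [this]
  have hsum : |((∑ b ∈ Icc (-N : ℤ) N, (fib b).card : ℕ) : ℝ) - ∑ b ∈ Icc (-N : ℤ) N, w b / m| ≤
      2 * N + 1 := by
    push_cast
    rw [← Finset.sum_sub_distrib]
    refine (Finset.abs_sum_le_sum_abs _ _).trans ((Finset.sum_le_sum fun b _ => hfib b).trans ?_)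
    rw [Finset.sum_const, Int.card_Icc, nsmul_eq_mul, mul_one]
    have : ((N : ℤ) + 1 - -N).toNat = 2 * N + 1 := by omega
    rw [this]; push_cast; rfl
  have heven : Function.Even fun b : ℤ => w b / m := by
    intro b; simp [w]
  have hsum2 : ∑ b ∈ Icc (-N : ℤ) N, w b / m = √T / m *
      (2 * ∑ i ∈ range N, √(1 - ((i + 1 : ℕ) / r : ℝ) ^ 2) + 1) := by
    rw [sum_Icc_of_even_eq_range heven, Finset.sum_range_succ']
    simp only [hw]
    push_cast
    simp only [mul_div_right_comm, ← Finset.mul_sum]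
    simp
    ring
  have hmain := abs_sum_range_sqrt_sub_le hr0 hrN
  have hid : 2 * quarterArea * T / (m * √Δ) = √T / m * (2 * (r * quarterArea)) := by
    rw [hr]
    have := Real.mul_self_sqrt hT.le
    field_simp
    rw [sq, this]
  have hrm : r ≤ √T / m := by
    rw [hr]
    gcongr
    exact Real.le_sqrt_of_sq_le hΔ
  rw [hsum2] at hsum
  rw [hid]
  have hTm : 0 ≤ √T / m := by positivity
  set A := ∑ i ∈ range N, √(1 - ((i + 1 : ℕ) / r : ℝ) ^ 2)
  rw [abs_le] at hmain hsum ⊢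
  have e1 : √T / m * (2 * A + 1) ≤ √T / m * (2 * (r * quarterArea)) + 3 * (√T / m) := by nlinarith
  have e2 : √T / m * (2 * (r * quarterArea)) - 3 * (√T / m) ≤ √T / m * (2 * A + 1) := by nlinarith
  have e3 : 5 * √T / m = 5 * (√T / m) := by ring
  rw [e3]
  constructor <;> linarith

end LatticeCount

section ClassCount

open nonZeroDivisors

namespace QuadraticBasis

variable {R : Type*} [CommRing R] [IsDedekindDomain R] [Module.Free ℤ R] {k : ℕ}

theorem eq_one_or_eq_neg_one_of_isUnit (q : QuadraticBasis R k) (hk : 1 < k) {u : R}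
    (hu : IsUnit u) : u = 1 ∨ u = -1 := by
  obtain ⟨a, b, rfl⟩ := q.exists_coord u
  have h1 := q.absNorm_span a b
  rw [Ideal.span_singleton_eq_top.2 hu, Ideal.absNorm_top] at h1
  have h2 := norm_nonneg (k := k) (by omega) a b
  have h3 : a ^ 2 + a * b + k * b ^ 2 = 1 := by omega
  have h4 := four_mul_norm (k := k) a b
  have hk' : (2 : ℤ) ≤ k := by exact_mod_cast hk
  have hb : b = 0 := by
    by_contra hb
    have : 0 < b ^ 2 := by positivity
    nlinarith [sq_nonneg (2 * a + b)]
  subst hb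
  have h5 : a = 1 ∨ a = -1 := by
    have : (a - 1) * (a + 1) = 0 := by linarith
    rcases mul_eq_zero.1 this with h | h <;> omega
  rcases h5 with rfl | rfl <;> simp

/-- The number of ideals in a class with norm at most `t`; the main term does not depend on the
class. -/
theorem abs_ncard_class_sub_le (q : QuadraticBasis R k) (hk : 1 < k) {C : ClassGroup R} {J : Ideal R}
    {hJ : J ∈ (Ideal R)⁰} {m : ℕ} {e : ℤ} (hJC : ClassGroup.mk0 ⟨J, hJ⟩ = C⁻¹)
    (hprim : q.IsPrim J m e) (hm3 : 3 * (m : ℤ) ^ 2 ≤ 4 * k - 1) {t : ℝ} (ht : 0 < t)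
    (hfin : {I : (Ideal R)⁰ | ClassGroup.mk0 I = C ∧
      (Ideal.absNorm (I : Ideal R) : ℝ) ≤ t}.Finite) :
    |({I : (Ideal R)⁰ | ClassGroup.mk0 I = C ∧ (Ideal.absNorm (I : Ideal R) : ℝ) ≤ t}.ncard : ℝ) -
      4 * quarterArea * t / √(4 * k - 1)| ≤ 5 * √(t / m) + 2 := by
  have hm0 : (0 : ℝ) < m := by exact_mod_cast hprim.1
  have hm3' : 3 * (m : ℝ) ^ 2 ≤ 4 * k - 1 := by exact_mod_cast hm3
  obtain ⟨hE, hcount⟩ := ncard_ellipse hm0 (2 * e + 1) (Δ := 4 * k - 1) (T := 4 * m * t)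
    (by positivity) (by nlinarith)
  set E := {p : ℤ × ℤ | (2 * m * p.1 + (2 * e + 1 : ℤ) * p.2) ^ 2 + (4 * k - 1) * (p.2 : ℝ) ^ 2 ≤
    4 * m * t} with hEdef
  set S := {I : (Ideal R)⁰ | ClassGroup.mk0 I = C ∧ (Ideal.absNorm (I : Ideal R) : ℝ) ≤ t}
  let x : ℤ × ℤ → R := fun p => ((m * p.1 + p.2 * e : ℤ) : R) + p.2 * q.ω
  have hxJ : ∀ p, x p ∈ J := fun p => (hprim.2 _ _).2 ⟨p.1, by ring⟩
  have hJx : ∀ y ∈ J, ∃ p, y = x p := by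
    intro y hy
    obtain ⟨a, b, rfl⟩ := q.exists_coord y
    obtain ⟨c, hc⟩ := (hprim.2 a b).1 hy
    exact ⟨(c, b), by simp only [x]; rw [← hc]; simp⟩
  have hxinj : ∀ p p', x p = x p' → p = p' := by
    intro p p' h
    obtain ⟨h1, h2⟩ := q.coord_inj h
    rw [h2] at h1
    have h3 : (m : ℤ) * p.1 = m * p'.1 := by linarith
    exact Prod.ext (mul_left_cancel₀ (by exact_mod_cast hprim.1.ne') h3) h2
  have hx0 : ∀ p, x p = 0 ↔ p = 0 := fun p =>
    ⟨fun h => hxinj p 0 (by rw [h]; simp [x]), fun h => by rw [h]; simp [x]⟩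
  have hxneg : ∀ p, x (-p) = -x p := by intro p; simp [x]; ring
  have hxnorm : ∀ p, 4 * (Ideal.absNorm (Ideal.span {x p}) : ℝ) =
      (2 * m * p.1 + (2 * e + 1 : ℤ) * p.2) ^ 2 + (4 * k - 1) * (p.2 : ℝ) ^ 2 := by
    intro p
    simp only [x]
    rw [q.absNorm_span, Nat.cast_natAbs, abs_of_nonneg (norm_nonneg (by omega) _ _)]
    push_cast; ring
  have hex : ∀ p : ℤ × ℤ, p ≠ 0 → ∃ I : (Ideal R)⁰, Ideal.span {x p} = J * I := by
    intro p hp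
    obtain ⟨I, hI⟩ := Ideal.dvd_iff_le.2 ((Ideal.span_singleton_le_iff_mem J).2 (hxJ p))
    refine ⟨⟨I, mem_nonZeroDivisors_iff_ne_zero.2 ?_⟩, hI⟩
    rintro rfl
    rw [mul_zero, Submodule.zero_eq_bot, Ideal.span_singleton_eq_bot, hx0] at hI
    exact hp hI
  choose! f hf using hex
  have hJcancel : ∀ I I' : (Ideal R)⁰, J * (I : Ideal R) = J * I' → I = I' := fun I I' h =>
    Subtype.ext (mul_left_cancel₀ hprim.ne_zero h)
  have hnormf : ∀ p : ℤ × ℤ, p ≠ 0 → (p ∈ E ↔ (Ideal.absNorm (f p : Ideal R) : ℝ) ≤ t) := by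
    intro p hp
    have h1 := hxnorm p
    rw [hf p hp, map_mul, hprim.absNorm] at h1
    rw [hEdef, Set.mem_ofPred_eq, ← h1]
    push_cast
    rw [← mul_assoc]
    exact mul_le_mul_iff_right₀ (by positivity)
  let E' := hE.toFinset.erase 0
  have hmaps : ∀ p ∈ E', f p ∈ hfin.toFinset := by
    intro p hp
    obtain ⟨hp0, hpE⟩ := Finset.mem_erase.1 hp
    rw [Set.Finite.mem_toFinset] at hpE ⊢
    refine ⟨?_, (hnormf p hp0).1 hpE⟩
    have h1 : ClassGroup.mk0 (⟨J, hJ⟩ * f p) = 1 := by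
      rw [ClassGroup.mk0_eq_one_iff]
      exact ⟨x p, (hf p hp0).symm⟩
    rw [map_mul, hJC] at h1
    exact (inv_mul_eq_one.1 h1).symm
  have hfiber : ∀ I ∈ hfin.toFinset, (E'.filter fun p => f p = I).card = 2 := by
    intro I hI
    rw [Set.Finite.mem_toFinset] at hI
    have h1 : ClassGroup.mk0 (⟨J, hJ⟩ * I) = 1 := by
      rw [map_mul, hJC, hI.1, inv_mul_cancel]
    rw [ClassGroup.mk0_eq_one_iff] at h1
    obtain ⟨y, hy⟩ := h1.principal
    replace hy : J * (I : Ideal R) = Ideal.span {y} := hy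
    obtain ⟨p₀, rfl⟩ := hJx y ((Ideal.mul_le_inf (hy ▸ Ideal.mem_span_singleton_self _ : y ∈ J * (I : Ideal R))).1)
    have hp₀ : p₀ ≠ 0 := by
      rintro rfl
      rw [(hx0 0).2 rfl] at hy
      have : J * (I : Ideal R) = 0 := by rw [hy]; simp
      exact (mul_eq_zero.1 this).elim hprim.ne_zero (nonZeroDivisors.coe_ne_zero I)
    rw [Finset.card_eq_two]
    refine ⟨p₀, -p₀, fun h => hp₀ (self_eq_neg.1 h), ?_⟩
    ext p
    rw [Finset.mem_filter, Finset.mem_insert, Finset.mem_singleton]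
    constructor
    · rintro ⟨hp, hpI⟩
      have hp0 := (Finset.mem_erase.1 hp).1
      have h2 := hf p hp0
      rw [hpI, hy, Ideal.span_singleton_eq_span_singleton] at h2
      obtain ⟨u, hu⟩ := h2.symm
      rcases q.eq_one_or_eq_neg_one_of_isUnit hk u.isUnit with h | h
      · exact Or.inl (hxinj _ _ (by rw [← hu, h, mul_one]))
      · exact Or.inr (hxinj _ _ (by rw [hxneg, ← hu, h, mul_neg, mul_one]))
    · intro h
      have hp0 : p ≠ 0 := by rcases h with rfl | rfl <;> simpa using hp₀
      have hsp : Ideal.span {x p} = Ideal.span {x p₀} := by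
        rcases h with rfl | rfl
        · rfl
        · rw [hxneg, Ideal.span_singleton_neg]
      have hfp : f p = I := hJcancel _ _ (by rw [← hf p hp0, hsp, hy])
      refine ⟨Finset.mem_erase.2 ⟨hp0, ?_⟩, hfp⟩
      rw [Set.Finite.mem_toFinset, hnormf p hp0, hfp]
      exact hI.2
  have hcard : E'.card = 2 * hfin.toFinset.card := by
    rw [Finset.card_eq_sum_card_fiberwise hmaps, Finset.sum_congr rfl hfiber, Finset.sum_const,
      smul_eq_mul, mul_comm]
  have hE0 : (0 : ℤ × ℤ) ∈ hE.toFinset := by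
    rw [Set.Finite.mem_toFinset, hEdef, Set.mem_ofPred_eq]
    simp; positivity
  have hcard2 : (E.ncard : ℝ) = 2 * S.ncard + 1 := by
    rw [Set.ncard_eq_toFinset_card E hE, Set.ncard_eq_toFinset_card S hfin,
      ← Finset.card_erase_add_one hE0]
    change ((E'.card + 1 : ℕ) : ℝ) = _
    rw [hcard]; push_cast; ring
  have hs : √(4 * m * t) = 2 * m * √(t / m) := by
    rw [Real.sqrt_eq_iff_mul_self_eq (by positivity) (by positivity)]
    have := Real.mul_self_sqrt (show 0 ≤ t / m by positivity)
    have h2 : (2 * m * √(t / m)) * (2 * m * √(t / m)) = 4 * m ^ 2 * (√(t / m) * √(t / m)) := by ring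
    rw [h2, this]; field_simp
  have hΔ : 0 < √(4 * k - 1 : ℝ) := Real.sqrt_pos.2 (by nlinarith)
  have hmain : 2 * quarterArea * (4 * m * t) / (m * √(4 * k - 1)) =
      2 * (4 * quarterArea * t / √(4 * k - 1)) := by field_simp
  have herr : 5 * (2 * m * √(t / m)) / m = 10 * √(t / m) := by field_simp; ring
  rw [hcard2, hs, hmain, herr] at hcount
  rw [abs_le] at hcount ⊢
  constructor <;> linarith

end QuadraticBasis

end ClassCount

section IdealZeta

open nonZeroDivisors UniqueFactorizationMonoid

theorem count_eq_factorization_prod {α : Type*} (f : α → ℕ) (i : α → Bool) {a : α} (s : Multiset α)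
    (hp : ∀ b ∈ s, (f b).Prime) (hinj : ∀ b ∈ s, f b = f a → i b = i a → b = a) :
    s.count a = ((s.filter fun b => i b = i a).map f).prod.factorization (f a) := by
  induction s using Multiset.induction_on with
  | empty => simp
  | cons b s ih =>
    have ih' := ih (fun c hc => hp c (Multiset.mem_cons_of_mem hc))
      (fun c hc => hinj c (Multiset.mem_cons_of_mem hc))
    have hb := hp b (Multiset.mem_cons_self b s)
    have hne : ((s.filter fun b => i b = i a).map f).prod ≠ 0 := by
      intro h
      obtain ⟨c, hc, hc0⟩ := Multiset.mem_map.1 (Multiset.prod_eq_zero_iff.1 h)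
      exact (hp c (Multiset.mem_cons_of_mem (Multiset.mem_filter.1 hc).1)).ne_zero hc0
    by_cases hi : i b = i a
    · rw [Multiset.filter_cons_of_pos (p := fun b => i b = i a) _ hi, Multiset.map_cons, Multiset.prod_cons,
        Nat.factorization_mul hb.ne_zero hne, Finsupp.add_apply, ← ih', hb.factorization]
      by_cases hf : f b = f a
      · have := hinj b (Multiset.mem_cons_self b s) hf hi
        subst this
        simp [add_comm]
      · have : a ≠ b := fun h => hf (h ▸ rfl)
        rw [Multiset.count_cons_of_ne this, Finsupp.single_eq_of_ne (Ne.symm hf), zero_add]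
    · have : a ≠ b := fun h => hi (h ▸ rfl)
      rw [Multiset.filter_cons_of_neg (p := fun b => i b = i a) _ hi, Multiset.count_cons_of_ne this, ih']

namespace QuadraticBasis

variable {R : Type*} [CommRing R] [IsDedekindDomain R] [Module.Free ℤ R] {k : ℕ}

theorem exists_prime_dvd_span (q : QuadraticBasis R k) {P : Ideal R} (hP : Prime P) :
    (Ideal.absNorm P).minFac.Prime ∧ P ∣ Ideal.span {(((Ideal.absNorm P).minFac : ℤ) : R)} := by
  have := Module.Finite.of_basis q.b
  have hP' := Ideal.isPrime_of_prime hP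
  have h0 : Ideal.absNorm P ≠ 0 := Ideal.absNorm_ne_zero_iff_mem_nonZeroDivisors.2
    (mem_nonZeroDivisors_iff_ne_zero.2 hP.ne_zero)
  have h1 : Ideal.absNorm P ≠ 1 := fun h => hP'.ne_top (Ideal.absNorm_eq_one_iff.1 h)
  obtain ⟨p, hp, hpP⟩ : ∃ p : ℕ, p.Prime ∧ (p : R) ∈ P := by
    have h2 : ((Multiset.map (Nat.cast : ℕ → R) (Ideal.absNorm P).primeFactorsList).prod) ∈ P := by
      rw [Multiset.map_coe, Multiset.prod_coe, ← Nat.cast_list_prod, Nat.prod_primeFactorsList h0]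
      exact Ideal.absNorm_mem P
    obtain ⟨x, hx, hxP⟩ := (hP'.multiset_prod_mem_iff_exists_mem _).1 h2
    obtain ⟨p, hp, rfl⟩ := Multiset.mem_map.1 hx
    exact ⟨p, Nat.prime_of_mem_primeFactorsList hp, hxP⟩
  have hdvd : P ∣ Ideal.span {((p : ℤ) : R)} := by
    rw [Ideal.dvd_span_singleton]; simpa using hpP
  have h3 := map_dvd Ideal.absNorm hdvd
  rw [q.absNorm_span_int, Int.natAbs_natCast] at h3
  have h4 : (Ideal.absNorm P).minFac = p := by
    have h5 := (Nat.minFac_prime h1).dvd_of_dvd_pow ((Nat.minFac_dvd _).trans h3)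
    exact (Nat.prime_dvd_prime_iff_eq (Nat.minFac_prime h1) hp).1 h5
  rw [h4]
  exact ⟨hp, hdvd⟩

theorem card_primes_over_le (q : QuadraticBasis R k) {p : ℕ} (hp : p.Prime) (s : Finset (Ideal R))
    (hs : ∀ P ∈ s, Prime P ∧ (Ideal.absNorm P).minFac = p) : s.card ≤ 2 := by
  have h1 : ∏ P ∈ s, P ∣ Ideal.span {((p : ℤ) : R)} := by
    refine Finset.prod_primes_dvd _ (fun P hP => (hs P hP).1) fun P hP => ?_
    have := (q.exists_prime_dvd_span (hs P hP).1).2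
    rwa [(hs P hP).2] at this
  have h2 := map_dvd Ideal.absNorm h1
  rw [map_prod, q.absNorm_span_int, Int.natAbs_natCast] at h2
  have h3 : p ^ s.card ∣ ∏ P ∈ s, Ideal.absNorm P := by
    rw [← Finset.prod_const]
    refine Finset.prod_dvd_prod_of_dvd _ _ fun P hP => ?_
    rw [← (hs P hP).2]
    exact Nat.minFac_dvd _
  exact (Nat.pow_dvd_pow_iff_le_right hp.one_lt).1 (h3.trans h2)

theorem exists_index (q : QuadraticBasis R k) : ∃ i : Ideal R → Bool, ∀ P P' : Ideal R,
    Prime P → Prime P' → (Ideal.absNorm P).minFac = (Ideal.absNorm P').minFac → i P = i P' →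
      P = P' := by
  have h : ∀ p : ℕ, ∃ i : Ideal R → Bool, ∀ P P' : Ideal R, Prime P → Prime P' →
      (Ideal.absNorm P).minFac = p → (Ideal.absNorm P').minFac = p → i P = i P' → P = P' := by
    intro p
    by_cases hex : ∃ Q : Ideal R, Prime Q ∧ (Ideal.absNorm Q).minFac = p
    · obtain ⟨Q, hQ, hQp⟩ := hex
      have hp : p.Prime := hQp ▸ (q.exists_prime_dvd_span hQ).1
      refine ⟨fun P => decide (P = Q), fun P P' hP hP' h1 h2 hi => ?_⟩
      by_cases h3 : P = Q
      · subst h3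
        simpa [eq_comm] using hi
      · by_cases h4 : P' = Q
        · subst h4
          simpa using hi
        · by_contra hne
          have := q.card_primes_over_le hp {Q, P, P'} (by
            intro T hT
            simp only [Finset.mem_insert, Finset.mem_singleton] at hT
            rcases hT with rfl | rfl | rfl <;> constructor <;> assumption)
          rw [Finset.card_eq_three.2 ⟨Q, P, P', Ne.symm h3, Ne.symm h4, hne, rfl⟩] at this
          omega
    · exact ⟨fun _ => true, fun P _ hP _ h1 => (hex ⟨P, hP, h1⟩).elim⟩
  choose i hi using h
  exact ⟨fun P => i (Ideal.absNorm P).minFac P, fun P P' hP hP' h1 h2 =>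
    hi _ P P' hP hP' rfl h1.symm (by simpa only [h1] using h2)⟩

/-- Ideals inject into pairs of positive integers with product at most the norm. -/
theorem exists_injective_pair (q : QuadraticBasis R k) : ∃ f : (Ideal R)⁰ → ℕ × ℕ,
    Function.Injective f ∧ ∀ I, 0 < (f I).1 ∧ 0 < (f I).2 ∧
      (f I).1 * (f I).2 ≤ Ideal.absNorm (I : Ideal R) := by
  obtain ⟨i, hi⟩ := q.exists_index
  let n : Ideal R → ℕ := fun P => (Ideal.absNorm P).minFac
  let g : Bool → Ideal R → ℕ := fun j I => (((normalizedFactors I).filter fun P => i P = j).map n).prod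
  have hprime : ∀ I : Ideal R, ∀ P ∈ normalizedFactors I, Prime P :=
    fun I P hP => prime_of_normalized_factor P hP
  have hcount : ∀ (I P : Ideal R), Prime P →
      (normalizedFactors I).count P = (g (i P) I).factorization (n P) := by
    intro I P hP
    exact count_eq_factorization_prod n i _ (fun Q hQ => (q.exists_prime_dvd_span (hprime I Q hQ)).1)
      fun Q hQ h1 h2 => hi Q P (hprime I Q hQ) hP h1 h2
  have hpos : ∀ j I, 0 < g j I := by
    intro j I
    refine Nat.pos_of_ne_zero fun h => ?_
    obtain ⟨P, hP, h0⟩ := Multiset.mem_map.1 (Multiset.prod_eq_zero_iff.1 h)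
    exact (q.exists_prime_dvd_span (hprime I P (Multiset.mem_filter.1 hP).1)).1.ne_zero h0
  refine ⟨fun I => (g true I, g false I), ?_, fun I => ⟨hpos _ _, hpos _ _, ?_⟩⟩
  · intro I I' h
    obtain ⟨h1, h2⟩ := Prod.ext_iff.1 h
    have hg : ∀ j, g j I = g j I' := by rintro (_ | _) <;> assumption
    have hnf : normalizedFactors (I : Ideal R) = normalizedFactors (I' : Ideal R) := by
      ext P
      by_cases hP : Prime P
      · rw [hcount _ _ hP, hcount _ _ hP, hg]
      · rw [Multiset.count_eq_zero_of_notMem fun h => hP (hprime _ _ h),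
          Multiset.count_eq_zero_of_notMem fun h => hP (hprime _ _ h)]
    refine Subtype.ext ?_
    rw [← Ideal.prod_normalizedFactors_eq_self (nonZeroDivisors.coe_ne_zero I), hnf,
      Ideal.prod_normalizedFactors_eq_self (nonZeroDivisors.coe_ne_zero I')]
  · have h1 : g true I * g false I = ((normalizedFactors (I : Ideal R)).map n).prod := by
      simp only [g]
      rw [← Multiset.prod_add, ← Multiset.map_add]
      congr 2
      convert Multiset.filter_add_not (fun P => i P = true) (normalizedFactors (I : Ideal R)) using 3
      simp
    have h2 : Ideal.absNorm (I : Ideal R) =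
        ((normalizedFactors (I : Ideal R)).map Ideal.absNorm).prod := by
      conv_lhs => rw [← Ideal.prod_normalizedFactors_eq_self (nonZeroDivisors.coe_ne_zero I)]
      exact map_multiset_prod _ _
    change g true I * g false I ≤ _
    rw [h1, h2]
    refine Multiset.prod_map_le_prod_map₀ _ _ (fun _ _ => Nat.zero_le _) fun P hP => ?_
    refine Nat.minFac_le (Nat.pos_of_ne_zero ?_)
    have := Module.Finite.of_basis q.b
    exact Ideal.absNorm_ne_zero_iff_mem_nonZeroDivisors.2
      (mem_nonZeroDivisors_iff_ne_zero.2 (hprime _ P hP).ne_zero)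

end QuadraticBasis

theorem tsum_rpow_neg_le {σ : ℝ} (hσ : 1 < σ) :
    ∑' n : ℕ, (n : ℝ) ^ (-σ) ≤ σ / (σ - 1) := by
  have h := ZetaAsymptotics.zeta_limit_aux1 hσ
  have h0 : 0 ≤ ZetaAsymptotics.termTSum σ := tsum_nonneg fun n => ZetaAsymptotics.term_nonneg _ _
  have hs : Summable fun n : ℕ => (n : ℝ) ^ (-σ) := Real.summable_nat_rpow.2 (by linarith)
  rw [hs.tsum_eq_zero_add]
  have h1 : ∑' n : ℕ, ((n + 1 : ℕ) : ℝ) ^ (-σ) = ∑' n : ℕ, 1 / (n + 1 : ℝ) ^ σ := by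
    refine tsum_congr fun n => ?_
    rw [Real.rpow_neg (by positivity)]; simp
  have h2 : σ / (σ - 1) = 1 / (σ - 1) + 1 := by
    have : σ - 1 ≠ 0 := by linarith
    field_simp; ring
  rw [h1, h2, Nat.cast_zero, Real.zero_rpow (by linarith)]
  nlinarith

namespace QuadraticBasis

variable {R : Type*} [CommRing R] [IsDedekindDomain R] [Module.Free ℤ R] {k : ℕ}

theorem summable_tsum_absNorm_rpow (q : QuadraticBasis R k) {σ : ℝ} (hσ : 1 < σ) :
    (Summable fun I : (Ideal R)⁰ => (Ideal.absNorm (I : Ideal R) : ℝ) ^ (-σ)) ∧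
    ∑' I : (Ideal R)⁰, (Ideal.absNorm (I : Ideal R) : ℝ) ^ (-σ) ≤ (σ / (σ - 1)) ^ 2 := by
  obtain ⟨f, hf, hf'⟩ := q.exists_injective_pair
  have hs : Summable fun n : ℕ => (n : ℝ) ^ (-σ) := Real.summable_nat_rpow.2 (by linarith)
  have h0 : ∀ n : ℕ, 0 ≤ (n : ℝ) ^ (-σ) := fun n => by positivity
  have hs2 : Summable fun p : ℕ × ℕ => (p.1 : ℝ) ^ (-σ) * (p.2 : ℝ) ^ (-σ) :=
    hs.mul_of_nonneg hs h0 h0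
  have hle : ∀ I : (Ideal R)⁰, (Ideal.absNorm (I : Ideal R) : ℝ) ^ (-σ) ≤
      ((f I).1 : ℝ) ^ (-σ) * ((f I).2 : ℝ) ^ (-σ) := by
    intro I
    obtain ⟨h1, h2, h3⟩ := hf' I
    rw [← Real.mul_rpow (by positivity) (by positivity)]
    refine Real.rpow_le_rpow_of_nonpos (by positivity) ?_ (by linarith)
    exact_mod_cast h3
  have hsf : Summable fun I : (Ideal R)⁰ => (Ideal.absNorm (I : Ideal R) : ℝ) ^ (-σ) :=
    (hs2.comp_injective hf).of_nonneg_of_le (fun I => by positivity) hle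
  refine ⟨hsf, ?_⟩
  calc _ ≤ ∑' p : ℕ × ℕ, (p.1 : ℝ) ^ (-σ) * (p.2 : ℝ) ^ (-σ) :=
        hsf.tsum_le_tsum_of_inj f hf (fun p _ => by positivity) hle hs2
    _ = (∑' n : ℕ, (n : ℝ) ^ (-σ)) * ∑' n : ℕ, (n : ℝ) ^ (-σ) :=
        (hs.tsum_mul_tsum hs hs2).symm
    _ ≤ _ := by
        rw [sq]
        have := tsum_rpow_neg_le hσ
        have h1 : 0 ≤ ∑' n : ℕ, (n : ℝ) ^ (-σ) := tsum_nonneg h0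
        gcongr

end QuadraticBasis

end IdealZeta

section CharacterSums

open nonZeroDivisors Finset

/-- The nonzero ideals of norm at most `n`. -/
noncomputable def normLe (R : Type*) [CommRing R] [IsDedekindDomain R] [Module.Free ℤ R]
    [Module.Finite ℤ R] [CharZero R] (n : ℕ) : Finset (Ideal R)⁰ :=
  (Ideal.finite_setOfPred_absNorm_le₀ (S := R) n).toFinset

/-- The coefficients of the `L`-series of a class group character. -/
noncomputable def coef {R : Type*} [CommRing R] [IsDedekindDomain R] [Module.Free ℤ R]
    [Module.Finite ℤ R] [CharZero R] (ψ : ClassGroup R →* ℂ) (n : ℕ) : ℂ :=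
  ∑ I ∈ (normLe R n).filter (fun I : (Ideal R)⁰ => Ideal.absNorm (I : Ideal R) = n),
    ψ (ClassGroup.mk0 I)

variable {R : Type*} [CommRing R] [IsDedekindDomain R] [Module.Free ℤ R]

theorem absNorm_pos_of_nonZeroDivisors [Module.Finite ℤ R] [CharZero R] (I : (Ideal R)⁰) :
    0 < Ideal.absNorm (I : Ideal R) :=
  Nat.pos_of_ne_zero (Ideal.absNorm_ne_zero_iff_mem_nonZeroDivisors.2 I.2)

theorem norm_map_eq_one {G : Type*} [Group G] [Finite G] (ψ : G →* ℂ) (g : G) : ‖ψ g‖ = 1 := by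
  have := isOfFinOrder_of_finite g
  exact (ψ.isOfFinOrder this).norm_eq_one

variable [Module.Finite ℤ R] [CharZero R]

theorem mem_normLe {n : ℕ} {I : (Ideal R)⁰} : I ∈ normLe R n ↔ Ideal.absNorm (I : Ideal R) ≤ n := by
  simp [normLe]

theorem sum_coef (ψ : ClassGroup R →* ℂ) (n : ℕ) :
    ∑ j ∈ Icc 1 n, coef ψ j = ∑ I ∈ normLe R n, ψ (ClassGroup.mk0 I) := by
  rw [← Finset.sum_fiberwise_of_maps_to (t := Icc 1 n)
    (g := fun I : (Ideal R)⁰ => Ideal.absNorm (I : Ideal R))]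
  · refine Finset.sum_congr rfl fun j hj => ?_
    rw [coef]
    refine Finset.sum_congr ?_ fun _ _ => rfl
    ext I
    simp only [mem_filter, mem_normLe]
    have := (mem_Icc.1 hj).2
    constructor <;> rintro ⟨h1, h2⟩ <;> exact ⟨by omega, h2⟩
  · exact fun I hI => mem_Icc.2 ⟨absNorm_pos_of_nonZeroDivisors I, mem_normLe.1 hI⟩

namespace QuadraticBasis

variable {k : ℕ}

theorem one_lt_log_disc (hk : 1 < k) : 1 < Real.log (4 * k - 1) := by
  have hk' : (2 : ℝ) ≤ k := by exact_mod_cast hk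
  rw [Real.lt_log_iff_exp_lt (by linarith)]
  have := Real.exp_one_lt_d9
  linarith

omit [Module.Finite ℤ R] [CharZero R] in
theorem zeta_bound (q : QuadraticBasis R k) (hk : 1 < k) :
    (Summable fun I : (Ideal R)⁰ => (Ideal.absNorm (I : Ideal R) : ℝ) ^
      (-(1 + 1 / Real.log (4 * k - 1)))) ∧
    ∑' I : (Ideal R)⁰, (Ideal.absNorm (I : Ideal R) : ℝ) ^ (-(1 + 1 / Real.log (4 * k - 1))) ≤
      (Real.log (4 * k - 1) + 1) ^ 2 := by
  have hL := one_lt_log_disc hk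
  obtain ⟨h1, h2⟩ := q.summable_tsum_absNorm_rpow (σ := 1 + 1 / Real.log (4 * k - 1))
    (by have : 0 < 1 / Real.log (4 * k - 1) := by positivity
        linarith)
  refine ⟨h1, h2.trans_eq ?_⟩
  congr 1
  field_simp
  ring

theorem rpow_one_div_log_le (hk : 1 < k) {t : ℝ} (ht : 0 < t) (htΔ : t ≤ 4 * k - 1) :
    t ^ (1 / Real.log (4 * k - 1)) ≤ 3 := by
  have hL := one_lt_log_disc hk
  have h1 : t ^ (1 / Real.log (4 * k - 1)) ≤ Real.exp 1 := by
    rw [Real.rpow_def_of_pos ht]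
    refine Real.exp_le_exp.2 ?_
    rw [mul_one_div, div_le_one (by linarith)]
    exact Real.log_le_log ht htΔ
  linarith [Real.exp_one_lt_d9]

theorem card_normLe_le (q : QuadraticBasis R k) (hk : 1 < k) {n : ℕ} {t : ℝ} (hn : (n : ℝ) ≤ t)
    (ht : 1 ≤ t) (htΔ : t ≤ 4 * k - 1) :
    ((normLe R n).card : ℝ) ≤ 3 * (Real.log (4 * k - 1) + 1) ^ 2 * t := by
  obtain ⟨h1, h2⟩ := q.zeta_bound hk
  have ht0 : 0 < t := by linarith
  set σ := 1 + 1 / Real.log (4 * k - 1) with hσ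
  have hσ0 : 0 < σ := by
    have hL := one_lt_log_disc hk
    positivity
  have h3 : ∀ I ∈ normLe R n, (1 : ℝ) ≤ t ^ σ * (Ideal.absNorm (I : Ideal R) : ℝ) ^ (-σ) := by
    intro I hI
    have hpos : (0 : ℝ) < Ideal.absNorm (I : Ideal R) := by
      exact_mod_cast absNorm_pos_of_nonZeroDivisors I
    rw [Real.rpow_neg hpos.le, ← div_eq_mul_inv, one_le_div (by positivity)]
    refine Real.rpow_le_rpow hpos.le (le_trans ?_ hn) hσ0.le
    exact_mod_cast mem_normLe.1 hI
  calc ((normLe R n).card : ℝ) = ∑ I ∈ normLe R n, (1 : ℝ) := by simp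
    _ ≤ ∑ I ∈ normLe R n, t ^ σ * (Ideal.absNorm (I : Ideal R) : ℝ) ^ (-σ) := Finset.sum_le_sum h3
    _ = t ^ σ * ∑ I ∈ normLe R n, (Ideal.absNorm (I : Ideal R) : ℝ) ^ (-σ) := by
        rw [Finset.mul_sum]
    _ ≤ t ^ σ * (Real.log (4 * k - 1) + 1) ^ 2 := by
        gcongr
        exact (h1.sum_le_tsum _ fun I _ => by positivity).trans h2
    _ ≤ t * 3 * (Real.log (4 * k - 1) + 1) ^ 2 := by
        gcongr
        rw [hσ, Real.rpow_add ht0, Real.rpow_one]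
        gcongr
        exact rpow_one_div_log_le hk ht0 htΔ
    _ = _ := by ring

theorem sqrt_disc_mem (hk : 1 < k) : 1 ≤ √(4 * k - 1 : ℝ) ∧ √(4 * k - 1 : ℝ) ≤ 4 * k - 1 := by
  have hk' : (2 : ℝ) ≤ k := by exact_mod_cast hk
  have h1 : 1 ≤ √(4 * k - 1 : ℝ) := Real.one_le_sqrt.2 (by linarith)
  have h2 := Real.mul_self_sqrt (show (0 : ℝ) ≤ 4 * k - 1 by linarith)
  exact ⟨h1, by nlinarith⟩

variable [Fintype (ClassGroup R)]

/-- Bounds for a system of representatives of small norm. -/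
theorem exists_representatives (q : QuadraticBasis R k) (hk : 1 < k) :
    (Fintype.card (ClassGroup R) : ℝ) ≤ 3 * (Real.log (4 * k - 1) + 1) ^ 2 * √(4 * k - 1) ∧
    ∃ m : ClassGroup R → ℕ, (∀ C, 0 < m C) ∧
      ∑ C, √(1 / m C) ≤ 3 * (Real.log (4 * k - 1) + 1) ^ 2 * √√(4 * k - 1) ∧
      ∀ C : ClassGroup R, ∀ t : ℝ, 0 < t →
        |(#{I ∈ normLe R ⌊t⌋₊ | ClassGroup.mk0 I = C} : ℝ) -
          4 * quarterArea * t / √(4 * k - 1)| ≤ 5 * √(t / m C) + 2 := by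
  choose J hJ m e hJC hprim hm using q.exists_reduced (by omega : 0 < k)
  have hk' : (2 : ℝ) ≤ k := by exact_mod_cast hk
  have hm1 : ∀ C, (m C : ℝ) ≤ √(4 * k - 1) := by
    intro C
    refine Real.le_sqrt_of_sq_le ?_
    have : 3 * (m C : ℝ) ^ 2 ≤ 4 * k - 1 := by exact_mod_cast hm C
    nlinarith
  have hm0 : ∀ C, (0 : ℝ) < m C := fun C => by exact_mod_cast (hprim C).1
  let g : ClassGroup R → (Ideal R)⁰ := fun C => ⟨J C, hJ C⟩
  have hg : Function.Injective g := fun C C' h => by rw [← hJC C, ← hJC C']; exact congrArg _ h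
  have hgm : ∀ C, Ideal.absNorm (g C : Ideal R) = m C := fun C => (hprim C).absNorm
  obtain ⟨hs1, hs2⟩ := sqrt_disc_mem hk
  obtain ⟨hz1, hz2⟩ := q.zeta_bound hk
  set s := √(4 * k - 1 : ℝ) with hs
  refine ⟨?_, fun C => m C⁻¹, fun C => (hprim _).1, ?_, ?_⟩
  · refine le_trans ?_ (q.card_normLe_le hk (Nat.floor_le (by linarith : 0 ≤ s)) hs1 hs2)
    have : (univ.image g) ⊆ normLe R ⌊s⌋₊ := by
      intro I hI
      obtain ⟨C, -, rfl⟩ := Finset.mem_image.1 hI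
      rw [mem_normLe, hgm]
      exact Nat.le_floor (hm1 C)
    have h2 := Finset.card_le_card this
    rw [Finset.card_image_of_injective _ hg, Finset.card_univ] at h2
    exact_mod_cast h2
  · have hinv := Fintype.sum_equiv (Equiv.inv (ClassGroup R)) (fun C => √(1 / (m C⁻¹ : ℝ)))
      (fun C => √(1 / (m C : ℝ))) (fun C => rfl)
    refine hinv.trans_le ?_
    set L := Real.log (4 * k - 1)
    have hL : 1 < L := one_lt_log_disc hk
    have hterm : ∀ C, √(1 / m C : ℝ) ≤ 3 * √s * (m C : ℝ) ^ (-(1 + 1 / L)) := by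
      intro C
      have h1 : √(1 / m C : ℝ) = (m C : ℝ) ^ (-(1 + 1 / L)) * ((m C : ℝ) ^ (1 / L) * √(m C)) := by
        rw [Real.sqrt_eq_rpow, Real.sqrt_eq_rpow, one_div, Real.inv_rpow (hm0 C).le,
          ← Real.rpow_neg (hm0 C).le, ← Real.rpow_add (hm0 C), ← Real.rpow_add (hm0 C)]
        congr 1; ring
      rw [h1, mul_comm]
      refine mul_le_mul_of_nonneg_right ?_ (by positivity)
      exact mul_le_mul (rpow_one_div_log_le hk (hm0 C) ((hm1 C).trans hs2))
        (Real.sqrt_le_sqrt (hm1 C)) (by positivity) (by positivity)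
    calc ∑ C, √(1 / m C : ℝ) ≤ ∑ C, 3 * √s * (m C : ℝ) ^ (-(1 + 1 / L)) :=
          Finset.sum_le_sum fun C _ => hterm C
      _ = 3 * √s * ∑ C, (Ideal.absNorm (g C : Ideal R) : ℝ) ^ (-(1 + 1 / L)) := by
          rw [Finset.mul_sum]; simp only [hgm]
      _ ≤ 3 * √s * (L + 1) ^ 2 := by
          gcongr
          refine le_trans ?_ hz2
          rw [← Finset.sum_image (s := univ) (g := g)
            (f := fun I : (Ideal R)⁰ => (Ideal.absNorm (I : Ideal R) : ℝ) ^ (-(1 + 1 / L)))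
            (hg.injOn)]
          exact hz1.sum_le_tsum _ fun I _ => by positivity
      _ = _ := by ring
  · intro C t ht
    have hset : {I : (Ideal R)⁰ | ClassGroup.mk0 I = C ∧ (Ideal.absNorm (I : Ideal R) : ℝ) ≤ t} =
        (({I ∈ normLe R ⌊t⌋₊ | ClassGroup.mk0 I = C} : Finset _) : Set (Ideal R)⁰) := by
      ext I
      simp [mem_normLe, Nat.le_floor_iff ht.le, and_comm]
    have h1 := q.abs_ncard_class_sub_le hk (hJC C⁻¹) (hprim C⁻¹) (hm C⁻¹) ht
      (hset ▸ Finset.finite_toSet _)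
    rwa [hset, Set.ncard_coe_finset] at h1

/-- Character sums over ideals of norm at most `t`. -/
theorem norm_sum_coef_sub_le (q : QuadraticBasis R k) (hk : 1 < k) (ψ : ClassGroup R →* ℂ)
    {t : ℝ} (ht : 1 ≤ t) :
    ‖∑ j ∈ Icc 1 ⌊t⌋₊, coef ψ j - (4 * quarterArea / √(4 * k - 1) : ℝ) * (∑ C, ψ C) * t‖ ≤
      45 * (quarterArea + 1) * (Real.log (4 * k - 1) + 1) ^ 2 * min t (√√(4 * k - 1) * √t) := by
  obtain ⟨hh, m, hm0, hmsum, hcount⟩ := q.exists_representatives hk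
  obtain ⟨hs1, hs2⟩ := sqrt_disc_mem hk
  have hψ := norm_map_eq_one ψ
  have hc0 := quarterArea_nonneg
  have hL : 1 < Real.log (4 * k - 1) := one_lt_log_disc hk
  have ht0 : 0 < t := by linarith
  set L2 := (Real.log (4 * k - 1) + 1) ^ 2 with hL2
  have hL20 : 0 < L2 := by positivity
  set s := √(4 * k - 1 : ℝ) with hs
  have hss := Real.mul_self_sqrt (show 0 ≤ s by linarith)
  have htt := Real.mul_self_sqrt ht0.le
  have hs0 : 0 < √s := Real.sqrt_pos.2 (by linarith)
  have hst0 : 0 < √t := Real.sqrt_pos.2 ht0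
  rw [sum_coef]
  rcases le_total s t with hst | hst
  · have hmin : min t (√s * √t) = √s * √t := by
      refine min_eq_right ?_
      have := Real.sqrt_le_sqrt hst
      nlinarith
    rw [hmin]
    have h1 : ∑ I ∈ normLe R ⌊t⌋₊, ψ (ClassGroup.mk0 I) =
        ∑ C, (#{I ∈ normLe R ⌊t⌋₊ | ClassGroup.mk0 I = C} : ℂ) * ψ C := by
      rw [← Finset.sum_fiberwise (g := fun I : (Ideal R)⁰ => ClassGroup.mk0 I)]
      refine Finset.sum_congr rfl fun C _ => ?_
      rw [Finset.sum_congr rfl (g := fun _ => ψ C)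
        (fun I hI => by rw [(Finset.mem_filter.1 hI).2]), Finset.sum_const, nsmul_eq_mul]
    have h2 : ∑ I ∈ normLe R ⌊t⌋₊, ψ (ClassGroup.mk0 I) - (4 * quarterArea / s : ℝ) * (∑ C, ψ C) * t =
        ∑ C, (((#{I ∈ normLe R ⌊t⌋₊ | ClassGroup.mk0 I = C} : ℝ) - 4 * quarterArea * t / s : ℝ) : ℂ)
          * ψ C := by
      rw [h1, Finset.mul_sum, Finset.sum_mul, ← Finset.sum_sub_distrib]
      refine Finset.sum_congr rfl fun C _ => ?_
      push_cast; ring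
    rw [h2]
    calc _ ≤ ∑ C : ClassGroup R, (5 * √t * √(1 / m C) + 2) := by
          refine (norm_sum_le _ _).trans (Finset.sum_le_sum fun C _ => ?_)
          rw [norm_mul, hψ, mul_one, Complex.norm_real, Real.norm_eq_abs]
          refine (hcount C t ht0).trans_eq ?_
          rw [div_eq_mul_one_div t, Real.sqrt_mul ht0.le, mul_assoc]
      _ = 5 * √t * ∑ C : ClassGroup R, √(1 / m C) + 2 * Fintype.card (ClassGroup R) := by
          rw [Finset.sum_add_distrib, Finset.mul_sum, Finset.sum_const, Finset.card_univ,
            nsmul_eq_mul, mul_comm (2 : ℝ)]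
      _ ≤ 5 * √t * (3 * L2 * √s) + 2 * (3 * L2 * s) := by gcongr
      _ ≤ 5 * √t * (3 * L2 * √s) + 2 * (3 * L2 * (√s * √t)) := by
          have : s ≤ √s * √t := by
            have := Real.sqrt_le_sqrt hst
            nlinarith
          gcongr
      _ = 21 * L2 * (√s * √t) := by ring
      _ ≤ _ := by
          gcongr
          nlinarith
  · have hmin : min t (√s * √t) = t := by
      refine min_eq_left ?_
      have := Real.sqrt_le_sqrt hst
      nlinarith
    rw [hmin]
    have h1 : ‖∑ I ∈ normLe R ⌊t⌋₊, ψ (ClassGroup.mk0 I)‖ ≤ 3 * L2 * t := by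
      refine (norm_sum_le _ _).trans ?_
      simp only [hψ, Finset.sum_const, nsmul_eq_mul, mul_one]
      exact q.card_normLe_le hk (Nat.floor_le ht0.le) ht (hst.trans hs2)
    have h2 : ‖∑ C, ψ C‖ ≤ 3 * L2 * s := by
      refine (norm_sum_le _ _).trans ?_
      simp only [hψ, Finset.sum_const, nsmul_eq_mul, mul_one, Finset.card_univ]
      exact hh
    have h3 : ‖((4 * quarterArea / s : ℝ) : ℂ) * (∑ C, ψ C) * t‖ ≤ 12 * quarterArea * L2 * t := by
      rw [norm_mul, norm_mul, Complex.norm_real, Complex.norm_real, Real.norm_of_nonneg (by positivity),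
        Real.norm_of_nonneg ht0.le]
      calc _ ≤ 4 * quarterArea / s * (3 * L2 * s) * t := by gcongr
        _ = _ := by field_simp; ring
    refine (norm_sub_le _ _).trans ((add_le_add h1 h3).trans ?_)
    have : 0 ≤ L2 * t := by positivity
    nlinarith [mul_nonneg hc0 this]

theorem sum_eq_zero_of_ne_one {G : Type*} [Group G] [Fintype G] {ψ : G →* ℂ} (hψ : ψ ≠ 1) :
    ∑ g, ψ g = 0 := by
  obtain ⟨a, ha⟩ : ∃ a, ψ a ≠ 1 := by
    by_contra! h
    exact hψ (MonoidHom.ext h)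
  have h1 : ψ a * ∑ g, ψ g = ∑ g, ψ g := by
    rw [Finset.mul_sum]
    exact Fintype.sum_equiv (Equiv.mulLeft a) _ _ fun g => by simp
  have h2 : (ψ a - 1) * ∑ g, ψ g = 0 := by rw [sub_mul, h1]; ring
  exact (mul_eq_zero.1 h2).resolve_left (sub_ne_zero.2 ha)

end QuadraticBasis

end CharacterSums

section IdealMangoldt

open nonZeroDivisors Finset UniqueFactorizationMonoid

/-- The von Mangoldt function on ideals. -/
noncomputable def idealMangoldt {R : Type*} [CommRing R] [IsDedekindDomain R] [Module.Free ℤ R]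
    (J : Ideal R) : ℝ :=
  if h : ∃ P : Ideal R, Prime P ∧ ∃ k : ℕ, k ≠ 0 ∧ J = P ^ k then
    Real.log (Ideal.absNorm h.choose) else 0

variable {R : Type*} [CommRing R] [IsDedekindDomain R] [Module.Free ℤ R]

omit [Module.Free ℤ R] in
theorem Ideal.eq_of_pow_eq_pow {P Q : Ideal R} (hP : Prime P) (hQ : Prime Q) {i j : ℕ} (hi : i ≠ 0)
    (h : P ^ i = Q ^ j) : P = Q := by
  have h1 : P ∣ Q := hP.dvd_of_dvd_pow (h ▸ dvd_pow_self P hi)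
  exact associated_iff_eq.1 (hP.associated_of_dvd hQ h1)

theorem idealMangoldt_pow {P : Ideal R} (hP : Prime P) {i : ℕ} (hi : i ≠ 0) :
    idealMangoldt (P ^ i) = Real.log (Ideal.absNorm P) := by
  have h : ∃ Q : Ideal R, Prime Q ∧ ∃ k : ℕ, k ≠ 0 ∧ P ^ i = Q ^ k := ⟨P, hP, i, hi, rfl⟩
  rw [idealMangoldt, dif_pos h]
  obtain ⟨h1, k, hk, h2⟩ := h.choose_spec
  exact congrArg (fun Q => Real.log (Ideal.absNorm Q)) (Ideal.eq_of_pow_eq_pow hP h1 hi h2).symm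

theorem idealMangoldt_nonneg (J : Ideal R) : 0 ≤ idealMangoldt J := by
  rw [idealMangoldt]
  split_ifs
  · exact Real.log_natCast_nonneg _
  · exact le_rfl

omit [Module.Free ℤ R] in
theorem pow_dvd_iff_le_count {P K : Ideal R} (hP : Prime P) (hK : K ≠ 0) {i : ℕ} :
    P ^ i ∣ K ↔ i ≤ (normalizedFactors K).count P := by
  rw [pow_dvd_iff_le_emultiplicity, emultiplicity_eq_count_normalizedFactors hP.irreducible hK,
    normalize_eq, Nat.cast_le]

variable [Module.Finite ℤ R] [CharZero R]

theorem sum_idealMangoldt {K : Ideal R} (hK : K ≠ 0) (S : Finset (Ideal R)⁰)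
    (hS : ∀ J : (Ideal R)⁰, (J : Ideal R) ∣ K → J ∈ S) :
    ∑ J ∈ S.filter (fun J : (Ideal R)⁰ => (J : Ideal R) ∣ K), idealMangoldt (J : Ideal R) =
      Real.log (Ideal.absNorm K) := by
  set f := normalizedFactors K with hf
  have hprime : ∀ P ∈ f, Prime P := fun P hP => prime_of_normalized_factor P hP
  have hmem0 : ∀ P ∈ f, ∀ i : ℕ, P ^ i ∈ (Ideal R)⁰ := fun P hP i =>
    mem_nonZeroDivisors_iff_ne_zero.2 (pow_ne_zero _ (hprime P hP).ne_zero)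
  have h1 : Real.log (Ideal.absNorm K) = (f.map fun P => Real.log (Ideal.absNorm P)).sum := by
    have h2 : K = f.prod := (associated_iff_eq.1 (prod_normalizedFactors hK)).symm
    have h3 : ∀ g : Multiset (Ideal R), (∀ P ∈ g, P ≠ 0) →
        Real.log (Ideal.absNorm g.prod) = (g.map fun P => Real.log (Ideal.absNorm P)).sum := by
      intro g
      induction g using Multiset.induction_on with
      | empty => simp
      | cons P g ih =>
        intro hg
        have hg' : ∀ Q ∈ g, Q ≠ 0 := fun Q hQ => hg Q (Multiset.mem_cons_of_mem hQ)
        have hpos : ∀ Q : Ideal R, Q ≠ 0 → (Ideal.absNorm Q : ℝ) ≠ 0 := fun Q hQ =>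
          Nat.cast_ne_zero.2 (absNorm_pos_of_nonZeroDivisors
            ⟨Q, mem_nonZeroDivisors_iff_ne_zero.2 hQ⟩).ne'
        rw [Multiset.prod_cons, Multiset.map_cons, Multiset.sum_cons, map_mul, Nat.cast_mul,
          Real.log_mul (hpos P (hg P (Multiset.mem_cons_self P g))) (hpos _ ?_), ih hg']
        exact Multiset.prod_ne_zero fun h => hg' 0 h rfl
    conv_lhs => rw [h2]
    exact h3 f fun P hP => (hprime P hP).ne_zero
  rw [h1, Finset.sum_multiset_map_count]
  have h2 : ∑ P ∈ f.toFinset, f.count P • Real.log (Ideal.absNorm P : ℝ) =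
      ∑ x ∈ f.toFinset.sigma (fun P => Icc 1 (f.count P)), Real.log (Ideal.absNorm x.1) := by
    rw [Finset.sum_sigma]
    exact Finset.sum_congr rfl fun P _ => by simp
  rw [h2, eq_comm]
  refine Finset.sum_of_injOn (fun x : (_ : Ideal R) × ℕ => if h : x.1 ∈ f then
    (⟨x.1 ^ x.2, hmem0 x.1 h x.2⟩ : (Ideal R)⁰) else 1) ?_ ?_ ?_ ?_
  · rintro ⟨P, i⟩ hx ⟨Q, j⟩ hy hxy
    simp only [coe_sigma, Set.mem_sigma_iff, mem_coe, Multiset.mem_toFinset, mem_Icc] at hx hy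
    simp only [dif_pos hx.1, dif_pos hy.1, Subtype.mk.injEq] at hxy
    have h3 := Ideal.eq_of_pow_eq_pow (hprime P hx.1) (hprime Q hy.1) (by omega) hxy
    subst h3
    rw [pow_injective_of_not_isUnit (hprime P hx.1).not_isUnit (hprime P hx.1).ne_zero hxy]
  · rintro ⟨P, i⟩ hx
    simp only [coe_sigma, Set.mem_sigma_iff, mem_coe, Multiset.mem_toFinset, mem_Icc] at hx
    simp only [dif_pos hx.1, coe_filter, Set.mem_ofPred_eq]
    have := (pow_dvd_iff_le_count (hprime P hx.1) hK).2 hx.2.2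
    exact ⟨hS _ this, this⟩
  · intro J hJ hJ'
    rw [idealMangoldt, dif_neg]
    rintro ⟨P, hP, i, hi, hJP⟩
    refine hJ' ?_
    have hdvd := (mem_filter.1 hJ).2
    rw [hJP] at hdvd
    have hc := (pow_dvd_iff_le_count hP hK).1 hdvd
    have hPf : P ∈ f := Multiset.one_le_count_iff_mem.1 ((Nat.one_le_iff_ne_zero.2 hi).trans hc)
    refine ⟨⟨P, i⟩, ?_, ?_⟩
    · simp only [coe_sigma, Set.mem_sigma_iff, mem_coe, Multiset.mem_toFinset, mem_Icc]
      exact ⟨hPf, by omega, hc⟩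
    · simp only [dif_pos hPf]
      exact Subtype.ext hJP.symm
  · rintro ⟨P, i⟩ hx
    simp only [mem_sigma, Multiset.mem_toFinset, mem_Icc] at hx
    simp only [dif_pos hx.1]
    rw [idealMangoldt_pow (hprime P hx.1) (by omega)]

end IdealMangoldt

section IdealSeries

open nonZeroDivisors Finset

variable {R : Type*} [CommRing R] [IsDedekindDomain R] [Module.Free ℤ R] [Module.Finite ℤ R]
  [CharZero R]

/-- The sum of a weight over the ideals of given norm. -/
noncomputable def normFiberSum (w : (Ideal R)⁰ → ℂ) (n : ℕ) : ℂ :=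
  ∑ I ∈ (normLe R n).filter (fun I : (Ideal R)⁰ => Ideal.absNorm (I : Ideal R) = n), w I

/-- The von Mangoldt coefficients attached to a class group character. -/
noncomputable def mangoldtCoef (ψ : ClassGroup R →* ℂ) : ℕ → ℂ :=
  normFiberSum fun I => ψ (ClassGroup.mk0 I) * idealMangoldt (I : Ideal R)

theorem mem_filter_normLe {n m : ℕ} (h : m ≤ n) {I : (Ideal R)⁰} :
    I ∈ (normLe R n).filter (fun I : (Ideal R)⁰ => Ideal.absNorm (I : Ideal R) = m) ↔
      Ideal.absNorm (I : Ideal R) = m := by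
  rw [mem_filter, mem_normLe]
  exact ⟨fun h => h.2, fun h' => ⟨h'.trans_le h, h'⟩⟩

theorem normFiberSum_zero (w : (Ideal R)⁰ → ℂ) : normFiberSum w 0 = 0 := by
  refine Finset.sum_eq_zero fun I hI => absurd ((mem_filter_normLe le_rfl).1 hI) ?_
  exact (absNorm_pos_of_nonZeroDivisors I).ne'

theorem coef_convolution (ψ : ClassGroup R →* ℂ) :
    LSeries.convolution (coef ψ) (mangoldtCoef ψ) = LSeries.logMul (coef ψ) := by
  funext n
  rw [LSeries.convolution_def]
  rcases eq_or_ne n 0 with rfl | hn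
  · have : coef ψ 0 = 0 := normFiberSum_zero fun I => ψ (ClassGroup.mk0 I)
    simp [LSeries.logMul, this]
  set T : Finset ((Ideal R)⁰ × (Ideal R)⁰) := (normLe R n ×ˢ normLe R n).filter fun x =>
    Ideal.absNorm (x.1 : Ideal R) * Ideal.absNorm (x.2 : Ideal R) = n with hT
  set f : (Ideal R)⁰ × (Ideal R)⁰ → ℂ := fun x => ψ (ClassGroup.mk0 x.1) *
    (ψ (ClassGroup.mk0 x.2) * idealMangoldt (x.2 : Ideal R)) with hf
  have hTmem : ∀ x, x ∈ T ↔
      Ideal.absNorm (x.1 : Ideal R) * Ideal.absNorm (x.2 : Ideal R) = n := by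
    intro x
    rw [hT, mem_filter, mem_product, mem_normLe, mem_normLe]
    refine ⟨fun h => h.2, fun h => ⟨⟨?_, ?_⟩, h⟩⟩
    · exact h ▸ Nat.le_mul_of_pos_right _ (absNorm_pos_of_nonZeroDivisors x.2)
    · exact h ▸ Nat.le_mul_of_pos_left _ (absNorm_pos_of_nonZeroDivisors x.1)
  have h1 : ∑ p ∈ n.divisorsAntidiagonal, coef ψ p.1 * mangoldtCoef ψ p.2 = ∑ x ∈ T, f x := by
    rw [← Finset.sum_fiberwise_of_maps_to (t := n.divisorsAntidiagonal)
      (g := fun x : (Ideal R)⁰ × (Ideal R)⁰ =>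
        (Ideal.absNorm (x.1 : Ideal R), Ideal.absNorm (x.2 : Ideal R)))
      (fun x hx => Nat.mem_divisorsAntidiagonal.2 ⟨(hTmem x).1 hx, hn⟩)]
    refine Finset.sum_congr rfl fun p hp => ?_
    rw [coef, mangoldtCoef, normFiberSum, Finset.sum_mul_sum, ← Finset.sum_product']
    refine Finset.sum_congr ?_ fun _ _ => rfl
    ext x
    rw [mem_product, mem_filter_normLe le_rfl, mem_filter_normLe le_rfl, mem_filter, hTmem,
      Prod.ext_iff]
    refine ⟨fun h => ⟨?_, h⟩, fun h => h.2⟩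
    rw [h.1, h.2]
    exact (Nat.mem_divisorsAntidiagonal.1 hp).1
  refine h1.trans ?_
  rw [← Finset.sum_fiberwise_of_maps_to (s := T)
    (t := (normLe R n).filter fun I : (Ideal R)⁰ => Ideal.absNorm (I : Ideal R) = n)
    (g := fun x => x.1 * x.2)]
  · rw [LSeries.logMul, coef, Finset.mul_sum]
    refine Finset.sum_congr rfl fun K hK => ?_
    have hKn := (mem_filter_normLe le_rfl).1 hK
    have h2 := sum_idealMangoldt (mem_nonZeroDivisors_iff_ne_zero.1 K.2) (normLe R n) (by
      intro J hJ
      rw [mem_normLe, ← hKn]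
      exact Nat.le_of_dvd (absNorm_pos_of_nonZeroDivisors K) (map_dvd _ hJ))
    rw [hKn] at h2
    rw [← Complex.ofReal_natCast, ← Complex.ofReal_log (Nat.cast_nonneg n), ← h2,
      Complex.ofReal_sum, Finset.sum_mul]
    refine Finset.sum_of_injOn Prod.snd ?_ ?_ ?_ ?_
    · rintro ⟨I, J⟩ hx ⟨I', J'⟩ hy (rfl : J = J')
      have e1 := (mem_filter.1 hx).2
      have e2 := (mem_filter.1 hy).2
      have e3 : I * J = I' * J := e1.trans e2.symm
      have e4 : (I : Ideal R) * J = I' * J := by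
        have := congrArg (Subtype.val) e3
        simpa using this
      rw [Subtype.ext (mul_right_cancel₀ (mem_nonZeroDivisors_iff_ne_zero.1 J.2) e4)]
    · rintro ⟨I, J⟩ hx
      obtain ⟨e1, e2⟩ := mem_filter.1 hx
      have e3 := (hTmem _).1 e1
      rw [mem_coe, mem_filter, mem_normLe]
      refine ⟨(mem_normLe.1 (mem_product.1 (mem_filter.1 e1).1).2), ?_⟩
      rw [← e2]
      exact Dvd.intro_left (I : Ideal R) rfl
    · intro J hJ hJ'
      obtain ⟨I, hI⟩ := (mem_filter.1 hJ).2
      refine absurd ?_ hJ'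
      have hI0 : I ∈ (Ideal R)⁰ := mem_nonZeroDivisors_iff_ne_zero.2 fun h =>
        mem_nonZeroDivisors_iff_ne_zero.1 K.2 (by rw [hI, h, mul_zero])
      refine ⟨(⟨I, hI0⟩, J), ?_, rfl⟩
      rw [mem_coe, mem_filter, hTmem]
      refine ⟨?_, Subtype.ext ?_⟩
      · rw [← hKn, hI, map_mul, mul_comm]
      · rw [hI, mul_comm]; rfl
    · rintro ⟨I, J⟩ hx
      have e2 := (mem_filter.1 hx).2
      rw [hf, ← e2]
      simp only [map_mul]
      ring
  · intro x hx
    rw [mem_filter_normLe le_rfl, ← (hTmem x).1 hx, ← map_mul]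
    rfl

theorem idealMangoldt_le_log (I : (Ideal R)⁰) :
    idealMangoldt (I : Ideal R) ≤ Real.log (Ideal.absNorm (I : Ideal R)) := by
  have h := sum_idealMangoldt (mem_nonZeroDivisors_iff_ne_zero.1 I.2)
    (normLe R (Ideal.absNorm (I : Ideal R))) (fun J hJ => mem_normLe.2
      (Nat.le_of_dvd (absNorm_pos_of_nonZeroDivisors I) (map_dvd _ hJ)))
  rw [← h]
  exact Finset.single_le_sum (f := fun J : (Ideal R)⁰ => idealMangoldt (J : Ideal R))
    (fun J _ => idealMangoldt_nonneg _)
    (mem_filter.2 ⟨mem_normLe.2 le_rfl, dvd_rfl⟩)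

theorem coef_one (n : ℕ) : coef (1 : ClassGroup R →* ℂ) n =
    ((normLe R n).filter fun I : (Ideal R)⁰ => Ideal.absNorm (I : Ideal R) = n).card := by
  simp [coef]

variable [Finite (ClassGroup R)]

theorem norm_coef_le (ψ : ClassGroup R →* ℂ) (n : ℕ) :
    ‖coef ψ n‖ ≤ ‖coef (1 : ClassGroup R →* ℂ) n‖ := by
  rw [coef_one, coef]
  refine (norm_sum_le _ _).trans ?_
  simp [norm_map_eq_one]

theorem norm_mangoldtCoef_le (ψ : ClassGroup R →* ℂ) (n : ℕ) :
    ‖mangoldtCoef ψ n‖ ≤ ‖LSeries.logMul (coef (1 : ClassGroup R →* ℂ)) n‖ := by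
  rw [LSeries.logMul, coef_one, mangoldtCoef, normFiberSum, norm_mul]
  have hn : 0 ≤ Real.log n := Real.log_natCast_nonneg n
  have h : ‖Complex.log n‖ = Real.log n := by
    rw [← Complex.ofReal_natCast, ← Complex.ofReal_log (Nat.cast_nonneg n), Complex.norm_real,
      Real.norm_of_nonneg hn]
  rw [h]
  refine (norm_sum_le _ _).trans ((Finset.sum_le_card_nsmul _ _ (Real.log n) ?_).trans_eq ?_)
  · intro I hI
    have hIn := (mem_filter_normLe le_rfl).1 hI
    rw [norm_mul, norm_map_eq_one, one_mul, Complex.norm_real,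
      Real.norm_of_nonneg (idealMangoldt_nonneg _), ← hIn]
    exact idealMangoldt_le_log I
  · rw [nsmul_eq_mul, mul_comm]
    simp

namespace QuadraticBasis

variable {k : ℕ}

omit [Finite (ClassGroup R)] in
theorem coef_one_rpow (q : QuadraticBasis R k) {σ : ℝ} (hσ : 1 < σ) :
    (Summable fun n : ℕ => ‖coef (1 : ClassGroup R →* ℂ) n‖ * (n : ℝ) ^ (-σ)) ∧
      ∑' n : ℕ, ‖coef (1 : ClassGroup R →* ℂ) n‖ * (n : ℝ) ^ (-σ) ≤ (σ / (σ - 1)) ^ 2 := by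
  obtain ⟨h1, h2⟩ := q.summable_tsum_absNorm_rpow hσ
  have h3 : ∀ m : ℕ, ∑ n ∈ range m, ‖coef (1 : ClassGroup R →* ℂ) n‖ * (n : ℝ) ^ (-σ) ≤
      (σ / (σ - 1)) ^ 2 := by
    intro m
    refine le_trans ?_ ((h1.sum_le_tsum ((normLe R m).filter fun I : (Ideal R)⁰ =>
      Ideal.absNorm (I : Ideal R) < m) (fun I _ => by positivity)).trans h2)
    rw [← Finset.sum_fiberwise_of_maps_to (t := range m)
      (g := fun I : (Ideal R)⁰ => Ideal.absNorm (I : Ideal R))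
      (fun I hI => mem_range.2 (mem_filter.1 hI).2)]
    refine Finset.sum_le_sum fun n hn => ?_
    rw [coef_one, Complex.norm_natCast, ← nsmul_eq_mul, ← Finset.sum_const]
    refine (Finset.sum_congr ?_ ?_).le
    · ext I
      rw [mem_filter_normLe le_rfl, mem_filter, mem_filter, mem_normLe]
      have := mem_range.1 hn
      refine ⟨fun h => ⟨by omega, h⟩, fun h => h.2⟩
    · intro I hI
      rw [(mem_filter.1 hI).2]
  have h0 : ∀ n : ℕ, 0 ≤ ‖coef (1 : ClassGroup R →* ℂ) n‖ * (n : ℝ) ^ (-σ) :=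
    fun n => by positivity
  exact ⟨summable_of_sum_range_le h0 h3, Real.tsum_le_of_sum_range_le h0 h3⟩

omit [Finite (ClassGroup R)] in
theorem norm_term_eq {f : ℕ → ℂ} (hf : f 0 = 0) (s : ℂ) (n : ℕ) :
    ‖LSeries.term f s n‖ = ‖f n‖ * (n : ℝ) ^ (-s.re) := by
  rcases Nat.eq_zero_or_pos n with rfl | hn
  · simp [hf]
  · rw [LSeries.norm_term_eq, if_neg hn.ne', Real.rpow_neg (Nat.cast_nonneg n), div_eq_mul_inv]

theorem lseriesSummable_coef (q : QuadraticBasis R k) (ψ : ClassGroup R →* ℂ) {s : ℂ}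
    (hs : 1 < s.re) : LSeriesSummable (coef ψ) s := by
  have h1 := (q.coef_one_rpow hs).1
  refine Summable.of_norm_bounded h1 fun n => (LSeries.norm_term_le s (norm_coef_le ψ n)).trans_eq ?_
  exact norm_term_eq (normFiberSum_zero fun _ => 1) s n

theorem abscissa_coef_lt (q : QuadraticBasis R k) (ψ : ClassGroup R →* ℂ) {s : ℂ}
    (hs : 1 < s.re) : LSeries.abscissaOfAbsConv (coef ψ) < s.re := by
  refine (LSeries.abscissaOfAbsConv_le_of_forall_lt_LSeriesSummable (x := 1) fun y hy =>
    q.lseriesSummable_coef ψ (by simpa using hy)).trans_lt ?_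
  exact_mod_cast hs

theorem lseriesSummable_mangoldtCoef (q : QuadraticBasis R k) (ψ : ClassGroup R →* ℂ) {s : ℂ}
    (hs : 1 < s.re) : LSeriesSummable (mangoldtCoef ψ) s :=
  Summable.of_norm_bounded (LSeriesSummable_logMul_of_lt_re (q.abscissa_coef_lt 1 hs)).norm
    fun n => LSeries.norm_term_le s (norm_mangoldtCoef_le ψ n)

theorem lseries_hasDerivAt (q : QuadraticBasis R k) (ψ : ClassGroup R →* ℂ) {s : ℂ}
    (hs : 1 < s.re) : HasDerivAt (LSeries (coef ψ))
      (-(LSeries (coef ψ) s * LSeries (mangoldtCoef ψ) s)) s := by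
  have h := LSeries_hasDerivAt (q.abscissa_coef_lt ψ hs)
  rwa [← coef_convolution, LSeries_convolution' (q.lseriesSummable_coef ψ hs)
    (q.lseriesSummable_mangoldtCoef ψ hs)] at h

theorem sum_mangoldt_nonneg (q : QuadraticBasis R k) (ψ : ClassGroup R →* ℂ) {m : ℕ} {a : ℕ → ℝ}
    (ha : ∀ z : ℂ, ‖z‖ = 1 → 0 ≤ ∑ j ∈ range m, a j * (z ^ j).re) {σ : ℝ} (hσ : 1 < σ) (t : ℝ) :
    0 ≤ ∑ j ∈ range m, a j * (LSeries (mangoldtCoef (ψ ^ j)) (σ + j * t * Complex.I)).re := by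
  have hsum : ∀ j : ℕ, LSeriesSummable (mangoldtCoef (ψ ^ j)) (σ + j * t * Complex.I) := fun j =>
    q.lseriesSummable_mangoldtCoef _ (by simpa using hσ)
  have h1 : ∀ j : ℕ, HasSum (fun n => a j * (LSeries.term (mangoldtCoef (ψ ^ j))
      (σ + j * t * Complex.I) n).re)
      (a j * (LSeries (mangoldtCoef (ψ ^ j)) (σ + j * t * Complex.I)).re) := fun j =>
    (Complex.hasSum_re (hsum j).hasSum).mul_left _
  refine (hasSum_sum fun j (_ : j ∈ range m) => h1 j).nonneg fun n => ?_
  rcases Nat.eq_zero_or_pos n with rfl | hn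
  · simp
  have hn0 : (n : ℂ) ≠ 0 := Nat.cast_ne_zero.2 hn.ne'
  have h2 : ∀ j : ℕ, (LSeries.term (mangoldtCoef (ψ ^ j)) (σ + j * t * Complex.I) n).re =
      ∑ I ∈ (normLe R n).filter (fun I : (Ideal R)⁰ => Ideal.absNorm (I : Ideal R) = n),
        idealMangoldt (I : Ideal R) * (n : ℝ) ^ (-σ) *
          ((ψ (ClassGroup.mk0 I) * (n : ℂ) ^ (-(t * Complex.I))) ^ j).re := by
    intro j
    rw [LSeries.term_of_ne_zero hn.ne', mangoldtCoef, normFiberSum, Finset.sum_div, Complex.re_sum]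
    refine Finset.sum_congr rfl fun I _ => ?_
    rw [← Complex.re_ofReal_mul]
    congr 1
    rw [MonoidHom.pow_apply, mul_pow, ← Complex.cpow_nat_mul, div_eq_mul_inv, ← Complex.cpow_neg,
      neg_add, Complex.cpow_add _ _ hn0, Complex.ofReal_mul, Complex.ofReal_cpow (Nat.cast_nonneg n)]
    push_cast
    ring_nf
  simp only [h2, Finset.mul_sum]
  rw [Finset.sum_comm]
  refine Finset.sum_nonneg fun I _ => ?_
  have h3 := ha (ψ (ClassGroup.mk0 I) * (n : ℂ) ^ (-(t * Complex.I))) (by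
    rw [norm_mul, norm_map_eq_one, Complex.norm_natCast_cpow_of_pos hn]
    simp)
  have h4 : 0 ≤ idealMangoldt (I : Ideal R) * (n : ℝ) ^ (-σ) :=
    mul_nonneg (idealMangoldt_nonneg _) (by positivity)
  refine (mul_nonneg h4 h3).trans_eq ?_
  rw [Finset.mul_sum]
  exact Finset.sum_congr rfl fun j _ => by ring

end QuadraticBasis

end IdealSeries

section LowerBound

open nonZeroDivisors Finset Filter Topology

variable {R : Type*} [CommRing R] [IsDedekindDomain R] [Module.Free ℤ R] [Module.Finite ℤ R]
  [CharZero R]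

theorem coef_one_right (ψ : ClassGroup R →* ℂ) : coef ψ 1 = 1 := by
  have : (normLe R 1).filter (fun I : (Ideal R)⁰ => Ideal.absNorm (I : Ideal R) = 1) = {1} := by
    ext I
    rw [mem_filter_normLe le_rfl, mem_singleton, Ideal.absNorm_eq_one_iff, Subtype.ext_iff, Submonoid.coe_one,
      Ideal.one_eq_top]
  rw [coef, this, Finset.sum_singleton, map_one, map_one]

variable [Finite (ClassGroup R)]

namespace QuadraticBasis

variable {k : ℕ}

theorem norm_lseries_coef_one_le (q : QuadraticBasis R k) (ψ : ClassGroup R →* ℂ) {s : ℂ}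
    (hs : 1 < s.re) : ‖LSeries (coef ψ) s‖ ≤ (s.re / (s.re - 1)) ^ 2 := by
  obtain ⟨h1, h2⟩ := q.coef_one_rpow hs
  refine (tsum_of_norm_bounded h1.hasSum fun n => ?_).trans h2
  refine (LSeries.norm_term_le s (norm_coef_le ψ n)).trans_eq ?_
  exact norm_term_eq (normFiberSum_zero fun _ => 1) s n

theorem tendsto_lseries_coef (q : QuadraticBasis R k) (ψ : ClassGroup R →* ℂ) (t : ℝ) :
    Tendsto (fun x : ℝ => LSeries (coef ψ) (x + t * Complex.I)) atTop (𝓝 1) := by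
  set g : ℕ → ℂ := fun n => coef ψ n * (n : ℂ) ^ (-(t * Complex.I)) with hg
  have h1 : ∀ x : ℝ, LSeries.term g x = LSeries.term (coef ψ) (x + t * Complex.I) := by
    intro x
    funext n
    rcases Nat.eq_zero_or_pos n with rfl | hn
    · simp
    · have hn0 : (n : ℂ) ≠ 0 := Nat.cast_ne_zero.2 hn.ne'
      rw [LSeries.term_of_ne_zero hn.ne', LSeries.term_of_ne_zero hn.ne',
        Complex.cpow_add _ _ hn0]
      simp only [hg, Complex.cpow_neg]
      field_simp
  have h2 : LSeries.abscissaOfAbsConv g < ⊤ := by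
    refine (LSeries.abscissaOfAbsConv_le_of_forall_lt_LSeriesSummable (x := 1) fun y hy => ?_).trans_lt
      (EReal.coe_lt_top 1)
    rw [LSeriesSummable, h1]
    exact q.lseriesSummable_coef ψ (by simpa using hy)
  have h3 := LSeries.tendsto_atTop h2
  have h4 : g 1 = 1 := by simp [hg, coef_one_right]
  rw [h4] at h3
  refine h3.congr fun x => ?_
  rw [LSeries, LSeries, h1]

theorem hasDerivAt_norm_sq (q : QuadraticBasis R k) (ψ : ClassGroup R →* ℂ) (t : ℝ) {x : ℝ}
    (hx : 1 < x) : HasDerivAt (fun x : ℝ => ‖LSeries (coef ψ) (x + t * Complex.I)‖ ^ 2)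
      (-2 * ‖LSeries (coef ψ) (x + t * Complex.I)‖ ^ 2 *
        (LSeries (mangoldtCoef ψ) (x + t * Complex.I)).re) x := by
  have h1 := q.lseries_hasDerivAt ψ (s := x + t * Complex.I) (by simpa using hx)
  have h2 : HasDerivAt (fun x : ℝ => (x + t * Complex.I : ℂ)) 1 x :=
    (Complex.ofRealCLM.hasDerivAt (x := x)).add_const _
  have h3 := (h1.comp x h2).norm_sq
  refine h3.congr_deriv ?_
  rw [mul_one, inner_neg_right, Complex.inner, Function.comp_apply]
  set L := LSeries (coef ψ) (x + t * Complex.I)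
  set Z := LSeries (mangoldtCoef ψ) (x + t * Complex.I)
  have : L * Z * (starRingEnd ℂ) L = ((‖L‖ ^ 2 : ℝ) : ℂ) * Z := by
    rw [mul_right_comm, Complex.mul_conj, Complex.normSq_eq_norm_sq]
  rw [this, Complex.re_ofReal_mul]
  ring

theorem one_le_norm_lseries_mul (q : QuadraticBasis R k) (ψ : ClassGroup R →* ℂ) {s : ℂ}
    (hs : 1 < s.re) : 1 ≤ ‖LSeries (coef ψ) s‖ * (s.re / (s.re - 1)) ^ 2 := by
  set t := s.im
  set h : ℝ → ℝ := fun x => ‖LSeries (coef ψ) (x + t * Complex.I)‖ ^ 2 *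
    ‖LSeries (coef (1 : ClassGroup R →* ℂ)) (x + (0 : ℝ) * Complex.I)‖ ^ 2 with hh
  have hd : ∀ x : ℝ, 1 < x → HasDerivAt h _ x := fun x hx =>
    (q.hasDerivAt_norm_sq ψ t hx).mul (q.hasDerivAt_norm_sq 1 0 hx)
  have hanti : AntitoneOn h (Set.Ioi 1) := by
    refine antitoneOn_of_deriv_nonpos (convex_Ioi 1)
      (fun x hx => (hd x hx).continuousAt.continuousWithinAt)
      (fun x hx => ?_) (fun x hx => ?_)
    · rw [interior_Ioi] at hx
      exact (hd x hx).differentiableAt.differentiableWithinAt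
    · rw [interior_Ioi] at hx
      rw [(hd x hx).deriv]
      have hpos := q.sum_mangoldt_nonneg ψ (m := 2) (a := fun _ => 1) (by
        intro z hz
        have := Complex.abs_re_le_norm z
        rw [hz, abs_le] at this
        simp [Finset.sum_range_succ]
        linarith [this.1]) hx t
      simp only [Finset.sum_range_succ, Finset.sum_range_zero, pow_zero, pow_one, one_mul, zero_add,
        Nat.cast_zero, zero_mul, Nat.cast_one, add_zero] at hpos
      set X := ‖LSeries (coef ψ) (x + t * Complex.I)‖ ^ 2
      set Y := ‖LSeries (coef (1 : ClassGroup R →* ℂ)) (x + (0 : ℝ) * Complex.I)‖ ^ 2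
      have hX : 0 ≤ X := by positivity
      have hY : 0 ≤ Y := by positivity
      have := mul_nonneg (mul_nonneg hX hY) hpos
      simp only [Complex.ofReal_zero, zero_mul, add_zero]
      linarith
  have hlim : Tendsto h atTop (𝓝 1) := by
    have := ((q.tendsto_lseries_coef ψ t).norm.pow 2).mul ((q.tendsto_lseries_coef 1 0).norm.pow 2)
    simpa only [norm_one, one_pow, one_mul] using this
  have h1 : 1 ≤ h s.re := by
    refine le_of_tendsto hlim ?_
    filter_upwards [eventually_ge_atTop s.re] with y hy
    exact hanti (Set.mem_Ioi.2 hs) (Set.mem_Ioi.2 (hs.trans_le hy)) hy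
  rw [hh] at h1
  simp only [t, Complex.re_add_im, Complex.ofReal_zero, zero_mul, add_zero] at h1
  have h2 := q.norm_lseries_coef_one_le 1 (s := s.re) (by simpa using hs)
  rw [Complex.ofReal_re] at h2
  rw [← mul_pow, one_le_sq_iff₀ (by positivity)] at h1
  exact h1.trans (by gcongr)

end QuadraticBasis

end LowerBound

section Continuation

open MeasureTheory Set Filter Topology Asymptotics

/-- The remainder of the summatory function of `f` against its linear main term. -/
noncomputable def remainder (f : ℕ → ℂ) (κ : ℂ) (t : ℝ) : ℂ :=
  ∑ j ∈ Finset.Icc 1 ⌊t⌋₊, f j - κ * t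

/-- The Mellin-type integral of the remainder. -/
noncomputable def remainderIntegral (f : ℕ → ℂ) (κ : ℂ) (s : ℂ) : ℂ :=
  s * ∫ t in Ioi (1 : ℝ), remainder f κ t * (t : ℂ) ^ (-(s + 1))

theorem measurable_remainder (f : ℕ → ℂ) (κ : ℂ) : Measurable (remainder f κ) := by
  have h1 : Measurable fun t : ℝ => ∑ j ∈ Finset.Icc 1 ⌊t⌋₊, f j :=
    (measurable_from_nat (f := fun n : ℕ => ∑ j ∈ Finset.Icc 1 n, f j)).comp Nat.measurable_floor
  exact h1.sub (Complex.measurable_ofReal.const_mul κ)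

theorem min_le_rpow_mul_rpow {Q t θ : ℝ} (hQ : 0 ≤ Q) (ht : 1 ≤ t) (hθ : θ ∈ Icc (0 : ℝ) 1) :
    min t (Q * √t) ≤ Q ^ θ * t ^ (1 - θ / 2) := by
  have ht0 : 0 < t := by linarith
  set m := min t (Q * √t)
  have hm : 0 ≤ m := le_min ht0.le (by positivity)
  calc m = m ^ (1 - θ) * m ^ θ := by
        rw [← Real.rpow_add_of_nonneg hm (by linarith [hθ.2]) hθ.1]; simp
    _ ≤ t ^ (1 - θ) * (Q * √t) ^ θ := by
        refine mul_le_mul (Real.rpow_le_rpow hm (min_le_left _ _) (by linarith [hθ.2]))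
          (Real.rpow_le_rpow hm (min_le_right _ _) hθ.1) (by positivity) (by positivity)
    _ = Q ^ θ * t ^ (1 - θ / 2) := by
        rw [Real.mul_rpow hQ (Real.sqrt_nonneg t), Real.sqrt_eq_rpow, ← Real.rpow_mul ht0.le,
          mul_left_comm, ← Real.rpow_add ht0]
        congr 2; ring

variable {f : ℕ → ℂ} {κ : ℂ} {P Q : ℝ}

theorem norm_remainder_mul_le (hP : 0 ≤ P) (hQ : 0 ≤ Q)
    (hE : ∀ t : ℝ, 1 ≤ t → ‖remainder f κ t‖ ≤ P * min t (Q * √t)) {θ : ℝ}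
    (hθ : θ ∈ Icc (0 : ℝ) 1) (s : ℂ) {t : ℝ} (ht : 1 ≤ t) :
    ‖remainder f κ t * (t : ℂ) ^ (-(s + 1))‖ ≤ P * Q ^ θ * t ^ (-(s.re + θ / 2)) := by
  have ht0 : 0 < t := by linarith
  rw [norm_mul, Complex.norm_cpow_eq_rpow_re_of_pos ht0]
  calc _ ≤ P * (Q ^ θ * t ^ (1 - θ / 2)) * t ^ (-(s + 1)).re := by
        gcongr
        exact (hE t ht).trans (by gcongr; exact min_le_rpow_mul_rpow hQ ht hθ)
    _ = P * Q ^ θ * (t ^ (1 - θ / 2) * t ^ (-(s + 1)).re) := by ring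
    _ = _ := by
        rw [← Real.rpow_add ht0]
        congr 2
        simp; ring

theorem integrableOn_remainder (hP : 0 ≤ P) (hQ : 0 ≤ Q)
    (hE : ∀ t : ℝ, 1 ≤ t → ‖remainder f κ t‖ ≤ P * min t (Q * √t)) {s : ℂ} (hs : 1 / 2 < s.re) :
    IntegrableOn (fun t : ℝ => remainder f κ t * (t : ℂ) ^ (-(s + 1))) (Ioi 1) := by
  have h1 : IntegrableOn (fun t : ℝ => P * Q ^ (1 : ℝ) * t ^ (-(s.re + 1 / 2))) (Ioi 1) :=
    (integrableOn_Ioi_rpow_of_lt (by linarith) one_pos).const_mul _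
  refine h1.mono' ?_ ?_
  · refine ((measurable_remainder f κ).mul ?_).aestronglyMeasurable
    exact Complex.measurable_ofReal.pow_const _
  · refine (ae_restrict_iff' measurableSet_Ioi).2 (Eventually.of_forall fun t ht => ?_)
    exact norm_remainder_mul_le hP hQ hE ⟨zero_le_one, le_rfl⟩ s (mem_Ioi.1 ht).le

theorem norm_remainderIntegral_le (hP : 0 ≤ P) (hQ : 0 ≤ Q)
    (hE : ∀ t : ℝ, 1 ≤ t → ‖remainder f κ t‖ ≤ P * min t (Q * √t)) {θ : ℝ}
    (hθ : θ ∈ Icc (0 : ℝ) 1) {s : ℂ} (hs : 1 < s.re + θ / 2) :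
    ‖remainderIntegral f κ s‖ ≤ ‖s‖ * (P * Q ^ θ / (s.re + θ / 2 - 1)) := by
  rw [remainderIntegral, norm_mul]
  gcongr
  have h1 : IntegrableOn (fun t : ℝ => P * Q ^ θ * t ^ (-(s.re + θ / 2))) (Ioi 1) :=
    (integrableOn_Ioi_rpow_of_lt (by linarith) one_pos).const_mul _
  refine (norm_integral_le_of_norm_le h1 ?_).trans_eq ?_
  · refine (ae_restrict_iff' measurableSet_Ioi).2 (Eventually.of_forall fun t ht => ?_)
    exact norm_remainder_mul_le hP hQ hE hθ s (mem_Ioi.1 ht).le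
  · rw [integral_const_mul, integral_Ioi_rpow_of_lt (by linarith) one_pos, Real.one_rpow,
      div_eq_mul_inv]
    congr 1
    rw [neg_one_mul, ← inv_neg]
    congr 1; ring

theorem differentiableAt_remainderIntegral (hP : 0 ≤ P)
    (hE : ∀ t : ℝ, 1 ≤ t → ‖remainder f κ t‖ ≤ P * min t (Q * √t)) {s : ℂ} (hs : 1 / 2 < s.re) :
    DifferentiableAt ℂ (remainderIntegral f κ) s := by
  set g : ℝ → ℂ := (Ioi (1 : ℝ)).indicator (remainder f κ) with hg
  have hgm : Measurable g := (measurable_remainder f κ).indicator measurableSet_Ioi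
  have hgb : ∀ t : ℝ, ‖g t‖ ≤ P * |t| := by
    intro t
    by_cases ht : t ∈ Ioi (1 : ℝ)
    · have ht' := mem_Ioi.1 ht
      rw [hg, indicator_of_mem ht, abs_of_pos (by linarith)]
      exact (hE t ht'.le).trans (by gcongr; exact min_le_left _ _)
    · rw [hg, indicator_of_notMem ht, norm_zero]
      positivity
  have h1 : LocallyIntegrable g volume := by
    have h2 : LocallyIntegrable (fun t : ℝ => P * |t|) volume := by
      exact Continuous.locallyIntegrable (by fun_prop)
    refine h2.mono hgm.aestronglyMeasurable (Eventually.of_forall fun t => ?_)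
    exact (hgb t).trans (le_abs_self _)
  have h3 : g =O[atTop] fun t : ℝ => t ^ (-(-1 / 2 : ℝ)) := by
    refine IsBigO.of_bound (P * Q) ?_
    filter_upwards [eventually_gt_atTop 1] with t ht
    rw [hg, indicator_of_mem (mem_Ioi.2 ht), Real.norm_of_nonneg (by positivity),
      show (-(-1 / 2 : ℝ)) = 1 / 2 by norm_num, ← Real.sqrt_eq_rpow, mul_assoc]
    exact (hE t ht.le).trans (by gcongr; exact min_le_right _ _)
  have h4 : g =O[𝓝[>] 0] fun t : ℝ => t ^ (-(-s.re - 1)) := by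
    refine IsBigO.of_bound 0 ?_
    filter_upwards [mem_nhdsWithin_of_mem_nhds (Iio_mem_nhds one_pos)] with t ht
    rw [hg, indicator_of_notMem (by simpa using (mem_Iio.1 ht).le)]
    simp
  have h5 : DifferentiableAt ℂ (mellin g) (-s) :=
    mellin_differentiableAt_of_isBigO_rpow (h1.locallyIntegrableOn _) h3
      (by simp; linarith) h4 (by simp)
  have h6 : remainderIntegral f κ = fun s => s * mellin g (-s) := by
    funext z
    rw [remainderIntegral, mellin]
    congr 1
    have : ∀ t : ℝ, (t : ℂ) ^ (-z - 1) • g t =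
        (Ioi (1 : ℝ)).indicator (fun t => remainder f κ t * (t : ℂ) ^ (-(z + 1))) t := by
      intro t
      by_cases ht : t ∈ Ioi (1 : ℝ)
      · rw [hg, indicator_of_mem ht, indicator_of_mem ht, smul_eq_mul, mul_comm]
        congr 2; ring
      · rw [hg, indicator_of_notMem ht, indicator_of_notMem ht, smul_zero]
    simp only [this]
    rw [setIntegral_indicator measurableSet_Ioi]
    congr 2
    ext t
    simp only [mem_inter_iff, mem_Ioi]
    constructor
    · exact fun h => ⟨by linarith, h⟩
    · exact fun h => h.2
  rw [h6]
  exact differentiableAt_id.mul (h5.comp s differentiableAt_id.neg)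

theorem lseries_eq_add_remainderIntegral (hP : 0 ≤ P) (hQ : 0 ≤ Q)
    (hE : ∀ t : ℝ, 1 ≤ t → ‖remainder f κ t‖ ≤ P * min t (Q * √t)) {s : ℂ} (hs : 1 < s.re)
    (hf : LSeriesSummable f s) :
    LSeries f s = κ * s / (s - 1) + remainderIntegral f κ s := by
  have h1 : (fun n : ℕ => ∑ j ∈ Finset.Icc 1 n, f j) =O[atTop] fun n : ℕ => (n : ℝ) ^ (1 : ℝ) := by
    refine IsBigO.of_bound (P + ‖κ‖) ?_
    filter_upwards [eventually_ge_atTop 1] with n hn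
    have hn' : (1 : ℝ) ≤ n := by exact_mod_cast hn
    have h2 := (hE n hn').trans (mul_le_mul_of_nonneg_left (min_le_left _ _) hP)
    rw [remainder, Nat.floor_natCast] at h2
    rw [Real.rpow_one, Real.norm_of_nonneg (by positivity), add_mul]
    have h3 := norm_add_le (∑ j ∈ Finset.Icc 1 n, f j - κ * (n : ℝ)) (κ * (n : ℝ))
    rw [sub_add_cancel, norm_mul, Complex.norm_real, Real.norm_of_nonneg (by positivity)] at h3
    linarith
  rw [LSeries_eq_mul_integral f zero_le_one hs hf h1, remainderIntegral]
  have hi1 := integrableOn_remainder hP hQ hE (s := s) (by linarith)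
  have hi2 : IntegrableOn (fun t : ℝ => κ * (t : ℂ) ^ (-s)) (Ioi 1) :=
    (integrableOn_Ioi_cpow_of_lt (by simpa using hs) one_pos).const_mul _
  have h4 : ∫ t in Ioi (1 : ℝ), (∑ k ∈ Finset.Icc 1 ⌊t⌋₊, f k) * (t : ℂ) ^ (-(s + 1)) =
      ∫ t in Ioi (1 : ℝ), (κ * (t : ℂ) ^ (-s) + remainder f κ t * (t : ℂ) ^ (-(s + 1))) := by
    refine setIntegral_congr_fun measurableSet_Ioi fun t ht => ?_
    have ht0 : (t : ℂ) ≠ 0 := by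
      have := mem_Ioi.1 ht
      exact_mod_cast (by linarith : (0 : ℝ) < t).ne'
    have h5 : (t : ℂ) ^ (-s) = t * (t : ℂ) ^ (-(s + 1)) := by
      rw [show -s = 1 + -(s + 1) by ring, Complex.cpow_add _ _ ht0, Complex.cpow_one]
    simp only [remainder, h5]
    ring
  rw [h4, integral_add hi2 hi1, integral_const_mul,
    integral_Ioi_cpow_of_lt (by simpa using hs) one_pos, mul_add]
  congr 1
  have : s - 1 ≠ 0 := fun h => by
    have := congrArg Complex.re h
    simp at this; linarith
  have h' : -s + 1 ≠ 0 := fun h => this (by linear_combination -h)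
  rw [Complex.ofReal_one, Complex.one_cpow]
  field_simp
  ring

end Continuation

section LogDerivBound

open Set Filter Topology Metric

theorem neg_re_logDeriv_le {G : ℂ → ℂ} {c : ℂ} {L B : ℝ} (hc : 1 < c.re) (hB : 0 ≤ B)
    (hG : ∀ z : ℂ, 1 / 2 < z.re → DifferentiableAt ℂ G z)
    (hne : ∀ z : ℂ, 1 < z.re → G z ≠ 0)
    (hleft : ∀ z ∈ closedBall c (1 / 4), z.re ≤ c.re →
      ‖G z‖ ≤ Real.exp (L / 2 * (c.re - z.re) + B))
    (hright : ∀ z : ℂ, 1 < z.re → -Real.log ‖G z‖ ≤ 3 / (z.re - 1)) :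
    -(logDeriv G c).re ≤ L / 4 + (10 * B + 150) ∧
      ∀ ρ : ℂ, G ρ = 0 → ρ.re ≤ c.re → -(logDeriv G c).re ≤ L / 4 + (10 * B + 150) -
        ((c - ρ).re / ‖c - ρ‖ ^ 2 - 25 * (c - ρ).re) := by
  have hopen : IsOpen {z : ℂ | 1 / 2 < z.re} := isOpen_lt continuous_const Complex.continuous_re
  have hana : AnalyticOnNhd ℂ G {z : ℂ | 1 / 2 < z.re} :=
    DifferentiableOn.analyticOnNhd (fun z hz => (hG z hz).differentiableWithinAt) hopen
  have hball : closedBall c (1 / 4) ⊆ {z : ℂ | 1 / 2 < z.re} := by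
    intro z hz
    rw [mem_closedBall, dist_eq_norm] at hz
    have := (abs_le.1 (Complex.abs_re_le_norm (z - c))).1
    rw [Complex.sub_re] at this
    simp only [mem_ofPred_eq]
    linarith
  obtain ⟨r, hr, h1, h2⟩ := exists_neg_re_logDeriv_le (F := G) (c := c) (r₀ := 1 / 5) (r₁ := 1 / 4)
    (A := L / 2) (B := B) (B' := 3) (by norm_num) (by norm_num) (hana.mono hball) (hne c hc)
    (fun z _ hz0 => by
      by_contra h
      exact hne z (hc.trans (not_le.1 h)) hz0)
    hB (by norm_num)
    (fun z hz hz0 hzc => by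
      rw [Real.log_le_iff_le_exp (norm_pos_iff.2 hz0)]
      exact hleft z hz hzc)
    (fun z _ hz0 hzc => by
      have hz1 : 1 < z.re := hc.trans_le hzc
      calc _ ≤ (z.re - c.re) * (3 / (z.re - 1)) :=
            mul_le_mul_of_nonneg_left (hright z hz1) (by linarith)
        _ ≤ (z.re - 1) * (3 / (z.re - 1)) :=
            mul_le_mul_of_nonneg_right (by linarith) (div_nonneg (by norm_num) (by linarith))
        _ = 3 := mul_div_cancel₀ _ (by linarith))
  have he : L / 2 / 2 + 2 * B / (1 / 5) + 2 * 3 / (1 / 5) ^ 2 = L / 4 + (10 * B + 150) := by ring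
  rw [he] at h1 h2
  refine ⟨h1, fun ρ hρ hρc => (h2 ρ hρ hρc).trans ?_⟩
  have h3 : 0 ≤ (c - ρ).re := by rw [Complex.sub_re]; linarith
  have h4 : 1 / r ^ 2 ≤ 25 := by
    rw [div_le_iff₀ (by nlinarith [hr.1])]
    nlinarith [hr.1]
  have h5 := mul_le_mul_of_nonneg_left h4 h3
  rw [mul_sub, mul_one_div]
  linarith

end LogDerivBound

section CharacterBounds

open Set Filter Topology Metric nonZeroDivisors

/-- The logarithmic size of the `L`-functions near the line of absolute convergence. -/
noncomputable def sizeBound (L : ℝ) : ℝ :=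
  Real.log (100 * (45 * (quarterArea + 1) * (L + 1) ^ 2 + 1) * L) + 1 / 2

variable {R : Type*} [CommRing R] [IsDedekindDomain R] [Module.Free ℤ R] [Module.Finite ℤ R]
  [CharZero R]

namespace QuadraticBasis

variable {k : ℕ}

theorem neg_log_norm_lseries_le [Finite (ClassGroup R)] (q : QuadraticBasis R k)
    (ψ : ClassGroup R →* ℂ) {s : ℂ} (hs : 1 < s.re) :
    LSeries (coef ψ) s ≠ 0 ∧ -Real.log ‖LSeries (coef ψ) s‖ ≤ 2 / (s.re - 1) := by
  have h := q.one_le_norm_lseries_mul ψ hs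
  have hw : 0 < s.re - 1 := by linarith
  have h0 : LSeries (coef ψ) s ≠ 0 := fun h0 => by
    rw [h0, norm_zero, zero_mul] at h
    linarith
  refine ⟨h0, ?_⟩
  have hpos : 0 < s.re / (s.re - 1) := div_pos (by linarith) hw
  have h1 := Real.log_nonneg h
  rw [Real.log_mul (norm_ne_zero_iff.2 h0) (by positivity), Real.log_pow] at h1
  have h2 := Real.log_le_sub_one_of_pos hpos
  have h3 : s.re / (s.re - 1) - 1 = 1 / (s.re - 1) := by field_simp; ring
  rw [h3] at h2
  have h4 : 2 / (s.re - 1) = 2 * (1 / (s.re - 1)) := by ring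
  push_cast at h1
  linarith

variable [Fintype (ClassGroup R)]

/-- The residue of the `L`-series of a class group character. -/
noncomputable def residue (k : ℕ) (ψ : ClassGroup R →* ℂ) : ℂ :=
  (4 * quarterArea / √(4 * k - 1) : ℝ) * ∑ C, ψ C

/-- The analytic continuation, up to its polar part, of the `L`-series of `ψ`. -/
noncomputable def regularPart (k : ℕ) (ψ : ClassGroup R →* ℂ) : ℂ → ℂ :=
  remainderIntegral (coef ψ) (residue k ψ)

omit [Module.Free ℤ R] [Module.Finite ℤ R] [CharZero R] in
theorem residue_eq_zero {ψ : ClassGroup R →* ℂ} (hψ : ψ ≠ 1) : residue k ψ = 0 := by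
  rw [residue, sum_eq_zero_of_ne_one hψ, mul_zero]

theorem norm_remainder_coef_le (q : QuadraticBasis R k) (hk : 1 < k) (ψ : ClassGroup R →* ℂ) {t : ℝ}
    (ht : 1 ≤ t) : ‖remainder (coef ψ) (residue k ψ) t‖ ≤
      45 * (quarterArea + 1) * (Real.log (4 * k - 1) + 1) ^ 2 * min t (√√(4 * k - 1) * √t) :=
  q.norm_sum_coef_sub_le hk ψ ht

theorem prefactor_nonneg (L : ℝ) : 0 ≤ 45 * (quarterArea + 1) * (L + 1) ^ 2 := by
  have := quarterArea_nonneg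
  positivity

theorem norm_residue_le (q : QuadraticBasis R k) (hk : 1 < k) (ψ : ClassGroup R →* ℂ) :
    ‖residue k ψ‖ ≤ 45 * (quarterArea + 1) * (Real.log (4 * k - 1) + 1) ^ 2 + 1 := by
  have h := (q.norm_remainder_coef_le hk ψ le_rfl).trans
    (mul_le_mul_of_nonneg_left (min_le_left _ _) (prefactor_nonneg _))
  rw [remainder, Nat.floor_one, Finset.Icc_self, Finset.sum_singleton, coef_one_right,
    Complex.ofReal_one, mul_one, mul_one] at h
  have := norm_sub_norm_le (residue k ψ) 1
  rw [norm_sub_rev, norm_one] at this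
  linarith

theorem norm_regularPart_le (q : QuadraticBasis R k) (hk : 1 < k) (hL : 4 ≤ Real.log (4 * k - 1))
    (ψ : ClassGroup R →* ℂ) {s : ℂ} {x : ℝ} (hx : 0 ≤ x) (hx' : 1 - x ≤ s.re) (hx4 : x ≤ 1 / 4) :
    ‖regularPart k ψ s‖ ≤ ‖s‖ * (45 * (quarterArea + 1) * (Real.log (4 * k - 1) + 1) ^ 2 *
      Real.log (4 * k - 1) * Real.exp (Real.log (4 * k - 1) / 2 * x + 1 / 2)) := by
  set L := Real.log (4 * k - 1) with hLdef
  set P := 45 * (quarterArea + 1) * (L + 1) ^ 2 with hP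
  have hP0 : 0 ≤ P := prefactor_nonneg L
  have hD : (0 : ℝ) < 4 * k - 1 := by
    have : (1 : ℝ) < k := by exact_mod_cast hk
    linarith
  have hL0 : 0 < L := by linarith
  have h1 : 2 / L ≤ 1 / 2 := by
    rw [div_le_div_iff₀ hL0 (by norm_num)]; linarith
  have h2 : 0 < 1 / L := by positivity
  have h3 : 2 / L = 2 * (1 / L) := by ring
  have hb := norm_remainderIntegral_le (θ := 2 * x + 2 / L) hP0 (Real.sqrt_nonneg _)
    (fun t ht => q.norm_remainder_coef_le hk ψ ht)
    ⟨by positivity, by linarith⟩ (s := s) (by linarith)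
  refine hb.trans (mul_le_mul_of_nonneg_left ?_ (_root_.norm_nonneg s))
  have h4 : √√(4 * k - 1 : ℝ) ^ (2 * x + 2 / L) = Real.exp (L / 2 * x + 1 / 2) := by
    rw [Real.sqrt_eq_rpow, Real.sqrt_eq_rpow, ← Real.rpow_mul hD.le, ← Real.rpow_mul hD.le,
      Real.rpow_def_of_pos hD, ← hLdef]
    congr 1
    field_simp
  rw [h4, div_eq_mul_one_div, mul_right_comm]
  refine mul_le_mul_of_nonneg_right ?_ (Real.exp_pos _).le
  refine mul_le_mul_of_nonneg_left ?_ hP0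
  rw [div_le_iff₀ (by linarith)]
  calc 1 = L * (1 / L) := by field_simp
    _ ≤ _ := mul_le_mul_of_nonneg_left (by linarith) hL0.le

theorem differentiableAt_regularPart (q : QuadraticBasis R k) (hk : 1 < k) (ψ : ClassGroup R →* ℂ)
    {s : ℂ} (hs : 1 / 2 < s.re) : DifferentiableAt ℂ (regularPart k ψ) s :=
  differentiableAt_remainderIntegral (prefactor_nonneg _)
    (fun _ ht => q.norm_remainder_coef_le hk ψ ht) hs

theorem lseries_eq (q : QuadraticBasis R k) (hk : 1 < k) (ψ : ClassGroup R →* ℂ) {s : ℂ}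
    (hs : 1 < s.re) :
    LSeries (coef ψ) s = residue k ψ * s / (s - 1) + regularPart k ψ s :=
  lseries_eq_add_remainderIntegral (prefactor_nonneg _) (Real.sqrt_nonneg _)
    (fun _ ht => q.norm_remainder_coef_le hk ψ ht) hs (q.lseriesSummable_coef ψ hs)

theorem sizeBound_nonneg {L : ℝ} (hL : 1 ≤ L) : 0 ≤ sizeBound L := by
  have h1 := prefactor_nonneg L
  have : 0 ≤ Real.log (100 * (45 * (quarterArea + 1) * (L + 1) ^ 2 + 1) * L) :=
    Real.log_nonneg (by nlinarith)
  rw [sizeBound]; linarith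

theorem exp_add_sizeBound {L : ℝ} (hL : 0 < L) (y : ℝ) : Real.exp (y + sizeBound L) =
    100 * (45 * (quarterArea + 1) * (L + 1) ^ 2 + 1) * L * Real.exp (y + 1 / 2) := by
  have := prefactor_nonneg L
  rw [sizeBound, add_left_comm, Real.exp_add, Real.exp_log (by positivity)]

theorem norm_le_six {c z : ℂ} (hc : 1 < c.re) (hc' : c.re ≤ 5 / 4) (hτ : |c.im| ≤ 4)
    (hz : z ∈ closedBall c (1 / 4)) : ‖z‖ ≤ 6 := by
  rw [mem_closedBall, dist_eq_norm] at hz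
  have h1 := Complex.norm_le_abs_re_add_abs_im c
  have h2 := norm_le_norm_add_norm_sub' z c
  rw [abs_of_pos (by linarith)] at h1
  linarith

theorem re_mangoldt_le_of_ne_one (q : QuadraticBasis R k) (hk : 1 < k)
    (hL : 4 ≤ Real.log (4 * k - 1)) {ψ : ClassGroup R →* ℂ} (hψ : ψ ≠ 1) {c : ℂ}
    (hc : 1 < c.re) (hc' : c.re ≤ 5 / 4) (hτ : |c.im| ≤ 4) :
    (LSeries (mangoldtCoef ψ) c).re ≤ Real.log (4 * k - 1) / 4 +
        (10 * sizeBound (Real.log (4 * k - 1)) + 150) ∧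
      ∀ ρ : ℂ, regularPart k ψ ρ = 0 → ρ.re ≤ c.re →
        (LSeries (mangoldtCoef ψ) c).re ≤ Real.log (4 * k - 1) / 4 +
          (10 * sizeBound (Real.log (4 * k - 1)) + 150) -
            ((c - ρ).re / ‖c - ρ‖ ^ 2 - 25 * (c - ρ).re) := by
  set L := Real.log (4 * k - 1) with hLdef
  have heq : ∀ z : ℂ, 1 < z.re → regularPart k ψ z = LSeries (coef ψ) z := fun z hz => by
    rw [q.lseries_eq hk ψ hz, residue_eq_zero hψ]; simp
  have hlog : logDeriv (regularPart k ψ) c = -LSeries (mangoldtCoef ψ) c := by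
    have hev : regularPart k ψ =ᶠ[𝓝 c] LSeries (coef ψ) := by
      filter_upwards [(isOpen_lt continuous_const Complex.continuous_re).mem_nhds hc] with z hz
      exact heq z hz
    rw [logDeriv_apply, hev.deriv_eq, hev.eq_of_nhds, (q.lseries_hasDerivAt ψ hc).deriv]
    have := (q.neg_log_norm_lseries_le ψ hc).1
    field_simp
  have h := neg_re_logDeriv_le (G := regularPart k ψ) (L := L) (B := sizeBound L) hc
    (sizeBound_nonneg (by linarith))
    (fun z hz => q.differentiableAt_regularPart hk ψ hz)
    (fun z hz => by rw [heq z hz]; exact (q.neg_log_norm_lseries_le ψ hz).1)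
    (fun z hz hzc => by
      have h6 := norm_le_six hc hc' hτ hz
      rw [mem_closedBall, dist_eq_norm] at hz
      have h7 := (abs_le.1 ((Complex.abs_re_le_norm (z - c)).trans hz)).1
      rw [Complex.sub_re] at h7
      have hP := prefactor_nonneg L
      refine (q.norm_regularPart_le hk hL ψ (x := c.re - z.re) (by linarith) (by linarith)
        (by linarith)).trans ?_
      rw [exp_add_sizeBound (by linarith), ← hLdef]
      set E := Real.exp (L / 2 * (c.re - z.re) + 1 / 2)
      set P := 45 * (quarterArea + 1) * (L + 1) ^ 2
      have h8 : 0 ≤ L * E := mul_nonneg (by linarith) (Real.exp_pos _).le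
      have h9 : 0 ≤ P * (L * E) := mul_nonneg hP h8
      have h10 : ‖z‖ * (P * L * E) ≤ 6 * (P * L * E) :=
        mul_le_mul_of_nonneg_right h6 (by linarith)
      linarith)
    (fun z hz => by
      rw [heq z hz]
      refine (q.neg_log_norm_lseries_le ψ hz).2.trans ?_
      have : 0 < z.re - 1 := by linarith
      gcongr; norm_num)
  rw [hlog, Complex.neg_re, neg_neg] at h
  exact h

theorem re_mangoldt_one_le (q : QuadraticBasis R k) (hk : 1 < k)
    (hL : 4 ≤ Real.log (4 * k - 1)) {c : ℂ}
    (hc : 1 < c.re) (hc' : c.re ≤ 5 / 4) (hτ : |c.im| ≤ 4) :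
    (LSeries (mangoldtCoef (1 : ClassGroup R →* ℂ)) c).re ≤ Real.log (4 * k - 1) / 4 +
        (10 * sizeBound (Real.log (4 * k - 1)) + 150) + (1 / (c - 1)).re := by
  set L := Real.log (4 * k - 1) with hLdef
  set ψ : ClassGroup R →* ℂ := 1
  set G : ℂ → ℂ := fun z => residue k ψ * z + (z - 1) * regularPart k ψ z with hG
  have hz1 : ∀ z : ℂ, 1 < z.re → z - 1 ≠ 0 := fun z hz h => by
    have := congrArg Complex.re h
    simp at this; linarith
  have heq : ∀ z : ℂ, 1 < z.re → G z = (z - 1) * LSeries (coef ψ) z := fun z hz => by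
    have := hz1 z hz
    rw [q.lseries_eq hk ψ hz, hG]
    field_simp
  have hlog : logDeriv G c = 1 / (c - 1) - LSeries (mangoldtCoef ψ) c := by
    have hev : G =ᶠ[𝓝 c] fun z => (z - 1) * LSeries (coef ψ) z := by
      filter_upwards [(isOpen_lt continuous_const Complex.continuous_re).mem_nhds hc] with z hz
      exact heq z hz
    have hd : HasDerivAt (fun z => (z - 1) * LSeries (coef ψ) z) _ c :=
      ((hasDerivAt_id' c).sub_const 1).mul (q.lseries_hasDerivAt ψ hc)
    rw [logDeriv_apply, hev.deriv_eq, hev.eq_of_nhds, hd.deriv]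
    have := (q.neg_log_norm_lseries_le ψ hc).1
    have := hz1 c hc
    field_simp
    ring
  have h := (neg_re_logDeriv_le (G := G) (L := L) (B := sizeBound L) hc
    (sizeBound_nonneg (by linarith))
    (fun z hz => by
      have := q.differentiableAt_regularPart hk ψ hz
      rw [hG]
      fun_prop)
    (fun z hz => by
      rw [heq z hz]
      exact mul_ne_zero (hz1 z hz) (q.neg_log_norm_lseries_le ψ hz).1)
    (fun z hz hzc => by
      have h6 := norm_le_six hc hc' hτ hz
      rw [mem_closedBall, dist_eq_norm] at hz
      have h7 := (abs_le.1 ((Complex.abs_re_le_norm (z - c)).trans hz)).1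
      rw [Complex.sub_re] at h7
      have hP := prefactor_nonneg L
      have h8 := q.norm_regularPart_le hk hL ψ (x := c.re - z.re) (by linarith) (by linarith)
        (by linarith)
      have h9 := q.norm_residue_le hk ψ
      rw [exp_add_sizeBound (by linarith)]
      rw [← hLdef] at h8 h9
      have hE1 : 1 ≤ Real.exp (L / 2 * (c.re - z.re) + 1 / 2) :=
        Real.one_le_exp (add_nonneg (mul_nonneg (by linarith) (by linarith)) (by norm_num))
      set E := Real.exp (L / 2 * (c.re - z.re) + 1 / 2)
      set P := 45 * (quarterArea + 1) * (L + 1) ^ 2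
      have h10 : 0 ≤ P * (L * E) := mul_nonneg hP (by nlinarith)
      have h11 : ‖z‖ * (P * L * E) ≤ 6 * (P * L * E) :=
        mul_le_mul_of_nonneg_right h6 (by linarith)
      have h12 : ‖z - 1‖ ≤ 7 := by
        have := norm_sub_le z 1
        rw [norm_one] at this
        linarith
      have h13 : ‖G z‖ ≤ (P + 1) * 6 + 7 * (6 * (P * L * E)) := by
        refine (norm_add_le _ _).trans ?_
        rw [norm_mul, norm_mul]
        gcongr
        exact h8.trans h11
      have h14 : (P + 1) * 1 ≤ (P + 1) * (L * E) :=
        mul_le_mul_of_nonneg_left (by nlinarith) (by linarith)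
      nlinarith)
    (fun z hz => by
      have hw : 0 < z.re - 1 := by linarith
      have h1 := (q.neg_log_norm_lseries_le ψ hz)
      rw [heq z hz, norm_mul, Real.log_mul (norm_ne_zero_iff.2 (hz1 z hz))
        (norm_ne_zero_iff.2 h1.1)]
      have h2 : z.re - 1 ≤ ‖z - 1‖ := by simpa using Complex.re_le_norm (z - 1)
      have h3 := Real.log_le_log hw h2
      have h4 := Real.one_sub_inv_le_log_of_pos hw
      have h5 : 3 / (z.re - 1) = 2 / (z.re - 1) + (z.re - 1)⁻¹ := by field_simp; ring
      linarith [h1.2])).1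
  rw [hlog, Complex.sub_re] at h
  linarith

end QuadraticBasis

end CharacterBounds

section ZeroFreeRegion

open Set Filter Topology nonZeroDivisors

theorem trigPolynomial_nonneg {a : ℕ → ℝ} (h0 : a 0 = 14379) (h1 : a 1 = 24480) (h2 : a 2 = 14900)
    (h3 : a 3 = 6000) (h4 : a 4 = 1250) (z : ℂ) (hz : ‖z‖ = 1) :
    0 ≤ ∑ j ∈ Finset.range 5, a j * (z ^ j).re := by
  have hn : z.re ^ 2 + z.im ^ 2 = 1 := by
    have := Complex.sq_norm z
    rw [hz, Complex.normSq_apply] at this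
    linarith
  have e2 : (z ^ 2).re = 2 * z.re ^ 2 - 1 := by
    rw [pow_two, Complex.mul_re]; linarith
  have e3 : (z ^ 3).re = 4 * z.re ^ 3 - 3 * z.re := by
    simp only [pow_succ, pow_zero, one_mul, Complex.mul_re, Complex.mul_im]
    linear_combination (-3 * z.re) * hn
  have e4 : (z ^ 4).re = 8 * z.re ^ 4 - 8 * z.re ^ 2 + 1 := by
    simp only [pow_succ, pow_zero, one_mul, Complex.mul_re, Complex.mul_im]
    linear_combination (z.im ^ 2 - 7 * z.re ^ 2 + 1) * hn
  simp only [Finset.sum_range_succ, Finset.sum_range_zero, pow_zero, pow_one, e2, e3, e4, h0, h1, h2,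
    h3, h4, Complex.one_re]
  have : 0 ≤ ((3 + 10 * z.re) * (9 + 10 * z.re)) ^ 2 := sq_nonneg _
  linarith

theorem eventually_sizeBound_le : ∀ᶠ L : ℝ in atTop, 10 * sizeBound L + 170 ≤ L / 100 := by
  have hq := quarterArea_nonneg
  set C := 100 * (180 * (quarterArea + 1) + 1) with hC
  have hC0 : 0 < C := by positivity
  have h1 : ∀ᶠ L : ℝ in atTop, ‖Real.log L‖ ≤ 1 / 6000 * ‖id L‖ :=
    Real.isLittleO_log_id_atTop.def (by norm_num)
  filter_upwards [h1, eventually_ge_atTop 1, eventually_ge_atTop (200 * (10 * Real.log C + 175))]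
    with L hL1 hL2 hL3
  rw [id, Real.norm_of_nonneg (Real.log_nonneg hL2), Real.norm_of_nonneg (by linarith)] at hL1
  have h2 : 100 * (45 * (quarterArea + 1) * (L + 1) ^ 2 + 1) * L ≤ C * L ^ 3 := by
    have h3 : (L + 1) ^ 2 ≤ 4 * L ^ 2 := by nlinarith
    have h4 : 45 * (quarterArea + 1) * (L + 1) ^ 2 ≤ 45 * (quarterArea + 1) * (4 * L ^ 2) := by gcongr
    have h5 : (1 : ℝ) ≤ L ^ 2 := one_le_pow₀ hL2
    calc _ ≤ 100 * (45 * (quarterArea + 1) * (4 * L ^ 2) + L ^ 2) * L := by gcongr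
      _ = _ := by rw [hC]; ring
  have h6 := Real.log_le_log (by positivity) h2
  rw [Real.log_mul hC0.ne' (by positivity), Real.log_pow] at h6
  push_cast at h6
  rw [sizeBound]
  linarith

variable {R : Type*} [CommRing R] [IsDedekindDomain R] [Module.Free ℤ R] [Module.Finite ℤ R]
  [CharZero R] [Fintype (ClassGroup R)]

namespace QuadraticBasis

variable {k : ℕ}

omit [Module.Finite ℤ R] [CharZero R] in
theorem sq_ne_one_of_ne_one (q : QuadraticBasis R k) (hp : (4 * k - 1 : ℕ).Prime) (hk : 1 < k)
    {ψ : ClassGroup R →* ℂ} (hψ : ψ ≠ 1) : ψ ^ 2 ≠ 1 := by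
  intro h
  have hinj : Function.Injective fun C : ClassGroup R => C ^ 2 := by
    intro C C' hCC
    have h1 : (C / C') ^ 2 = 1 := by
      rw [div_pow]; exact div_eq_one.2 hCC
    exact div_eq_one.1 (q.eq_one_of_sq_eq_one hp hk h1)
  refine hψ (MonoidHom.ext fun C => ?_)
  obtain ⟨C', rfl⟩ := (Finite.injective_iff_surjective.1 hinj) C
  have := DFunLike.congr_fun h C'
  rw [MonoidHom.pow_apply] at this
  simpa using this

omit [Module.Finite ℤ R] [CharZero R] [Module.Free ℤ R] in
theorem sq_apply_eq_conj {ψ : ClassGroup R →* ℂ} (hψ : ψ ^ 3 = 1) (C : ClassGroup R) :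
    (ψ ^ 2) C = (starRingEnd ℂ) (ψ C) := by
  have h1 := DFunLike.congr_fun hψ C
  rw [MonoidHom.pow_apply, MonoidHom.one_apply] at h1
  have h2 := norm_map_eq_one ψ C
  have h0 : ψ C ≠ 0 := fun h => by rw [h, norm_zero] at h2; exact zero_ne_one h2
  have h3 : ψ C * (starRingEnd ℂ) (ψ C) = 1 := by
    rw [Complex.mul_conj, Complex.normSq_eq_norm_sq, h2]; simp
  rw [MonoidHom.pow_apply]
  refine mul_left_cancel₀ h0 ?_
  rw [h3, ← h1]; ring

theorem regularPart_conj_eq_zero {ψ : ClassGroup R →* ℂ} (hψ : ψ ≠ 1) (hψ2 : ψ ^ 2 ≠ 1)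
    (hψ3 : ψ ^ 3 = 1) {ρ : ℂ} (hρ : regularPart k ψ ρ = 0) :
    regularPart k (ψ ^ 2) ((starRingEnd ℂ) ρ) = 0 := by
  have h1 : ∀ n, coef (ψ ^ 2) n = (starRingEnd ℂ) (coef ψ n) := fun n => by
    rw [coef, coef, map_sum]
    exact Finset.sum_congr rfl fun I _ => sq_apply_eq_conj hψ3 _
  suffices h : regularPart k (ψ ^ 2) ((starRingEnd ℂ) ρ) = (starRingEnd ℂ) (regularPart k ψ ρ) by
    rw [h, hρ, map_zero]
  rw [regularPart, regularPart, remainderIntegral, remainderIntegral, residue_eq_zero hψ,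
    residue_eq_zero hψ2, map_mul, ← integral_conj]
  congr 1
  refine MeasureTheory.setIntegral_congr_fun measurableSet_Ioi fun t ht => ?_
  have ht0 : (0 : ℝ) < t := one_pos.trans (mem_Ioi.1 ht)
  simp only [remainder, zero_mul, sub_zero, h1, map_mul, map_sum]
  congr 1
  have harg : (t : ℂ).arg ≠ Real.pi := by
    rw [Complex.arg_ofReal_of_nonneg ht0.le]; exact Real.pi_pos.ne
  rw [show -((starRingEnd ℂ) ρ + 1) = (starRingEnd ℂ) (-(ρ + 1)) by simp,
    Complex.cpow_conj _ _ harg, Complex.conj_ofReal]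

theorem cubic_compensation {L y g : ℝ} (hL : 0 < L) (hg : 0 ≤ g) (hy1 : 0.2734 / L ≤ y)
    (hy2 : y ≤ (0.2734 + 1 / 12) / L) :
    6000 * ((0.2734 / L) / ((0.2734 / L) ^ 2 + g)) ≤ 14900 * (y / (y ^ 2 + g)) := by
  set x := 0.2734 / L with hx
  have hx0 : 0 < x := by positivity
  have hy3 : y ≤ 1.31 * x := by
    refine hy2.trans ?_
    rw [hx, mul_div_assoc', div_le_div_iff_of_pos_right hL]
    norm_num
  have hy0 : 0 < y := hx0.trans_le hy1
  clear_value x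
  rw [mul_div_assoc', mul_div_assoc', div_le_div_iff₀ (by positivity) (by positivity)]
  have h1 : y ^ 2 + g ≤ 2 * (x ^ 2 + g) := by nlinarith
  have h2 : x * (y ^ 2 + g) ≤ y * (2 * (x ^ 2 + g)) := by
    gcongr
  have h3 : 0 ≤ y * (x ^ 2 + g) := by positivity
  linarith

theorem zeroFree (q : QuadraticBasis R k) (hp : (4 * k - 1 : ℕ).Prime) (hk : 1 < k)
    (hL : 4 ≤ Real.log (4 * k - 1))
    (hsize : 10 * sizeBound (Real.log (4 * k - 1)) + 170 ≤ Real.log (4 * k - 1) / 100)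
    {ψ : ClassGroup R →* ℂ} (hψ : ψ ≠ 1) {ρ : ℂ} (hρ : regularPart k ψ ρ = 0) (hγ : |ρ.im| ≤ 1) :
    ρ.re ≤ 1 - 1 / 12 / Real.log (4 * k - 1) := by
  set L := Real.log (4 * k - 1) with hLdef
  by_contra! hβ
  have hL0 : 0 < L := by linarith
  have hβ1 : ρ.re ≤ 1 := by
    by_contra! h
    have h1 := q.lseries_eq hk ψ h
    rw [residue_eq_zero hψ, hρ] at h1
    exact (q.neg_log_norm_lseries_le ψ h).1 (by rw [h1]; simp)
  set σ : ℝ := 1 + 0.2734 / L with hσ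
  have hx0 : 0 < 0.2734 / L := by positivity
  have hx1 : 0.2734 / L ≤ 1 / 10 := by
    rw [div_le_iff₀ hL0]; linarith
  have hσ1 : 1 < σ := by linarith
  set s : ℕ → ℂ := fun j => σ + j * ρ.im * Complex.I with hs
  have hsre : ∀ j, (s j).re = σ := fun j => by simp [hs]
  have hsim : ∀ j, (s j).im = j * ρ.im := fun j => by simp [hs]
  have hs1 : ∀ j, 1 < (s j).re := fun j => by rw [hsre]; exact hσ1
  have hs2 : ∀ j, (s j).re ≤ 5 / 4 := fun j => by rw [hsre]; linarith
  have hs3 : ∀ j : ℕ, j ≤ 4 → |(s j).im| ≤ 4 := fun j hj => by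
    have hj' : (j : ℝ) ≤ 4 := by exact_mod_cast hj
    rw [hsim, abs_mul, Nat.abs_cast]
    nlinarith [abs_nonneg ρ.im]
  set Z : ℕ → ℝ := fun j => (LSeries (mangoldtCoef (ψ ^ j)) (s j)).re with hZ
  set E := 10 * sizeBound L + 150 with hE
  have hψ2 : ψ ^ 2 ≠ 1 := q.sq_ne_one_of_ne_one hp hk hψ
  have hψ4 : ψ ^ 4 ≠ 1 := by
    have := q.sq_ne_one_of_ne_one hp hk hψ2
    rwa [← pow_mul] at this
  set y := σ - ρ.re with hy
  have hy1 : 0.2734 / L ≤ y := by rw [hy, hσ]; linarith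
  have hy2 : y ≤ (0.2734 + 1 / 12) / L := by
    rw [add_div, hy, hσ]; linarith
  have hy0 : 0 < y := by linarith
  have hy3 : y ≤ 1 / 5 := by
    refine hy2.trans ?_
    rw [div_le_iff₀ hL0]; linarith
  have hpos : 0 ≤ 14379 * Z 0 + 24480 * Z 1 + 14900 * Z 2 + 6000 * Z 3 + 1250 * Z 4 := by
    set a : ℕ → ℝ := fun j => if j = 0 then 14379 else if j = 1 then 24480 else if j = 2 then 14900
      else if j = 3 then 6000 else 1250 with ha
    have h := q.sum_mangoldt_nonneg ψ (m := 5) (a := a)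
      (trigPolynomial_nonneg (by simp [ha]) (by simp [ha]) (by simp [ha]) (by simp [ha])
        (by simp [ha])) hσ1 ρ.im
    simpa [Finset.sum_range_succ, ha, hZ, hs] using h
  have hZ0 : Z 0 ≤ L / 4 + E + L / 0.2734 := by
    have h := q.re_mangoldt_one_le hk hL (hs1 0) (hs2 0) (hs3 0 (by norm_num))
    have h1 : (1 / (s 0 - 1)).re = L / 0.2734 := by
      have : s 0 - 1 = ((0.2734 / L : ℝ) : ℂ) := by
        apply Complex.ext <;> simp [hs, hσ]
      rw [this, ← Complex.ofReal_one, ← Complex.ofReal_div, Complex.ofReal_re, one_div_div]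
    rw [h1, ← pow_zero ψ] at h
    exact h
  have hZ1 : Z 1 ≤ L / 4 + E - L / (0.2734 + 1 / 12) + 5 := by
    have h := (q.re_mangoldt_le_of_ne_one hk hL hψ (hs1 1) (hs2 1) (hs3 1 (by norm_num))).2 ρ hρ
      (by rw [hsre]; linarith)
    have h1 : s 1 - ρ = (y : ℂ) := by
      apply Complex.ext <;> simp [hs, hy]
    rw [h1, Complex.ofReal_re, Complex.norm_real, Real.norm_of_nonneg hy0.le] at h
    have h2 : L / (0.2734 + 1 / 12) ≤ y / y ^ 2 := by
      rw [pow_two, div_mul_cancel_left₀ hy0.ne', ← one_div, le_div_iff₀ hy0]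
      calc _ ≤ L / (0.2734 + 1 / 12) * ((0.2734 + 1 / 12) / L) := by gcongr
        _ = 1 := by field_simp
    simp only [hZ, pow_one]
    linarith
  have hZ2 := (q.re_mangoldt_le_of_ne_one hk hL hψ2 (hs1 2) (hs2 2) (hs3 2 (by norm_num))).1
  have hZ4 := (q.re_mangoldt_le_of_ne_one hk hL hψ4 (hs1 4) (hs2 4) (hs3 4 (by norm_num))).1
  have hZ23 : 14900 * Z 2 + 6000 * Z 3 ≤ 20900 * (L / 4 + E) + 74500 := by
    by_cases hψ3 : ψ ^ 3 = 1
    · have h2 := (q.re_mangoldt_le_of_ne_one hk hL hψ2 (hs1 2) (hs2 2) (hs3 2 (by norm_num))).2 _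
        (regularPart_conj_eq_zero hψ hψ2 hψ3 hρ) (by rw [hsre, Complex.conj_re]; linarith)
      have h3 := q.re_mangoldt_one_le hk hL (hs1 3) (hs2 3) (hs3 3 (by norm_num))
      have e1 : (s 2 - (starRingEnd ℂ) ρ).re = y := by simp [hs, hy]
      have e2 : ‖s 2 - (starRingEnd ℂ) ρ‖ ^ 2 = y ^ 2 + 9 * ρ.im ^ 2 := by
        rw [Complex.sq_norm, Complex.normSq_apply, e1, Complex.sub_im, Complex.conj_im, hsim]
        push_cast; ring
      have e3 : (1 / (s 3 - 1)).re = (0.2734 / L) / ((0.2734 / L) ^ 2 + 9 * ρ.im ^ 2) := by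
        have e4 : (s 3 - 1).re = 0.2734 / L := by rw [Complex.sub_re, hsre, hσ]; simp
        rw [one_div, Complex.inv_re, Complex.normSq_apply, e4, Complex.sub_im, hsim]
        congr 1
        simp; ring
      rw [e1, e2] at h2
      rw [e3, ← hψ3] at h3
      have h5 := cubic_compensation hL0 (g := 9 * ρ.im ^ 2) (by positivity) hy1 hy2
      simp only [hZ]
      linarith
    · have h3 := (q.re_mangoldt_le_of_ne_one hk hL hψ3 (hs1 3) (hs2 3) (hs3 3 (by norm_num))).1
      simp only [hZ]
      linarith
  have hZ4' : Z 4 ≤ L / 4 + E := hZ4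
  norm_num at hZ0 hZ1
  linarith

end QuadraticBasis

end ZeroFreeRegion

open nonZeroDivisors in
theorem lambdaChi_eq_coef {K : Type} [Field K] [NumberField K] (χ : ClassGroup (𝓞 K) →* ℂ) (n : ℕ) :
    lambdaChi K χ n = coef χ n := by
  have himage : {I : Ideal (𝓞 K) | Ideal.absNorm I = n ∧ I ≠ 0} =
      (((normLe (𝓞 K) n).filter fun I : (Ideal (𝓞 K))⁰ =>
        Ideal.absNorm (I : Ideal (𝓞 K)) = n).image
        Subtype.val : Finset (Ideal (𝓞 K))) := by
    ext I
    simp only [Set.mem_ofPred_eq, Finset.coe_image, Set.mem_image, Finset.mem_coe,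
      mem_filter_normLe le_rfl]
    exact ⟨fun h => ⟨⟨I, mem_nonZeroDivisors_of_ne_zero h.2⟩, h.1, rfl⟩,
      by rintro ⟨J, hJ, rfl⟩; exact ⟨hJ, nonZeroDivisors.ne_zero J.2⟩⟩
  rw [lambdaChi, himage, finsum_mem_coe_finset,
    Finset.sum_image fun _ _ _ _ h => Subtype.ext h, coef]
  exact Finset.sum_congr rfl fun I _ => by rw [idealClass, dif_pos I.2]

theorem tsum_lambdaChi_eq_lseries {K : Type} [Field K] [NumberField K]
    (χ : ClassGroup (𝓞 K) →* ℂ) (s : ℂ) :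
    ∑' n : ℕ, lambdaChi K χ n / (n : ℂ) ^ s = LSeries (coef χ) s := by
  refine tsum_congr fun n => ?_
  rw [lambdaChi_eq_coef]
  rcases eq_or_ne n 0 with rfl | hn
  · have h0 : coef χ 0 = 0 := by
      rw [coef, Finset.sum_filter]
      exact Finset.sum_eq_zero fun I _ => if_neg (absNorm_pos_of_nonZeroDivisors I).ne'
    rw [h0, zero_div, LSeries.term_zero]
  · rw [LSeries.term_of_ne_zero hn]

theorem QuadraticBasis.eq_regularPart {R : Type*} [CommRing R] [IsDedekindDomain R]
    [Module.Free ℤ R] [Module.Finite ℤ R] [CharZero R] [Fintype (ClassGroup R)] {k : ℕ}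
    (q : QuadraticBasis R k) (hk : 1 < k) {ψ : ClassGroup R →* ℂ} (hψ : ψ ≠ 1) {F : ℂ → ℂ}
    (hF : Differentiable ℂ F) (hFL : ∀ s : ℂ, 1 < s.re → F s = LSeries (coef ψ) s) {s : ℂ}
    (hs : 1 / 2 < s.re) : F s = regularPart k ψ s := by
  have hopen : ∀ a : ℝ, IsOpen {z : ℂ | a < z.re} := fun a =>
    isOpen_lt continuous_const Complex.continuous_re
  refine AnalyticOnNhd.eqOn_of_preconnected_of_eventuallyEq (U := {z : ℂ | 1 / 2 < z.re}) (z₀ := 2)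
    (DifferentiableOn.analyticOnNhd hF.differentiableOn (hopen _))
    (DifferentiableOn.analyticOnNhd (fun z hz =>
      (q.differentiableAt_regularPart hk ψ hz).differentiableWithinAt) (hopen _))
    (convex_halfSpace_re_gt _).isPreconnected (by simp; norm_num) ?_ hs
  filter_upwards [(hopen 1).mem_nhds (show (2 : ℂ) ∈ {z : ℂ | 1 < z.re} by simp)] with z hz
  rw [hFL z hz, q.lseries_eq hk ψ hz, residue_eq_zero hψ, zero_mul, zero_div, zero_add]

theorem class_group_L_function_zero_free_region :
    ∃ D₀ : ℕ, ∀ (c : ℝ), 0 < c → c ≤ 1 / 12 →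
    ∀ (D : ℕ) [Fact (Nat.Prime D)], D₀ < D → 3 < D → D % 4 = 3 → HypH c D →
    ∀ (K : Type) [Field K] [NumberField K], Module.finrank ℚ K = 2 →
      (∃ α : K, α ^ 2 = -(D : K)) →
    ∀ χ : ClassGroup (𝓞 K) →* ℂ, χ ≠ 1 →
    ∀ F : ℂ → ℂ, Differentiable ℂ F →
      (∀ s : ℂ, 1 < s.re → F s = ∑' n : ℕ, lambdaChi K χ n / (n : ℂ) ^ s) →
    ∀ ρ : ℂ, F ρ = 0 → |ρ.im| ≤ 1 → ρ.re ≤ 1 - c / Real.log D := by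
  obtain ⟨L₀, hL₀⟩ := Filter.eventually_atTop.1
    (eventually_sizeBound_le.and (Filter.eventually_ge_atTop (4 : ℝ)))
  refine ⟨⌈Real.exp L₀⌉₊, fun c _ hc D hD hD₀ hD3 hD4 _ K _ _ hK hα χ hχ F hF hFχ ρ hρ hγ => ?_⟩
  obtain ⟨q⟩ := nonempty_quadraticBasis hD.out hD4 K hK hα
  set k := (D + 1) / 4
  have hk : 1 < k := by omega
  have hDk : 4 * k - 1 = D := by omega
  have hDk' : (4 * (k : ℝ) - 1) = D := by
    rw [← hDk, Nat.cast_sub (by omega)]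
    push_cast; ring
  have hlog : L₀ ≤ Real.log D := by
    rw [Real.le_log_iff_exp_le (by exact_mod_cast hD.out.pos)]
    exact (Nat.lt_of_ceil_lt hD₀).le
  obtain ⟨hsize, hL⟩ := hL₀ _ hlog
  have hcL : c / Real.log D ≤ 1 / 12 / Real.log D := by gcongr
  rcases le_or_gt ρ.re (1 / 2) with h | h
  · have : 1 / 12 / Real.log D ≤ 1 / 2 := by
      rw [div_le_iff₀ (by linarith)]; linarith
    linarith
  · have hρ' : QuadraticBasis.regularPart k χ ρ = 0 := by
      rw [← q.eq_regularPart hk hχ hF (fun s hs => (hFχ s hs).trans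
        (tsum_lambdaChi_eq_lseries χ s)) h, hρ]
    have := q.zeroFree (hDk.symm ▸ hD.out) hk (by rwa [hDk']) (by rwa [hDk']) hχ hρ' hγ
    rw [hDk'] at this
    linarith
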